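/- For 3/4 ≤ c < 1 let A_c be the unique smooth solution, with derivatives up to order 10 square-integrable, of (L A_c)' + √c(1 − c) A_c = (e^{−√c x} Q³)', and let a_c^I = lim_{x→+∞} A_c(x) e^{γ_c^I x} with γ_c^I = √(1 − (3/4)c) − (1/2)√c. Then: (1) for each c ∈ (3/4, 1) there is C = C(c) such that for all c̃ close enough to c, ∑_{k=0}^3 ∫ |A_c^{(k)} − A_{c̃}^{(k)}|² ≤ C² |c − c̃|²; and (2) the map c ↦ a_c^I is continuous on [3/4, 1); in particular a_c^I has a constant sign on [3/4, 1). -/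

import Mathlib

open Real MeasureTheory Filter

noncomputable def Q (x : ℝ) : ℝ := (5 / (2 * Real.cosh (3 * x / 2) ^ 2)) ^ ((1:ℝ)/3)

/-- The linearized operator `L f = −f'' + f − 4Q³ f`. -/
noncomputable def LQ (f : ℝ → ℝ) : ℝ → ℝ :=
  fun x => -iteratedDeriv 2 f x + f x - 4 * (Q x) ^ 3 * f x

/-- `A` is the solution of `(L A)' + √c(1−c) A = (e^{−√c x} Q³)'` which is smooth with
square-integrable derivatives up to order 10. -/
noncomputable def IsAc (c : ℝ) (A : ℝ → ℝ) : Prop :=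
  ContDiff ℝ (⊤ : ℕ∞) A ∧
  (∀ k : ℕ, k ≤ 10 → Integrable (fun x => (iteratedDeriv k A x) ^ 2)) ∧
  (∀ x : ℝ, deriv (LQ A) x + Real.sqrt c * (1 - c) * A x
    = deriv (fun y => Real.exp (-(Real.sqrt c) * y) * (Q y) ^ 3) x)

/-- The hyperbolic tangent profile, which satisfies `Q' = -Th Q`. -/
noncomputable def Th (x : ℝ) : ℝ := Real.tanh (3 * x / 2)

lemma hasDerivAt_Th (x : ℝ) : HasDerivAt Th (3 / 2 * (1 - Th x ^ 2)) x := by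
  have h1 : HasDerivAt (fun y : ℝ => 3 * y / 2) (3 / 2) x := by
    simpa using ((hasDerivAt_id x).const_mul 3).div_const 2
  have hc : Real.cosh (3 * x / 2) ≠ 0 := (Real.cosh_pos _).ne'
  have h2 := h1.sinh.div h1.cosh hc
  have e : Th = fun y : ℝ => Real.sinh (3 * y / 2) / Real.cosh (3 * y / 2) := by
    funext y; rw [Th, Real.tanh_eq_sinh_div_cosh]
  rw [e]
  refine h2.congr_deriv ?_
  field_simp

lemma Th_sq_lt_one (x : ℝ) : Th x ^ 2 < 1 := Real.tanh_sq_lt_one _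

lemma abs_Th_lt_one (x : ℝ) : |Th x| < 1 := by
  have := Th_sq_lt_one x
  rw [← sq_abs] at this
  nlinarith [abs_nonneg (Th x)]

lemma Q_pos (x : ℝ) : 0 < Q x := by
  have := Real.cosh_pos (3 * x / 2)
  unfold Q; positivity

lemma Q_cube_cosh (x : ℝ) : Q x ^ 3 = 5 / (2 * Real.cosh (3 * x / 2) ^ 2) := by
  have := Real.cosh_pos (3 * x / 2)
  unfold Q
  rw [← Real.rpow_natCast, ← Real.rpow_mul (by positivity)]
  norm_num

lemma Q_cube (x : ℝ) : Q x ^ 3 = 5 / 2 * (1 - Th x ^ 2) := by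
  have h := Real.cosh_pos (3 * x / 2)
  rw [Q_cube_cosh, Th, Real.tanh_eq_sinh_div_cosh]
  have := Real.cosh_sq (3 * x / 2)
  field_simp
  linarith

lemma contDiff_Q : ContDiff ℝ (⊤ : ℕ∞) Q := by
  have h : ContDiff ℝ (⊤ : ℕ∞) (fun x : ℝ => 5 / (2 * Real.cosh (3 * x / 2) ^ 2)) := by
    refine contDiff_const.div
      (contDiff_const.mul ((Real.contDiff_cosh.comp (by fun_prop)).pow 2)) ?_
    intro x
    have := Real.cosh_pos (3 * x / 2)
    positivity
  refine h.rpow_const_of_ne ?_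
  intro x
  have := Real.cosh_pos (3 * x / 2)
  positivity

lemma continuous_Q : Continuous Q := contDiff_Q.continuous

lemma continuous_Th : Continuous Th :=
  continuous_iff_continuousAt.2 fun x => (hasDerivAt_Th x).continuousAt

lemma hasDerivAt_Q (x : ℝ) : HasDerivAt Q (-(Th x * Q x)) x := by
  have hd : HasDerivAt Q (deriv Q x) x :=
    (contDiff_Q.differentiable (by simp) x).hasDerivAt
  have h3 := hd.fun_pow 3
  have h4 : HasDerivAt (fun y => Q y ^ 3) (5 / 2 * (-(2 * Th x * (3 / 2 * (1 - Th x ^ 2))))) x := by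
    have e : (fun y => Q y ^ 3) = fun y => 5 / 2 * (1 - Th y ^ 2) := funext Q_cube
    rw [e]
    have := (((hasDerivAt_Th x).fun_pow 2).const_sub 1).const_mul (5 / 2)
    refine this.congr_deriv ?_
    norm_num
  have h5 := h3.unique h4
  have hq := Q_pos x
  have hc := Q_cube x
  have : deriv Q x = -(Th x * Q x) := by
    have h6 : Q x ^ 2 * (deriv Q x + Th x * Q x) = 0 := by
      norm_num at h5
      linear_combination h5 / 3 + Th x * hc
    rcases mul_eq_zero.1 h6 with h7 | h7
    · exact absurd h7 (by positivity)
    · linarith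
  rwa [this] at hd

lemma hasDerivAt_Q_cube (x : ℝ) : HasDerivAt (fun y => Q y ^ 3) (-(3 * Th x * Q x ^ 3)) x := by
  refine ((hasDerivAt_Q x).fun_pow 3).congr_deriv ?_
  norm_num; ring

lemma Th_neg (x : ℝ) : Th (-x) = -Th x := by
  rw [Th, Th, ← Real.tanh_neg]; congr 1; ring

lemma Th_zero : Th 0 = 0 := by simp [Th]

lemma Q_neg (x : ℝ) : Q (-x) = Q x := by
  have : (3 * -x / 2 : ℝ) = -(3 * x / 2) := by ring
  rw [Q, Q, this, Real.cosh_neg]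

lemma Q_cube_le (x : ℝ) : Q x ^ 3 ≤ 10 * Real.exp (-3 * |x|) := by
  have key : ∀ y : ℝ, 0 ≤ y → Q y ^ 3 ≤ 10 * Real.exp (-3 * y) := by
    intro y hy
    rw [Q_cube_cosh, Real.cosh_eq, div_le_iff₀ (by positivity)]
    have e : Real.exp (-3 * y) = (Real.exp (3 * y / 2))⁻¹ ^ 2 := by
      rw [← Real.exp_neg, ← Real.exp_nat_mul]; congr 1; push_cast; ring
    rw [e, Real.exp_neg]
    have h := Real.exp_pos (3 * y / 2)
    have : 1 ≤ (Real.exp (3 * y / 2))⁻¹ * (Real.exp (3 * y / 2) + (Real.exp (3 * y / 2))⁻¹) := by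
      rw [mul_add, inv_mul_cancel₀ h.ne']
      have : 0 < (Real.exp (3 * y / 2))⁻¹ := by positivity
      nlinarith
    nlinarith
  rcases abs_cases x with ⟨h, hx⟩ | ⟨h, hx⟩
  · rw [h]; exact key x hx
  · rw [h, ← Q_neg]; exact key (-x) (by linarith)

lemma Q_le (x : ℝ) : Q x ≤ 3 * Real.exp (-|x|) := by
  have h := Q_cube_le x
  have e : Real.exp (-3 * |x|) = Real.exp (-|x|) ^ 3 := by
    rw [← Real.exp_nat_mul]; congr 1; push_cast; ring
  refine le_of_pow_le_pow_left₀ (n := 3) (by norm_num) (by positivity) ?_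
  rw [e] at h
  have : 0 < Real.exp (-|x|) ^ 3 := by positivity
  nlinarith

lemma Q_cube_le_const (x : ℝ) : Q x ^ 3 ≤ 5 / 2 := by
  rw [Q_cube]; nlinarith [sq_nonneg (Th x)]

section L2

variable {X : Type*} [MeasurableSpace X] {μ : Measure X} {f g : X → ℝ}

lemma MeasureTheory.MemLp.integrable_two_mul (hf : MemLp f 2 μ) (hg : MemLp g 2 μ) :
    Integrable (fun x => f x * g x) μ := hf.integrable_mul hg

/-- The Cauchy–Schwarz inequality for real square-integrable functions. -/
lemma sq_integral_mul_le (hf : MemLp f 2 μ) (hg : MemLp g 2 μ) :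
    (∫ x, f x * g x ∂μ) ^ 2 ≤ (∫ x, f x ^ 2 ∂μ) * ∫ x, g x ^ 2 ∂μ := by
  have h : ∀ t : ℝ, 0 ≤ (∫ x, g x ^ 2 ∂μ) * (t * t) + (2 * ∫ x, f x * g x ∂μ) * t
      + ∫ x, f x ^ 2 ∂μ := by
    intro t
    have h1 : 0 ≤ ∫ x, (f x + t * g x) ^ 2 ∂μ := integral_nonneg fun x => sq_nonneg _
    have e : ∀ x, (f x + t * g x) ^ 2 = g x ^ 2 * (t * t) + f x * g x * (2 * t) + f x ^ 2 := by
      intro x; ring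
    simp_rw [e] at h1
    have i1 : Integrable (fun x => g x ^ 2 * (t * t)) μ := hg.integrable_sq.mul_const _
    have i2 : Integrable (fun x => f x * g x * (2 * t)) μ := (hf.integrable_two_mul hg).mul_const _
    rw [integral_add (by fun_prop) hf.integrable_sq, integral_add i1 i2,
      integral_mul_const, integral_mul_const] at h1
    linarith
  have := discrim_le_zero h
  rw [discrim] at this
  linarith

lemma integral_add_sq_le (hf : MemLp f 2 μ) (hg : MemLp g 2 μ) :
    ∫ x, (f x + g x) ^ 2 ∂μ ≤ 2 * (∫ x, f x ^ 2 ∂μ) + 2 * ∫ x, g x ^ 2 ∂μ := by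
  rw [← integral_const_mul, ← integral_const_mul,
    ← integral_add (hf.integrable_sq.const_mul _) (hg.integrable_sq.const_mul _)]
  refine integral_mono (hf.add hg).integrable_sq
    ((hf.integrable_sq.const_mul _).add (hg.integrable_sq.const_mul _)) fun x => ?_
  simp only
  nlinarith [sq_nonneg (f x - g x)]

lemma integral_mul_le_add_sq (hf : MemLp f 2 μ) (hg : MemLp g 2 μ) {η : ℝ} (hη : 0 < η) :
    ∫ x, f x * g x ∂μ ≤ η * (∫ x, f x ^ 2 ∂μ) + (1 / η) * ∫ x, g x ^ 2 ∂μ := by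
  rw [← integral_const_mul, ← integral_const_mul,
    ← integral_add (hf.integrable_sq.const_mul _) (hg.integrable_sq.const_mul _)]
  refine integral_mono (hf.integrable_two_mul hg)
    ((hf.integrable_sq.const_mul _).add (hg.integrable_sq.const_mul _)) fun x => ?_
  have : η * f x ^ 2 + 1 / η * g x ^ 2 - f x * g x
      = η * (f x - g x / (2 * η)) ^ 2 + 3 / (4 * η) * g x ^ 2 := by field_simp; ring
  have h2 : 0 ≤ η * (f x - g x / (2 * η)) ^ 2 + 3 / (4 * η) * g x ^ 2 := by positivity
  change f x * g x ≤ η * f x ^ 2 + 1 / η * g x ^ 2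
  linarith

lemma MeasureTheory.MemLp.bounded_mul (hf : MemLp f 2 μ) (hg : AEStronglyMeasurable g μ) {C : ℝ}
    (hC : ∀ x, |g x| ≤ C) : MemLp (fun x => g x * f x) 2 μ := by
  refine MemLp.of_le_mul (c := C) hf (hg.mul hf.aestronglyMeasurable) (ae_of_all _ fun x => ?_)
  rw [norm_mul]
  exact mul_le_mul_of_nonneg_right (hC x) (norm_nonneg _)

lemma MeasureTheory.MemLp.of_forall_eq {p : ENNReal} (hf : MemLp f p μ) (h : ∀ x, f x = g x) :
    MemLp g p μ := by
  rwa [← funext h]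

end L2

/-- A measurable function dominated by exponentials decaying at both ends is integrable. -/
lemma integrable_of_exp_bounds {f : ℝ → ℝ} (hf : AEStronglyMeasurable f) {a b C : ℝ} (ha : 0 < a)
    (hb : 0 < b) (hl : ∀ x ≤ 0, |f x| ≤ C * exp (a * x))
    (hr : ∀ x, 0 ≤ x → |f x| ≤ C * exp (-b * x)) :
    Integrable f := by
  rw [← integrableOn_univ, ← Set.Iic_union_Ioi (a := (0 : ℝ))]
  refine IntegrableOn.union ?_ ?_
  · refine Integrable.mono' ((integrableOn_exp_mul_Iic ha 0).const_mul C) hf.restrict ?_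
    filter_upwards [ae_restrict_mem measurableSet_Iic] with x hx
    exact hl x hx
  · refine Integrable.mono' ((exp_neg_integrableOn_Ioi 0 hb).const_mul C) hf.restrict ?_
    filter_upwards [ae_restrict_mem measurableSet_Ioi] with x hx
    exact hr x (le_of_lt hx)

lemma integrable_exp_neg_abs {a : ℝ} (ha : 0 < a) : Integrable fun x : ℝ => exp (-a * |x|) := by
  refine integrable_of_exp_bounds (Continuous.aestronglyMeasurable (by fun_prop)) ha ha
    (C := 1) (fun x hx => ?_) (fun x hx => ?_)
  · rw [abs_of_nonpos hx, abs_of_pos (exp_pos _)]; simp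
  · rw [abs_of_nonneg hx, abs_of_pos (exp_pos _)]; simp

lemma memLp_two_of_exp_bound {f : ℝ → ℝ} (hf : Continuous f) {C : ℝ}
    (h : ∀ x, |f x| ≤ C * exp (-(1 / 2) * |x|)) : MemLp f 2 := by
  rw [memLp_two_iff_integrable_sq hf.aestronglyMeasurable]
  refine Integrable.mono' ((integrable_exp_neg_abs one_pos).const_mul (C ^ 2))
    (hf.pow 2).aestronglyMeasurable (ae_of_all _ fun x => ?_)
  rw [Real.norm_eq_abs, abs_pow]
  have : exp (-1 * |x|) = exp (-(1 / 2) * |x|) ^ 2 := by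
    rw [← Real.exp_nat_mul]; congr 1; push_cast; ring
  rw [this, ← mul_pow]
  exact pow_le_pow_left₀ (abs_nonneg _) (h x) 2

lemma tendsto_zero_of_memLp_two_atTop {f f' : ℝ → ℝ} (hd : ∀ x, HasDerivAt f (f' x) x)
    (hf : MemLp f 2) (hf' : MemLp f' 2) : Tendsto f atTop (nhds 0) := by
  have h : Tendsto (fun x => f x ^ 2) atTop (nhds 0) := by
    refine tendsto_zero_of_hasDerivAt_of_integrableOn_Ioi (a := 0)
      (f' := fun x => 2 * (f x * f' x)) (fun x _ => ?_)
      ((hf.integrable_two_mul hf').const_mul 2).integrableOn hf.integrable_sq.integrableOn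
    refine ((hd x).fun_pow 2).congr_deriv ?_
    norm_num; ring
  have h2 := h.sqrt
  simp only [Real.sqrt_sq_eq_abs, Real.sqrt_zero] at h2
  exact (tendsto_zero_iff_abs_tendsto_zero _).2 h2

lemma tendsto_zero_of_memLp_two_atBot {f f' : ℝ → ℝ} (hd : ∀ x, HasDerivAt f (f' x) x)
    (hf : MemLp f 2) (hf' : MemLp f' 2) : Tendsto f atBot (nhds 0) := by
  have h : Tendsto (fun x => f x ^ 2) atBot (nhds 0) := by
    refine tendsto_zero_of_hasDerivAt_of_integrableOn_Iic (a := 0)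
      (f' := fun x => 2 * (f x * f' x)) (fun x _ => ?_)
      ((hf.integrable_two_mul hf').const_mul 2).integrableOn hf.integrable_sq.integrableOn
    refine ((hd x).fun_pow 2).congr_deriv ?_
    norm_num; ring
  have h2 := h.sqrt
  simp only [Real.sqrt_sq_eq_abs, Real.sqrt_zero] at h2
  exact (tendsto_zero_iff_abs_tendsto_zero _).2 h2

/-- The one-dimensional Sobolev inequality. -/
lemma sq_le_of_memLp_two {f f' : ℝ → ℝ} (hd : ∀ x, HasDerivAt f (f' x) x)
    (hf : MemLp f 2) (hf' : MemLp f' 2) (x : ℝ) :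
    f x ^ 2 ≤ (∫ y, f y ^ 2) + ∫ y, f' y ^ 2 := by
  have ht : Tendsto (fun x => f x ^ 2) atBot (nhds 0) := by
    simpa using (tendsto_zero_of_memLp_two_atBot hd hf hf').pow 2
  have h := integral_Iic_of_hasDerivAt_of_tendsto' (a := x) (f := fun x => f x ^ 2)
    (f' := fun x => 2 * (f x * f' x))
    (fun y _ => ((hd y).fun_pow 2).congr_deriv (by norm_num; ring))
    ((hf.integrable_two_mul hf').const_mul 2).integrableOn ht
  rw [sub_zero] at h
  rw [← h, ← integral_add hf.integrable_sq hf'.integrable_sq]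
  have hi : Integrable fun y => f y ^ 2 + f' y ^ 2 := hf.integrable_sq.add hf'.integrable_sq
  refine le_trans (integral_mono ((hf.integrable_two_mul hf').const_mul 2).integrableOn
    hi.integrableOn fun y => ?_) (setIntegral_le_integral hi (ae_of_all _ fun y => ?_))
  · change 2 * (f y * f' y) ≤ f y ^ 2 + f' y ^ 2
    nlinarith [sq_nonneg (f y - f' y)]
  · change 0 ≤ f y ^ 2 + f' y ^ 2
    positivity

/-- The derivative of `Q`. -/
noncomputable def Qd (x : ℝ) : ℝ := -(Th x * Q x)

/-- The potential of the linearized operator. -/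
noncomputable def pot (x : ℝ) : ℝ := 1 - 4 * Q x ^ 3

lemma hasDerivAt_Qd (x : ℝ) : HasDerivAt Qd (Q x - Q x ^ 4) x := by
  refine ((hasDerivAt_Th x).fun_mul (hasDerivAt_Q x)).fun_neg.congr_deriv ?_
  have := Q_cube x
  linear_combination Q x * this

lemma hasDerivAt_Qdd (x : ℝ) : HasDerivAt (fun y => Q y - Q y ^ 4) (pot x * Qd x) x := by
  refine ((hasDerivAt_Q x).fun_sub ((hasDerivAt_Q x).fun_pow 4)).congr_deriv ?_
  norm_num [pot, Qd]; ring

lemma continuous_Qd : Continuous Qd := (continuous_Th.mul continuous_Q).neg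

lemma continuous_pot : Continuous pot := by
  have := continuous_Q
  unfold pot; fun_prop

lemma abs_pot_le (x : ℝ) : |pot x| ≤ 9 := by
  have h1 := Q_cube_le_const x
  have h2 := pow_pos (Q_pos x) 3
  rw [pot, abs_le]; constructor <;> linarith

lemma abs_Qd_le (x : ℝ) : |Qd x| ≤ Q x := by
  rw [Qd, abs_neg, abs_mul, abs_of_pos (Q_pos x)]
  nlinarith [abs_Th_lt_one x, Q_pos x]

lemma Qd_neg (x : ℝ) : Qd (-x) = -Qd x := by
  rw [Qd, Qd, Th_neg, Q_neg]; ring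

lemma Qd_zero : Qd 0 = 0 := by simp [Qd, Th_zero]

lemma Q_le_half (x : ℝ) : Q x ≤ 3 * exp (-(1 / 2) * |x|) := by
  refine (Q_le x).trans ?_
  have := abs_nonneg x
  gcongr
  linarith

lemma abs_mul_exp_neg_abs_le (x : ℝ) : |x| * exp (-|x|) ≤ 2 * exp (-(1 / 2) * |x|) := by
  have h := add_one_le_exp (1 / 2 * |x|)
  have e : exp (-|x|) = exp (-(1 / 2) * |x|) * exp (-(1 / 2) * |x|) := by
    rw [← exp_add]; congr 1; ring
  have e2 : exp (1 / 2 * |x|) * exp (-(1 / 2) * |x|) = 1 := by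
    rw [← exp_add]; simp
  have hp := exp_pos (-(1 / 2) * |x|)
  have h3 : |x| * exp (-(1 / 2) * |x|) ≤ 2 := by nlinarith
  rw [e]; nlinarith

lemma memLp_Q : MemLp Q 2 :=
  memLp_two_of_exp_bound continuous_Q fun x => by
    rw [abs_of_pos (Q_pos x)]; exact Q_le_half x

lemma memLp_Qd : MemLp Qd 2 :=
  memLp_two_of_exp_bound continuous_Qd fun x => (abs_Qd_le x).trans (Q_le_half x)

lemma memLp_id_mul_Q : MemLp (fun x => x * Q x) 2 :=
  memLp_two_of_exp_bound (C := 6) (continuous_id.mul continuous_Q) fun x => by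
    rw [abs_mul, abs_of_pos (Q_pos x)]
    have h1 := abs_mul_exp_neg_abs_le x
    have h2 := Q_le x
    nlinarith [abs_nonneg x]

lemma riccati_exterior {x : ℝ} (hx : 1 ≤ x) :
    -3 * exp (-3 * (x - 1)) + (-1 / 2 + exp (-3 * (x - 1))) ^ 2 ≤ pot x - 1 / 4 := by
  have h1 := Q_cube_le x
  rw [abs_of_pos (by linarith)] at h1
  have h2 : exp (-3 * x) = exp (-3) * exp (-3 * (x - 1)) := by rw [← exp_add]; congr 1; ring
  have h3 : exp (-3 * (x - 1)) ≤ 1 := exp_le_one_iff.2 (by linarith)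
  have h4 := exp_pos (-3 * (x - 1))
  have h5 : exp (-3 : ℝ) ≤ 1 / 20 := by
    have h6 : (20 : ℝ) ≤ exp 3 := by
      have h7 := Real.exp_one_gt_d9
      have h8 : exp (3 : ℝ) = exp 1 ^ 3 := by rw [← Real.exp_nat_mul]; norm_num
      rw [h8]
      have : (2.7182818283 : ℝ) ^ 3 ≤ exp 1 ^ 3 := pow_le_pow_left₀ (by norm_num) h7.le 3
      linarith [show (20 : ℝ) ≤ 2.7182818283 ^ 3 by norm_num]
    rw [exp_neg]
    rw [inv_le_comm₀ (exp_pos 3) (by norm_num)]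
    linarith
  rw [pot]
  rw [h2] at h1
  nlinarith

lemma cos_pos_of_mem_unit {x : ℝ} (h0 : 0 ≤ x) (h1 : x ≤ 1) : 0 < cos (3.1 * (x - 1 / 2)) := by
  have := Real.pi_gt_d2
  apply Real.cos_pos_of_mem_Ioo
  constructor <;> norm_num at * <;> linarith

/-- The one-sided coercivity of the quadratic form of the linearized operator on functions that
vanish at the origin. -/
lemma halfLine_coercive {h h1 : ℝ → ℝ} (hd : ∀ x, HasDerivAt h (h1 x) x)
    (hh : MemLp h 2) (hh1 : MemLp h1 2) (h0 : h 0 = 0) :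
    ∃ α : ℝ, 1 / 4 * (∫ x in Set.Ioi 0, (h x - α * Qd x) ^ 2)
      ≤ ∫ x in Set.Ioi 0, (h1 x ^ 2 + pot x * h x ^ 2) := by
  have hQ1 : Qd 1 ≠ 0 := by
    have : 0 < Th 1 := by
      rw [Th, Real.tanh_eq_sinh_div_cosh]
      exact div_pos (Real.sinh_pos_iff.2 (by norm_num)) (Real.cosh_pos _)
    have := Q_pos 1
    rw [Qd]
    exact (neg_neg_of_pos (by positivity)).ne
  obtain ⟨α, hα⟩ : ∃ α, h 1 - α * Qd 1 = 0 := ⟨h 1 / Qd 1, by field_simp; ring⟩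
  refine ⟨α, ?_⟩
  set g : ℝ → ℝ := fun x => h x - α * Qd x with hg
  set Qdd : ℝ → ℝ := fun x => Q x - Q x ^ 4
  have hgd : ∀ x, HasDerivAt g (h1 x - α * Qdd x) x := fun x =>
    (hd x).sub ((hasDerivAt_Qd x).const_mul α)
  have hgL : MemLp g 2 := hh.sub (memLp_Qd.const_mul α)
  set F : ℝ → ℝ := fun x => h1 x ^ 2 + pot x * h x ^ 2 - 1 / 4 * g x ^ 2 with hF
  have hpi : Integrable fun x => pot x * h x ^ 2 :=
    hh.integrable_sq.bdd_mul continuous_pot.aestronglyMeasurable (ae_of_all _ abs_pot_le)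
  have hFi : Integrable F :=
    (hh1.integrable_sq.add hpi).sub (hgL.integrable_sq.const_mul _)
  have key : ∀ (a : ℝ → ℝ) (a' x : ℝ), HasDerivAt a a' x → a' + a x ^ 2 ≤ pot x - 1 / 4 →
      ∃ H', HasDerivAt (fun y => a y * g y ^ 2 + 2 * α * g y * Qdd y + α ^ 2 * (Qd y * Qdd y)) H' x
        ∧ H' ≤ F x := by
    intro a a' x ha hle
    refine ⟨_, ((ha.fun_mul ((hgd x).fun_pow 2)).fun_add
      (((hgd x).const_mul (2 * α)).fun_mul (hasDerivAt_Qdd x))).fun_add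
      (((hasDerivAt_Qd x).fun_mul (hasDerivAt_Qdd x)).const_mul (α ^ 2)), ?_⟩
    have e : h x = g x + α * Qd x := by simp [hg]
    have h3 : 0 ≤ (pot x - 1 / 4 - (a' + a x ^ 2)) * g x ^ 2 :=
      mul_nonneg (by linarith) (sq_nonneg _)
    have h4 := sq_nonneg (h1 x - α * Qdd x - a x * g x)
    simp only [hF]
    rw [e]
    norm_num
    change _ ≤ h1 x ^ 2 + pot x * (g x + α * Qd x) ^ 2 - 1 / 4 * g x ^ 2
    simp only [Qdd] at h4 ⊢
    nlinarith
  have hg0 : g 0 = 0 := by simp [hg, h0, Qd_zero]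
  have hg1 : g 1 = 0 := hα
  have hQddc : Continuous Qdd := by
    have := continuous_Q
    fun_prop
  have hgc : Continuous g := continuous_iff_continuousAt.2 fun x => (hgd x).continuousAt
  have inner : α ^ 2 * (Qd 1 * Qdd 1) ≤ ∫ x in (0 : ℝ)..1, F x := by
    set a : ℝ → ℝ := fun x => -(3.1 * tan (3.1 * (x - 1 / 2)))
    have had : ∀ x, 0 ≤ x → x ≤ 1 →
        HasDerivAt a (-(3.1 * (3.1 * (1 + tan (3.1 * (x - 1 / 2)) ^ 2)))) x := by
      intro x hx0 hx1
      have hc := (cos_pos_of_mem_unit hx0 hx1).ne'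
      have hl : HasDerivAt (fun y : ℝ => 3.1 * (y - 1 / 2)) 3.1 x := by
        exact (((hasDerivAt_id' x).sub_const (1 / 2)).const_mul (3.1 : ℝ)).congr_deriv (mul_one _)
      have := (((Real.hasDerivAt_tan hc).comp x hl).const_mul 3.1).fun_neg
      refine this.congr_deriv ?_
      rw [Real.tan_eq_sin_div_cos]
      generalize 3.1 * (x - 1 / 2) = θ at hc
      have := Real.sin_sq_add_cos_sq θ
      field_simp
      linarith
    have hric : ∀ x, -(3.1 * (3.1 * (1 + tan (3.1 * (x - 1 / 2)) ^ 2))) + a x ^ 2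
        ≤ pot x - 1 / 4 := by
      intro x
      have := (abs_le.1 (abs_pot_le x)).1
      simp only [a]
      nlinarith
    choose! H' hH' hH'le using fun x (hx : x ∈ Set.Icc (0 : ℝ) 1) =>
      key a _ x (had x hx.1 hx.2) (hric x)
    have := intervalIntegral.sub_le_integral_of_hasDeriv_right_of_le (a := 0) (b := 1)
      zero_le_one
      (fun x hx => (hH' x hx).continuousAt.continuousWithinAt)
      (fun x hx => (hH' x ⟨hx.1.le, hx.2.le⟩).hasDerivWithinAt) hFi.integrableOn
      (fun x hx => hH'le x ⟨hx.1.le, hx.2.le⟩)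
    simpa [hg0, hg1, Qd_zero] using this
  have outer : ∀ X, 1 ≤ X → (-1 / 2 + exp (-3 * (X - 1))) * g X ^ 2 + 2 * α * g X * Qdd X
      + α ^ 2 * (Qd X * Qdd X) - α ^ 2 * (Qd 1 * Qdd 1) ≤ ∫ x in (1 : ℝ)..X, F x := by
    intro X hX
    set a : ℝ → ℝ := fun x => -1 / 2 + exp (-3 * (x - 1))
    have had : ∀ x, HasDerivAt a (-3 * exp (-3 * (x - 1))) x := by
      intro x
      have hl : HasDerivAt (fun y : ℝ => -3 * (y - 1)) (-3) x := by
        simpa using ((hasDerivAt_id x).sub_const 1).const_mul (-3 : ℝ)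
      refine (hl.exp.const_add (-1 / 2)).congr_deriv ?_
      ring
    choose! H' hH' hH'le using fun x (hx : x ∈ Set.Icc (1 : ℝ) X) =>
      key a _ x (had x) (riccati_exterior hx.1)
    have := intervalIntegral.sub_le_integral_of_hasDeriv_right_of_le hX
      (fun x hx => (hH' x hx).continuousAt.continuousWithinAt)
      (fun x hx => (hH' x ⟨hx.1.le, hx.2.le⟩).hasDerivWithinAt) hFi.integrableOn
      (fun x hx => hH'le x ⟨hx.1.le, hx.2.le⟩)
    simp only [a, hg1] at this
    linarith
  have hglim : Tendsto g atTop (nhds 0) := by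
    refine tendsto_zero_of_memLp_two_atTop hgd hgL (hh1.sub (MemLp.const_mul ?_ α))
    have : Qdd = fun x => Q x - (Q x ^ 3) * Q x := by funext x; simp only [Qdd]; ring
    rw [this]
    refine memLp_Q.sub (memLp_Q.bounded_mul (C := 5 / 2)
      (continuous_Q.pow 3).aestronglyMeasurable fun x => ?_)
    rw [abs_of_pos (pow_pos (Q_pos x) 3)]; exact Q_cube_le_const x
  have hexp : Tendsto (fun X : ℝ => exp (-3 * (X - 1))) atTop (nhds 0) := by
    refine Real.tendsto_exp_atBot.comp ?_
    refine Tendsto.const_mul_atTop_of_neg (by norm_num) ?_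
    exact tendsto_atTop_add_const_right _ _ tendsto_id
  have hQ0 : Tendsto Q atTop (nhds 0) :=
    tendsto_zero_of_memLp_two_atTop hasDerivAt_Q memLp_Q memLp_Qd
  have hQdd0 : Tendsto Qdd atTop (nhds 0) := by simpa using hQ0.sub (hQ0.pow 4)
  have hQd0 : Tendsto Qd atTop (nhds 0) :=
    squeeze_zero_norm (fun x => abs_Qd_le x) hQ0
  have hlim : -(α ^ 2 * (Qd 1 * Qdd 1)) ≤ ∫ x in Set.Ioi 1, F x := by
    refine le_of_tendsto_of_tendsto ?_
      (intervalIntegral_tendsto_integral_Ioi 1 hFi.integrableOn tendsto_id)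
      (eventually_atTop.2 ⟨1, outer⟩)
    have t1 := ((hexp.const_add (-1 / 2)).mul (hglim.pow 2)).add
      ((hglim.const_mul (2 * α)).mul hQdd0)
    simpa using ((t1.add ((hQd0.mul hQdd0).const_mul (α ^ 2))).sub_const
      (α ^ 2 * (Qd 1 * Qdd 1)))
  have hsplit : ∫ x in Set.Ioi 0, F x = (∫ x in (0 : ℝ)..1, F x) + ∫ x in Set.Ioi 1, F x :=
    (intervalIntegral.integral_interval_add_Ioi hFi.integrableOn hFi.integrableOn).symm
  have hsub : ∫ x in Set.Ioi 0, F x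
      = (∫ x in Set.Ioi 0, (h1 x ^ 2 + pot x * h x ^ 2)) - ∫ x in Set.Ioi 0, 1 / 4 * g x ^ 2 :=
    integral_sub (hh1.integrable_sq.add hpi).integrableOn
      (hgL.integrable_sq.const_mul _).integrableOn
  rw [integral_const_mul] at hsub
  linarith

/-- The scaling direction `Q / 3 + x Q' / 2`, which `L` maps to `-Q`. -/
noncomputable def scalQ (x : ℝ) : ℝ := Q x / 3 + x * Qd x / 2

noncomputable def scalQd (x : ℝ) : ℝ := 5 / 6 * Qd x + x * (Q x - Q x ^ 4) / 2

lemma hasDerivAt_scalQ (x : ℝ) : HasDerivAt scalQ (scalQd x) x := by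
  refine (((hasDerivAt_Q x).div_const 3).fun_add
    (((hasDerivAt_id' x).fun_mul (hasDerivAt_Qd x)).div_const 2)).congr_deriv ?_
  simp only [scalQd, Qd]; ring

lemma hasDerivAt_scalQd (x : ℝ) : HasDerivAt scalQd (pot x * scalQ x + Q x) x := by
  refine (((hasDerivAt_Qd x).const_mul (5 / 6)).fun_add
    (((hasDerivAt_id' x).fun_mul (hasDerivAt_Qdd x)).div_const 2)).congr_deriv ?_
  simp only [scalQ, Qd, pot]; ring

lemma memLp_id_mul_Qd : MemLp (fun x => x * Qd x) 2 := by
  have := memLp_id_mul_Q.bounded_mul (g := fun x => -Th x) (C := 1)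
    continuous_Th.neg.aestronglyMeasurable (fun x => by
      rw [abs_neg]; exact (abs_Th_lt_one x).le)
  refine this.of_forall_eq fun x => ?_
  simp only [Qd]; ring

lemma memLp_scalQ : MemLp scalQ 2 := by
  refine ((memLp_Q.const_mul (1 / 3)).add (memLp_id_mul_Qd.const_mul (1 / 2))).of_forall_eq
    fun x => ?_
  simp only [scalQ, Pi.add_apply]; ring

lemma Q_cube_pos (x : ℝ) : 0 < Q x ^ 3 := pow_pos (Q_pos x) 3

lemma abs_one_sub_Q_cube_le (x : ℝ) : |1 - Q x ^ 3| ≤ 2 := by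
  have h1 := Q_cube_le_const x
  have h2 := Q_cube_pos x
  rw [abs_le]; constructor <;> linarith

lemma aestronglyMeasurable_one_sub_Q_cube :
    AEStronglyMeasurable (fun x => 1 - Q x ^ 3) volume :=
  (continuous_const.sub (continuous_Q.pow 3)).aestronglyMeasurable

lemma memLp_id_mul_Qdd : MemLp (fun x => x * (Q x - Q x ^ 4)) 2 := by
  refine (memLp_id_mul_Q.bounded_mul aestronglyMeasurable_one_sub_Q_cube
    abs_one_sub_Q_cube_le).of_forall_eq fun x => ?_
  ring

lemma memLp_Qdd : MemLp (fun x => Q x - Q x ^ 4) 2 := by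
  refine (memLp_Q.bounded_mul aestronglyMeasurable_one_sub_Q_cube
    abs_one_sub_Q_cube_le).of_forall_eq fun x => ?_
  ring

lemma memLp_scalQd : MemLp scalQd 2 := by
  refine ((memLp_Qd.const_mul (5 / 6)).add (memLp_id_mul_Qdd.const_mul (1 / 2))).of_forall_eq
    fun x => ?_
  simp only [scalQd, Pi.add_apply]; ring

lemma MeasureTheory.MemLp.pot_mul {f : ℝ → ℝ} (hf : MemLp f 2) : MemLp (fun x => pot x * f x) 2 :=
  hf.bounded_mul continuous_pot.aestronglyMeasurable abs_pot_le

lemma integral_scalQ_form {D D1 : ℝ → ℝ} (hd : ∀ x, HasDerivAt D (D1 x) x)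
    (hD : MemLp D 2) (hD1 : MemLp D1 2) :
    ∫ x, (D1 x * scalQd x + pot x * D x * scalQ x) = -∫ x, D x * Q x := by
  have i1 := hD1.integrable_two_mul memLp_scalQd
  have i2 := hD.pot_mul.integrable_two_mul memLp_scalQ
  have i3 := hD.integrable_two_mul memLp_Q
  have h := integral_eq_zero_of_hasDerivAt_of_integrable
    (f := fun x => D x * scalQd x)
    (f' := fun x => (D1 x * scalQd x + pot x * D x * scalQ x) + D x * Q x)
    (fun x => ((hd x).fun_mul (hasDerivAt_scalQd x)).congr_deriv (by ring))
    (by fun_prop) (hD.integrable_two_mul memLp_scalQd)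
  rw [integral_add (by fun_prop) i3] at h
  linarith

lemma integral_Q_sq_pos : 0 < ∫ x, Q x ^ 2 := by
  exact integral_pos_of_integrable_nonneg_nonzero (x := 0) (continuous_Q.pow 2)
    memLp_Q.integrable_sq (fun x => sq_nonneg _) (pow_pos (Q_pos 0) 2).ne'

lemma integral_scalQ_mul_Q : ∫ x, scalQ x * Q x = (∫ x, Q x ^ 2) / 12 := by
  have i1 := memLp_Q.integrable_sq
  have i2 := memLp_id_mul_Qd.integrable_two_mul memLp_Q
  have h := integral_eq_zero_of_hasDerivAt_of_integrable
    (f := fun x => x * Q x * Q x) (f' := fun x => Q x ^ 2 + 2 * (x * Qd x * Q x))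
    (fun x => (((hasDerivAt_id' x).fun_mul (hasDerivAt_Q x)).fun_mul
      (hasDerivAt_Q x)).congr_deriv (by simp only [Qd]; ring))
    (by fun_prop) (memLp_id_mul_Q.integrable_two_mul memLp_Q)
  rw [integral_add i1 (by fun_prop), integral_const_mul] at h
  have e : ∀ x, scalQ x * Q x = 1 / 3 * Q x ^ 2 + 1 / 2 * (x * Qd x * Q x) := by
    intro x; simp only [scalQ]; ring
  simp_rw [e]
  rw [integral_add (by fun_prop) (by fun_prop), integral_const_mul, integral_const_mul]
  linarith

lemma integral_eq_integral_Ioi_add_neg {F : ℝ → ℝ} (hF : Integrable F) :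
    ∫ x, F x = (∫ x in Set.Ioi 0, F x) + ∫ x in Set.Ioi 0, F (-x) := by
  have h := integral_comp_neg_Ioi (0 : ℝ) F
  rw [neg_zero] at h
  rw [h, add_comm, intervalIntegral.integral_Iic_add_Ioi hF.integrableOn hF.integrableOn]

lemma MeasureTheory.MemLp.comp_neg_real {f : ℝ → ℝ} (hf : MemLp f 2) : MemLp (fun x => f (-x)) 2 :=
  hf.comp_measurePreserving (Measure.measurePreserving_neg volume)

lemma integral_Ioi_Qd_mul_Q : ∫ x in Set.Ioi 0, Qd x * Q x = -(Q 0 ^ 2 / 2) := by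
  have ht : Tendsto (fun x => Q x ^ 2 / 2) atTop (nhds 0) := by
    simpa using ((tendsto_zero_of_memLp_two_atTop hasDerivAt_Q memLp_Q memLp_Qd).pow 2).div_const 2
  have := integral_Ioi_of_hasDerivAt_of_tendsto' (a := 0) (f := fun x => Q x ^ 2 / 2)
    (f' := fun x => Qd x * Q x)
    (fun x _ => (((hasDerivAt_Q x).fun_pow 2).div_const 2).congr_deriv
      (by simp only [Qd]; norm_num; ring))
    (memLp_Qd.integrable_two_mul memLp_Q).integrableOn ht
  rw [this]; ring

lemma form_coercive_consts_pos {q2 qd W c0 b : ℝ} (hqdp : 0 ≤ qd) (hWp : 0 ≤ W) (hc0p : 0 < c0)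
    (hbp : 0 < b) (hq2p : 0 < q2) :
    0 < 4 * W / c0 + 16 + 32 * qd / b ^ 2 * (2 * c0 + 4 * q2) ∧
    0 < (4 * W / c0 + 16 + 32 * qd / b ^ 2 * (2 * c0 + 4 * q2)) * (2 / c0)
        + 32 * qd / b ^ 2 := by
  constructor <;> positivity

lemma form_coercive_aux {q2 qd W c0 b B ε t Gp Gm β X Y N S : ℝ} (hqdp : 0 ≤ qd)
    (hWp : 0 ≤ W) (hc0p : 0 < c0) (hbp : 0 < b) (hq2p : 0 < q2)
    (hG : 1 / 4 * (Gp + Gm) ≤ B + 2 * t * ε - t ^ 2 * c0) (hGpp : 0 ≤ Gp) (hGmp : 0 ≤ Gm)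
    (hβeq : β * b = t * c0 + X + Y - ε) (hX2 : X ^ 2 ≤ Gp * q2) (hY2 : Y ^ 2 ≤ Gm * q2)
    (hN : N ≤ 2 * (Gp + Gm) + 4 * β ^ 2 * qd) (hT : S ≤ 2 * t ^ 2 * W + 2 * N) :
    S ≤ (4 * W / c0 + 16 + 32 * qd / b ^ 2 * (2 * c0 + 4 * q2)) * B
      + ((4 * W / c0 + 16 + 32 * qd / b ^ 2 * (2 * c0 + 4 * q2)) * (2 / c0)
        + 32 * qd / b ^ 2) * ε ^ 2 := by
  set E := B + 2 / c0 * ε ^ 2 with hE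
  have hyoung : 2 * t * ε ≤ t ^ 2 * c0 / 2 + 2 / c0 * ε ^ 2 := by
    have : t ^ 2 * c0 / 2 + 2 / c0 * ε ^ 2 - 2 * t * ε = (t * c0 - 2 * ε) ^ 2 / (2 * c0) := by
      field_simp; ring
    have h2 : 0 ≤ (t * c0 - 2 * ε) ^ 2 / (2 * c0) := by positivity
    linarith
  have htc : 0 ≤ t ^ 2 * c0 := by positivity
  have hGE : Gp + Gm ≤ 4 * E := by linarith
  have htE : t ^ 2 ≤ 2 / c0 * E := by
    have : t ^ 2 * c0 ≤ 2 * E := by linarith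
    rw [div_mul_eq_mul_div, le_div_iff₀ hc0p]; exact this
  have hβ2 : β ^ 2 ≤ 4 / b ^ 2 * (2 * c0 * E + 4 * E * q2 + ε ^ 2) := by
    have u1 : (β * b) ^ 2 ≤ 4 * (t ^ 2 * c0 ^ 2 + X ^ 2 + Y ^ 2 + ε ^ 2) := by
      rw [hβeq]
      nlinarith [sq_nonneg (t * c0 - X), sq_nonneg (t * c0 - Y), sq_nonneg (t * c0 + ε),
        sq_nonneg (X - Y), sq_nonneg (X + ε), sq_nonneg (Y + ε)]
    have u2 : t ^ 2 * c0 ^ 2 ≤ 2 * c0 * E := by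
      calc t ^ 2 * c0 ^ 2 ≤ 2 / c0 * E * c0 ^ 2 := by gcongr
        _ = 2 * c0 * E := by field_simp
    have u3 : (Gp + Gm) * q2 ≤ 4 * E * q2 := by gcongr
    rw [div_mul_eq_mul_div, le_div_iff₀ (by positivity)]
    nlinarith
  calc S ≤ 2 * t ^ 2 * W + 2 * (2 * (Gp + Gm) + 4 * β ^ 2 * qd) := by linarith
    _ ≤ 2 * (2 / c0 * E) * W + 2 * (2 * (4 * E)
        + 4 * (4 / b ^ 2 * (2 * c0 * E + 4 * E * q2 + ε ^ 2)) * qd) := by gcongr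
    _ = (4 * W / c0 + 16 + 32 * qd / b ^ 2 * (2 * c0 + 4 * q2)) * B
        + ((4 * W / c0 + 16 + 32 * qd / b ^ 2 * (2 * c0 + 4 * q2)) * (2 / c0)
          + 32 * qd / b ^ 2) * ε ^ 2 := by
        rw [hE]; field_simp; ring

/-- Coercivity of the quadratic form of `L` modulo the kernel direction `Q'` and the
negative direction, which is controlled by the pairing with `Q`. -/
lemma form_coercive : ∃ K₁ K₂ : ℝ, 0 < K₁ ∧ 0 < K₂ ∧ ∀ D D1 : ℝ → ℝ,
    (∀ x, HasDerivAt D (D1 x) x) → MemLp D 2 → MemLp D1 2 → ∃ α : ℝ,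
      ∫ x, (D x - α * Qd x) ^ 2
        ≤ K₁ * (∫ x, (D1 x ^ 2 + pot x * D x ^ 2)) + K₂ * (∫ x, D x * Q x) ^ 2 := by
  set q2 := ∫ x, Q x ^ 2 with hq2
  have hq2p : 0 < q2 := integral_Q_sq_pos
  set qd := ∫ x in Set.Ioi 0, Qd x ^ 2 with hqd
  have hqdp : 0 ≤ qd := integral_nonneg fun x => sq_nonneg _
  set W := ∫ x, scalQ x ^ 2 with hW
  have hWp : 0 ≤ W := integral_nonneg fun x => sq_nonneg _
  set c0 := q2 / 12 with hc0
  have hc0p : 0 < c0 := by positivity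
  set b := Q 0 ^ 2 with hb
  have hbp : 0 < b := pow_pos (Q_pos 0) 2
  obtain ⟨hK₁, hK₂⟩ := form_coercive_consts_pos hqdp hWp hc0p hbp hq2p
  refine ⟨_, _, hK₁, hK₂, ?_⟩
  intro D D1 hd hD hD1
  set ε := ∫ x, D x * Q x with hε
  set B := ∫ x, (D1 x ^ 2 + pot x * D x ^ 2) with hB
  have hs0 : scalQ 0 ≠ 0 := by
    have := Q_pos 0
    simp only [scalQ]; norm_num; linarith
  obtain ⟨t, ht⟩ : ∃ t, D 0 - t * scalQ 0 = 0 := ⟨D 0 / scalQ 0, by field_simp; ring⟩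
  set h : ℝ → ℝ := fun x => D x - t * scalQ x with hh
  set h1 : ℝ → ℝ := fun x => D1 x - t * scalQd x with hh1
  have hhd : ∀ x, HasDerivAt h (h1 x) x := fun x =>
    (hd x).fun_sub ((hasDerivAt_scalQ x).const_mul t)
  have hhL : MemLp h 2 := hD.sub (memLp_scalQ.const_mul t)
  have hh1L : MemLp h1 2 := hD1.sub (memLp_scalQd.const_mul t)
  have iD : Integrable fun x => D1 x ^ 2 + pot x * D x ^ 2 := by
    refine (hD1.integrable_sq.add (hD.pot_mul.integrable_two_mul hD)).congr
      (ae_of_all _ fun x => ?_)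
    simp only [Pi.add_apply]; ring
  have ih : Integrable fun x => h1 x ^ 2 + pot x * h x ^ 2 := by
    refine (hh1L.integrable_sq.add (hhL.pot_mul.integrable_two_mul hhL)).congr
      (ae_of_all _ fun x => ?_)
    simp only [Pi.add_apply]; ring
  have hform : ∫ x, (h1 x ^ 2 + pot x * h x ^ 2) = B + 2 * t * ε - t ^ 2 * c0 := by
    have e : ∀ x, h1 x ^ 2 + pot x * h x ^ 2 = (D1 x ^ 2 + pot x * D x ^ 2)
        - 2 * t * (D1 x * scalQd x + pot x * D x * scalQ x)
        + t ^ 2 * (scalQd x * scalQd x + pot x * scalQ x * scalQ x) := by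
      intro x; simp only [hh, hh1]; ring
    have i1 := hD1.integrable_two_mul memLp_scalQd
    have i2 := hD.pot_mul.integrable_two_mul memLp_scalQ
    have i3 := memLp_scalQd.integrable_two_mul memLp_scalQd
    have i4 := memLp_scalQ.pot_mul.integrable_two_mul memLp_scalQ
    simp_rw [e]
    rw [integral_add (by fun_prop) (by fun_prop), integral_sub (by fun_prop) (by fun_prop),
      integral_const_mul, integral_const_mul, integral_scalQ_form hd hD hD1,
      integral_scalQ_form hasDerivAt_scalQ memLp_scalQ memLp_scalQd, integral_scalQ_mul_Q]
    ring
  have hm1L : MemLp (fun x => -h1 (-x)) 2 := hh1L.comp_neg_real.neg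
  obtain ⟨αp, hαp⟩ := halfLine_coercive hhd hhL hh1L ht
  obtain ⟨αm, hαm⟩ := halfLine_coercive (h := fun x => h (-x)) (h1 := fun x => -h1 (-x))
    (fun x => ((hhd (-x)).comp x (hasDerivAt_neg x)).congr_deriv (by ring))
    hhL.comp_neg_real hm1L (by simpa using ht)
  set gp : ℝ → ℝ := fun x => h x - αp * Qd x with hgp
  set gm : ℝ → ℝ := fun x => h (-x) - αm * Qd x with hgm
  have hgpL : MemLp gp 2 := hhL.sub (memLp_Qd.const_mul αp)
  have hgmL : MemLp gm 2 := hhL.comp_neg_real.sub (memLp_Qd.const_mul αm)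
  set Gp := ∫ x in Set.Ioi 0, gp x ^ 2 with hGp
  set Gm := ∫ x in Set.Ioi 0, gm x ^ 2 with hGm
  have hGpp : 0 ≤ Gp := integral_nonneg fun x => sq_nonneg _
  have hGmp : 0 ≤ Gm := integral_nonneg fun x => sq_nonneg _
  have hG : 1 / 4 * (Gp + Gm) ≤ B + 2 * t * ε - t ^ 2 * c0 := by
    rw [← hform, integral_eq_integral_Ioi_add_neg ih]
    have e : ∀ x, (-h1 (-x)) ^ 2 + pot x * h (-x) ^ 2 = h1 (-x) ^ 2 + pot (-x) * h (-x) ^ 2 := by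
      intro x; simp only [pot, Q_neg]; ring
    simp_rw [e] at hαm
    linarith
  set β := (αp + αm) / 2 with hβ
  set α := (αp - αm) / 2 with hα
  refine ⟨α, ?_⟩
  set X := ∫ x in Set.Ioi 0, gp x * Q x with hX
  set Y := ∫ x in Set.Ioi 0, gm x * Q x with hY
  have hβeq : β * b = t * c0 + X + Y - ε := by
    have i1 := hhL.integrable_two_mul memLp_Q
    have i2 := memLp_scalQ.integrable_two_mul memLp_Q
    have e1 : ε = (∫ x, h x * Q x) + t * c0 := by
      have e : ∀ x, D x * Q x = h x * Q x + t * (scalQ x * Q x) := by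
        intro x; simp only [hh]; ring
      rw [hε]
      simp_rw [e]
      rw [integral_add i1 (by fun_prop), integral_const_mul, integral_scalQ_mul_Q]
    have i3 : Integrable (fun x => gp x * Q x) (volume.restrict (Set.Ioi 0)) :=
      (hgpL.integrable_two_mul memLp_Q).integrableOn
    have i4 : Integrable (fun x => gm x * Q x) (volume.restrict (Set.Ioi 0)) :=
      (hgmL.integrable_two_mul memLp_Q).integrableOn
    have i5 : Integrable (fun x => Qd x * Q x) (volume.restrict (Set.Ioi 0)) :=
      (memLp_Qd.integrable_two_mul memLp_Q).integrableOn
    have e2 : ∫ x in Set.Ioi 0, h x * Q x = X + αp * -(b / 2) := by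
      have e : ∀ x, h x * Q x = gp x * Q x + αp * (Qd x * Q x) := by
        intro x; simp only [hgp]; ring
      simp_rw [e]
      rw [integral_add i3 (by fun_prop), integral_const_mul, integral_Ioi_Qd_mul_Q]
    have e3 : ∫ x in Set.Ioi 0, h (-x) * Q (-x) = Y + αm * -(b / 2) := by
      have e : ∀ x, h (-x) * Q (-x) = gm x * Q x + αm * (Qd x * Q x) := by
        intro x; simp only [hgm, Q_neg]; ring
      simp_rw [e]
      rw [integral_add i4 (by fun_prop), integral_const_mul, integral_Ioi_Qd_mul_Q]
    rw [integral_eq_integral_Ioi_add_neg i1, e2, e3] at e1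
    rw [hβ]; linarith
  have hQ2 : ∫ x in Set.Ioi 0, Q x ^ 2 ≤ q2 :=
    setIntegral_le_integral memLp_Q.integrable_sq (ae_of_all _ fun x => sq_nonneg _)
  have hX2 : X ^ 2 ≤ Gp * q2 :=
    (sq_integral_mul_le (hgpL.restrict _) (memLp_Q.restrict _)).trans
      (mul_le_mul_of_nonneg_left hQ2 hGpp)
  have hY2 : Y ^ 2 ≤ Gm * q2 :=
    (sq_integral_mul_le (hgmL.restrict _) (memLp_Q.restrict _)).trans
      (mul_le_mul_of_nonneg_left hQ2 hGmp)
  have hrL : MemLp (fun x => h x - α * Qd x) 2 := hhL.sub (memLp_Qd.const_mul α)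
  have hN : ∫ x, (h x - α * Qd x) ^ 2 ≤ 2 * (Gp + Gm) + 4 * β ^ 2 * qd := by
    rw [integral_eq_integral_Ioi_add_neg hrL.integrable_sq]
    have e1 : ∀ x, (h x - α * Qd x) = gp x + β * Qd x := by
      intro x; simp only [hgp, hα, hβ]; ring
    have e2 : ∀ x, (h (-x) - α * Qd (-x)) = gm x + β * Qd x := by
      intro x; simp only [hgm, hα, hβ, Qd_neg]; ring
    simp_rw [e1]
    simp_rw [← e1, e2]
    have e3 : ∫ x in Set.Ioi 0, (β * Qd x) ^ 2 = β ^ 2 * qd := by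
      simp_rw [mul_pow]; rw [integral_const_mul]
    have u1 := integral_add_sq_le (hgpL.restrict (Set.Ioi 0))
      ((memLp_Qd.const_mul β).restrict (Set.Ioi 0))
    have u2 := integral_add_sq_le (hgmL.restrict (Set.Ioi 0))
      ((memLp_Qd.const_mul β).restrict (Set.Ioi 0))
    rw [e3] at u1 u2
    simp_rw [e1]
    linarith
  have hT : ∫ x, (D x - α * Qd x) ^ 2 ≤ 2 * t ^ 2 * W + 2 * ∫ x, (h x - α * Qd x) ^ 2 := by
    have u := integral_add_sq_le (memLp_scalQ.const_mul t) hrL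
    have e1 : ∀ x, D x - α * Qd x = t * scalQ x + (h x - α * Qd x) := by
      intro x; simp only [hh]; ring
    have e2 : ∫ x, (t * scalQ x) ^ 2 = t ^ 2 * W := by
      simp_rw [mul_pow]; rw [integral_const_mul]
    rw [e2] at u
    calc ∫ x, (D x - α * Qd x) ^ 2 = ∫ x, (t * scalQ x + (h x - α * Qd x)) ^ 2 := by
          refine integral_congr_ae (ae_of_all _ fun x => ?_)
          simp only [e1 x]
      _ ≤ _ := by linarith
  exact form_coercive_aux hqdp hWp hc0p hbp hq2p hG hGpp hGmp hβeq hX2 hY2 hN hT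

lemma hasDerivAt_pot (x : ℝ) : HasDerivAt pot (12 * Th x * Q x ^ 3) x :=
  (((hasDerivAt_Q_cube x).const_mul 4).const_sub 1).congr_deriv (by ring)

/-- The derivative of `x Q`. -/
noncomputable def xQd (x : ℝ) : ℝ := Q x + x * Qd x

/-- The second derivative of `x Q`. -/
noncomputable def xQdd (x : ℝ) : ℝ := 2 * Qd x + x * (Q x - Q x ^ 4)

lemma hasDerivAt_xQ (x : ℝ) : HasDerivAt (fun y => y * Q y) (xQd x) x :=
  ((hasDerivAt_id' x).fun_mul (hasDerivAt_Q x)).congr_deriv (by simp only [xQd, Qd]; ring)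

lemma hasDerivAt_xQd (x : ℝ) : HasDerivAt xQd (xQdd x) x :=
  ((hasDerivAt_Q x).fun_add ((hasDerivAt_id' x).fun_mul (hasDerivAt_Qd x))).congr_deriv
    (by simp only [xQdd, Qd]; ring)

lemma hasDerivAt_xQdd (x : ℝ) :
    HasDerivAt xQdd (pot x * xQd x + (2 * Q x + Q x ^ 4)) x :=
  (((hasDerivAt_Qd x).const_mul 2).fun_add
    ((hasDerivAt_id' x).fun_mul (hasDerivAt_Qdd x))).congr_deriv
    (by simp only [xQd, Qd, pot]; ring)

lemma memLp_xQd : MemLp xQd 2 := memLp_Q.add memLp_id_mul_Qd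

lemma memLp_xQdd : MemLp xQdd 2 := (memLp_Qd.const_mul 2).add memLp_id_mul_Qdd

lemma memLp_two_mul_Q_add : MemLp (fun x => 2 * Q x + Q x ^ 4) 2 :=
  ((memLp_Q.const_mul 3).sub memLp_Qdd).of_forall_eq fun x => by
    simp only [Pi.sub_apply]; ring

/-- `D` is a square-integrable solution of `(L D - R)' = -lam D`, with first two derivatives
`D1` and `D2`. -/
structure IsLinSol (lam : ℝ) (D D1 D2 R : ℝ → ℝ) : Prop where
  hd : ∀ x, HasDerivAt D (D1 x) x
  hd1 : ∀ x, HasDerivAt D1 (D2 x) x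
  hD : MemLp D 2
  hD1 : MemLp D1 2
  hD2 : MemLp D2 2
  hR : MemLp R 2
  hM : ∀ x, HasDerivAt (fun y => -D2 y + pot y * D y - R y) (-lam * D x) x

namespace IsLinSol

variable {lam : ℝ} {D D1 D2 R : ℝ → ℝ}

lemma energy_identity (h : IsLinSol lam D D1 D2 R) (hlam : 0 < lam) :
    ∫ x, (D1 x ^ 2 + pot x * D x ^ 2) = ∫ x, D x * R x := by
  obtain ⟨hd, hd1, hD, hD1, hD2, hR, hM⟩ := h
  have hML : MemLp (fun y => -D2 y + pot y * D y - R y) 2 := (hD2.neg.add hD.pot_mul).sub hR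
  have h1 := integral_eq_zero_of_hasDerivAt_of_integrable
    (f := fun x => (-D2 x + pot x * D x - R x) ^ 2)
    (f' := fun x => -2 * lam * (D x * (-D2 x + pot x * D x - R x)))
    (fun x => ((hM x).fun_pow 2).congr_deriv (by norm_num; ring))
    ((hD.integrable_two_mul hML).const_mul _) hML.integrable_sq
  rw [integral_const_mul] at h1
  have h2 : ∫ x, D x * (-D2 x + pot x * D x - R x) = 0 := by
    rcases mul_eq_zero.1 h1 with h | h
    · nlinarith
    · exact h
  have i1 := hD.integrable_two_mul hD2
  have i2 := hD.integrable_two_mul hD.pot_mul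
  have i3 := hD.integrable_two_mul hR
  have i4 := hD1.integrable_sq
  have i5 := hD.integrable_two_mul hML
  have h3 := integral_eq_zero_of_hasDerivAt_of_integrable
    (f := fun x => D x * D1 x) (f' := fun x => D1 x ^ 2 + D x * D2 x)
    (fun x => ((hd x).fun_mul (hd1 x)).congr_deriv (by ring))
    (by fun_prop) (hD.integrable_two_mul hD1)
  have e1 : ∀ x, D1 x ^ 2 + pot x * D x ^ 2 = (D1 x ^ 2 + D x * D2 x)
      + (D x * (-D2 x + pot x * D x - R x) + D x * R x) := by intro x; ring
  simp_rw [e1]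
  rw [integral_add (by fun_prop) (by fun_prop), h3, integral_add i5 i3, h2]
  ring

lemma pairing_Q (h : IsLinSol lam D D1 D2 R) : lam * ∫ x, D x * Q x = -∫ x, R x * Qd x := by
  obtain ⟨hd, hd1, hD, hD1, hD2, hR, hM⟩ := h
  have hML : MemLp (fun y => -D2 y + pot y * D y - R y) 2 := (hD2.neg.add hD.pot_mul).sub hR
  have i1 := hML.integrable_two_mul memLp_Qd
  have i2 := hD.integrable_two_mul memLp_Q
  have i3 := hR.integrable_two_mul memLp_Qd
  have i4 := hD2.integrable_two_mul memLp_Qd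
  have i5 := hD.integrable_two_mul memLp_Qd.pot_mul
  have h1 := integral_eq_zero_of_hasDerivAt_of_integrable
    (f := fun x => (-D2 x + pot x * D x - R x) * Q x)
    (f' := fun x => -lam * (D x * Q x) + (-D2 x + pot x * D x - R x) * Qd x)
    (fun x => ((hM x).fun_mul (hasDerivAt_Q x)).congr_deriv (by simp only [Qd]; ring))
    (by fun_prop) (hML.integrable_two_mul memLp_Q)
  have h2 := integral_eq_zero_of_hasDerivAt_of_integrable
    (f := fun x => D1 x * Qd x - D x * (Q x - Q x ^ 4))
    (f' := fun x => D2 x * Qd x - D x * (pot x * Qd x))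
    (fun x => (((hd1 x).fun_mul (hasDerivAt_Qd x)).fun_sub
      ((hd x).fun_mul (hasDerivAt_Qdd x))).congr_deriv (by ring))
    (by fun_prop) ((hD1.integrable_two_mul memLp_Qd).sub (hD.integrable_two_mul memLp_Qdd))
  have e : ∀ x, -lam * (D x * Q x) + (-D2 x + pot x * D x - R x) * Qd x
      = -lam * (D x * Q x) - (D2 x * Qd x - D x * (pot x * Qd x)) - R x * Qd x := by
    intro x; ring
  simp_rw [e] at h1
  rw [integral_sub (by fun_prop) i3, integral_sub (by fun_prop) (by fun_prop), h2,
    integral_const_mul] at h1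
  linarith

lemma pairing_xQ (h : IsLinSol lam D D1 D2 R) : lam * ∫ x, D x * (x * Q x)
    = -(∫ x, D x * (2 * Q x + Q x ^ 4)) - ∫ x, R x * xQd x := by
  obtain ⟨hd, hd1, hD, hD1, hD2, hR, hM⟩ := h
  have hML : MemLp (fun y => -D2 y + pot y * D y - R y) 2 := (hD2.neg.add hD.pot_mul).sub hR
  have i1 := hML.integrable_two_mul memLp_xQd
  have i2 := hD.integrable_two_mul memLp_id_mul_Q
  have i3 := hR.integrable_two_mul memLp_xQd
  have i4 := hD2.integrable_two_mul memLp_xQd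
  have i5 := hD.integrable_two_mul memLp_xQd.pot_mul
  have i6 := hD.integrable_two_mul memLp_two_mul_Q_add
  have h1 := integral_eq_zero_of_hasDerivAt_of_integrable
    (f := fun x => (-D2 x + pot x * D x - R x) * (x * Q x))
    (f' := fun x => -lam * (D x * (x * Q x)) + (-D2 x + pot x * D x - R x) * xQd x)
    (fun x => ((hM x).fun_mul (hasDerivAt_xQ x)).congr_deriv (by ring))
    (by fun_prop) (hML.integrable_two_mul memLp_id_mul_Q)
  have h2 := integral_eq_zero_of_hasDerivAt_of_integrable
    (f := fun x => D1 x * xQd x - D x * xQdd x)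
    (f' := fun x => D2 x * xQd x - D x * (pot x * xQd x) - D x * (2 * Q x + Q x ^ 4))
    (fun x => (((hd1 x).fun_mul (hasDerivAt_xQd x)).fun_sub
      ((hd x).fun_mul (hasDerivAt_xQdd x))).congr_deriv (by ring))
    (by fun_prop) ((hD1.integrable_two_mul memLp_xQd).sub (hD.integrable_two_mul memLp_xQdd))
  have e : ∀ x, -lam * (D x * (x * Q x)) + (-D2 x + pot x * D x - R x) * xQd x
      = -lam * (D x * (x * Q x))
        - (D2 x * xQd x - D x * (pot x * xQd x) - D x * (2 * Q x + Q x ^ 4))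
        - D x * (2 * Q x + Q x ^ 4) - R x * xQd x := by
    intro x; ring
  simp_rw [e] at h1
  rw [integral_sub (by fun_prop) i3, integral_sub (by fun_prop) i6,
    integral_sub (by fun_prop) (by fun_prop), h2, integral_const_mul] at h1
  linarith

end IsLinSol

lemma integral_Qd_mul_xQ : ∫ x, Qd x * (x * Q x) = -(∫ x, Q x ^ 2) / 2 := by
  have i1 := memLp_Q.integrable_sq
  have i2 := memLp_Qd.integrable_two_mul memLp_id_mul_Q
  have h := integral_eq_zero_of_hasDerivAt_of_integrable
    (f := fun x => x * Q x * Q x) (f' := fun x => Q x ^ 2 + 2 * (Qd x * (x * Q x)))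
    (fun x => (((hasDerivAt_id' x).fun_mul (hasDerivAt_Q x)).fun_mul
      (hasDerivAt_Q x)).congr_deriv (by simp only [Qd]; ring))
    (by fun_prop) (memLp_id_mul_Q.integrable_two_mul memLp_Q)
  rw [integral_add i1 (by fun_prop), integral_const_mul] at h
  linarith

lemma integral_Qd_mul_two_mul_Q_add : ∫ x, Qd x * (2 * Q x + Q x ^ 4) = 0 := by
  refine integral_eq_zero_of_hasDerivAt_of_integrable
    (f := fun x => Q x * Q x + 1 / 5 * (Q x ^ 3 * Q x * Q x)) (fun x => ?_)
    (memLp_Qd.integrable_two_mul memLp_two_mul_Q_add) ?_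
  · exact (((hasDerivAt_Q x).fun_mul (hasDerivAt_Q x)).fun_add
      ((((hasDerivAt_Q_cube x).fun_mul (hasDerivAt_Q x)).fun_mul
        (hasDerivAt_Q x)).const_mul (1 / 5))).congr_deriv (by simp only [Qd]; ring)
  · have h1 := memLp_Q.bounded_mul (g := fun x => Q x ^ 3) (C := 5 / 2)
      (continuous_Q.pow 3).aestronglyMeasurable fun x => by
        rw [abs_of_pos (Q_cube_pos x)]; exact Q_cube_le_const x
    exact (memLp_Q.integrable_two_mul memLp_Q).add ((h1.integrable_two_mul memLp_Q).const_mul _)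

lemma linear_estimate_aux {p q2 l0 y1 y2 y3 K₁ K₂ : ℝ} (hl0 : 0 < l0) (hp : 0 ≤ p) (hq2 : 0 < q2)
    (hK₁ : 0 < K₁) (hK₂ : 0 < K₂) (hy1 : 0 ≤ y1) (hy2 : 0 ≤ y2) (hy3 : 0 ≤ y3) :
    ∃ C : ℝ, 0 ≤ C ∧ ∀ {d r n s ε α lam X1 X2 X3 : ℝ}, l0 ≤ lam → lam ≤ 1 →
      n ≤ K₁ * s + K₂ * ε ^ 2 → (lam * ε) ^ 2 ≤ r * p →
      α * lam * q2 / 2 = lam * X1 + X2 + X3 → X1 ^ 2 ≤ n * y1 → X2 ^ 2 ≤ n * y2 →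
      X3 ^ 2 ≤ r * y3 → d ≤ 2 * n + 2 * (α ^ 2 * p) →
      (∀ η, 0 < η → s ≤ η * d + 1 / η * r) → d ≤ C * r := by
  refine ⟨2 * (2 * ((2 + 2 * p * (12 / (l0 ^ 2 * q2 ^ 2)) * (y1 + y2)) * K₁) ^ 2
      + (2 + 2 * p * (12 / (l0 ^ 2 * q2 ^ 2)) * (y1 + y2)) * (K₂ * p / l0 ^ 2)
      + 2 * p * (12 / (l0 ^ 2 * q2 ^ 2)) * y3), by positivity, ?_⟩
  intro d r n s ε α lam X1 X2 X3 hl hl1 hcoer hε hα hX1 hX2 hX3 hdn hs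
  set a := 12 / (l0 ^ 2 * q2 ^ 2) with ha
  have hap : 0 < a := by positivity
  have hll : l0 ^ 2 ≤ lam ^ 2 := pow_le_pow_left₀ hl0.le hl 2
  have hα2 : α ^ 2 ≤ a * (n * y1 + n * y2 + r * y3) := by
    have h1 : (α * lam * q2 / 2) ^ 2 ≤ 3 * (lam ^ 2 * X1 ^ 2 + X2 ^ 2 + X3 ^ 2) := by
      rw [hα]
      nlinarith [sq_nonneg (lam * X1 - X2), sq_nonneg (lam * X1 - X3), sq_nonneg (X2 - X3)]
    have h2 : lam ^ 2 * X1 ^ 2 ≤ 1 * (n * y1) := by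
      gcongr
      exact pow_le_one₀ (hl0.le.trans hl) hl1
    have h3 : α ^ 2 * (l0 ^ 2 * q2 ^ 2) ≤ α ^ 2 * (lam ^ 2 * q2 ^ 2) := by gcongr
    rw [ha, div_mul_eq_mul_div, le_div_iff₀ (by positivity)]
    nlinarith
  have hε2 : ε ^ 2 ≤ p / l0 ^ 2 * r := by
    rw [div_mul_eq_mul_div, le_div_iff₀ (by positivity)]
    have : ε ^ 2 * l0 ^ 2 ≤ ε ^ 2 * lam ^ 2 := by gcongr
    nlinarith
  set k1 := 2 + 2 * p * a * (y1 + y2) with hk1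
  have hk1p : 0 < k1 := by positivity
  have h1 : d ≤ k1 * n + 2 * p * a * y3 * r := by
    have : α ^ 2 * p ≤ a * (n * y1 + n * y2 + r * y3) * p := by gcongr
    rw [hk1]; linarith
  have h2 : n ≤ K₁ * s + K₂ * p / l0 ^ 2 * r := by
    have : K₂ * ε ^ 2 ≤ K₂ * (p / l0 ^ 2 * r) := by gcongr
    calc n ≤ K₁ * s + K₂ * (p / l0 ^ 2 * r) := by linarith
      _ = _ := by ring
  have h3 := hs (1 / (2 * (k1 * K₁))) (by positivity)
  have h4 : k1 * n ≤ k1 * (K₁ * s + K₂ * p / l0 ^ 2 * r) := by gcongr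
  have h5 : k1 * K₁ * s ≤ k1 * K₁ * (1 / (2 * (k1 * K₁)) * d + 1 / (1 / (2 * (k1 * K₁))) * r) := by
    gcongr
  have h6 : k1 * K₁ * (1 / (2 * (k1 * K₁)) * d + 1 / (1 / (2 * (k1 * K₁))) * r)
      = d / 2 + 2 * (k1 * K₁) ^ 2 * r := by field_simp
  linarith

/-- The a priori estimate for `(L D)' + lam D = R'` in `H³`. -/
lemma linear_estimate {l0 : ℝ} (hl0 : 0 < l0) : ∃ K : ℝ, 0 < K ∧
    ∀ (lam : ℝ) (D D1 D2 D3 R R1 : ℝ → ℝ), l0 ≤ lam → lam ≤ 1 → IsLinSol lam D D1 D2 R →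
    (∀ x, HasDerivAt D2 (D3 x) x) → (∀ x, HasDerivAt R (R1 x) x) → MemLp D3 2 → MemLp R1 2 →
    (∫ x, D x ^ 2) + (∫ x, D1 x ^ 2) + (∫ x, D2 x ^ 2) + (∫ x, D3 x ^ 2)
      ≤ K * ((∫ x, R x ^ 2) + ∫ x, R1 x ^ 2) := by
  obtain ⟨K₁, K₂, hK₁, hK₂, hcoer⟩ := form_coercive
  have hp : 0 ≤ ∫ x, Qd x ^ 2 := integral_nonneg fun x => sq_nonneg _
  have hy1 : 0 ≤ ∫ x, (x * Q x) ^ 2 := integral_nonneg fun x => sq_nonneg _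
  have hy2 : 0 ≤ ∫ x, (2 * Q x + Q x ^ 4) ^ 2 := integral_nonneg fun x => sq_nonneg _
  have hy3 : 0 ≤ ∫ x, xQd x ^ 2 := integral_nonneg fun x => sq_nonneg _
  have hq2 := integral_Q_sq_pos
  obtain ⟨C, hC0, hCaux⟩ := linear_estimate_aux hl0 hp hq2 hK₁ hK₂ hy1 hy2 hy3
  have hC : ∀ (lam : ℝ) (D D1 D2 R : ℝ → ℝ), l0 ≤ lam → lam ≤ 1 → IsLinSol lam D D1 D2 R →
      (∫ x, D x ^ 2) ≤ C * ∫ x, R x ^ 2 := by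
    intro lam D D1 D2 R hl hl1 h
    obtain ⟨hd, hd1, hD, hD1, hD2, hR, hM⟩ := id h
    have hlam : 0 < lam := hl0.trans_le hl
    obtain ⟨α, hα⟩ := hcoer D D1 hd hD hD1
    rw [h.energy_identity hlam] at hα
    have hNL : MemLp (fun x => D x - α * Qd x) 2 := hD.sub (memLp_Qd.const_mul α)
    have hpQ := h.pairing_Q
    have hpx := h.pairing_xQ
    have e1 : ∫ x, D x * (x * Q x)
        = (∫ x, (D x - α * Qd x) * (x * Q x)) + α * (-(∫ x, Q x ^ 2) / 2) := by
      rw [← integral_Qd_mul_xQ, ← integral_const_mul,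
        ← integral_add (hNL.integrable_two_mul memLp_id_mul_Q)
          ((memLp_Qd.integrable_two_mul memLp_id_mul_Q).const_mul α)]
      congr 1; funext x; ring
    have e2 : ∫ x, D x * (2 * Q x + Q x ^ 4)
        = ∫ x, (D x - α * Qd x) * (2 * Q x + Q x ^ 4) := by
      have : ∫ x, (D x - α * Qd x) * (2 * Q x + Q x ^ 4)
          = (∫ x, D x * (2 * Q x + Q x ^ 4)) - ∫ x, α * (Qd x * (2 * Q x + Q x ^ 4)) := by
        rw [← integral_sub (hD.integrable_two_mul memLp_two_mul_Q_add)
          ((memLp_Qd.integrable_two_mul memLp_two_mul_Q_add).const_mul α)]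
        congr 1; funext x; ring
      rw [this, integral_const_mul, integral_Qd_mul_two_mul_Q_add]; ring
    have hdn : ∫ x, D x ^ 2 ≤ 2 * (∫ x, (D x - α * Qd x) ^ 2) + 2 * (α ^ 2 * ∫ x, Qd x ^ 2) := by
      have u := integral_add_sq_le hNL (memLp_Qd.const_mul α)
      simp_rw [mul_pow] at u
      rw [integral_const_mul] at u
      simpa using u
    refine hCaux hl hl1 hα ?_ ?_
      (sq_integral_mul_le hNL memLp_id_mul_Q) (sq_integral_mul_le hNL memLp_two_mul_Q_add)
      (sq_integral_mul_le hR memLp_xQd) hdn (fun η hη => integral_mul_le_add_sq hD hR hη)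
    · rw [hpQ, neg_sq]; exact sq_integral_mul_le hR memLp_Qd
    · rw [e1, e2] at hpx; linarith
  refine ⟨4004 * (C + (10 * C + 1) + 1), by positivity, ?_⟩
  intro lam D D1 D2 D3 R R1 hl hl1 h hd2 hRd hD3 hR1
  obtain ⟨hd, hd1, hD, hD1, hD2, hR, hM⟩ := id h
  have hlam : 0 < lam := hl0.trans_le hl
  have hd0 := hC lam D D1 D2 R hl hl1 h
  have hr : 0 ≤ ∫ x, R x ^ 2 := integral_nonneg fun x => sq_nonneg _
  have hr1 : 0 ≤ ∫ x, R1 x ^ 2 := integral_nonneg fun x => sq_nonneg _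
  have hdp : 0 ≤ ∫ x, D x ^ 2 := integral_nonneg fun x => sq_nonneg _
  have i0 := hD.integrable_sq
  have i1 := hD1.integrable_sq
  have i3 := hR1.integrable_sq
  have hE := h.energy_identity hlam
  have hb1 : ∫ x, D1 x ^ 2 ≤ 10 * (∫ x, D x ^ 2) + ∫ x, R x ^ 2 := by
    have h1 : ∫ x, D1 x ^ 2 ≤ ∫ x, ((D1 x ^ 2 + pot x * D x ^ 2) + 9 * D x ^ 2) := by
      have ip : Integrable fun x => pot x * D x ^ 2 :=
        i0.bdd_mul continuous_pot.aestronglyMeasurable (ae_of_all _ abs_pot_le)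
      refine integral_mono i1 (by fun_prop) fun x => ?_
      have := (abs_le.1 (abs_pot_le x)).1
      change D1 x ^ 2 ≤ (D1 x ^ 2 + pot x * D x ^ 2) + 9 * D x ^ 2
      nlinarith [sq_nonneg (D x)]
    have ip : Integrable fun x => pot x * D x ^ 2 :=
      i0.bdd_mul continuous_pot.aestronglyMeasurable (ae_of_all _ abs_pot_le)
    rw [integral_add (by fun_prop) (by fun_prop), integral_const_mul, hE] at h1
    have := integral_mul_le_add_sq hD hR one_pos
    linarith
  have hD3e : ∀ x, D3 x = lam * D x + pot x * D1 x + 12 * Th x * Q x ^ 3 * D x - R1 x := by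
    intro x
    have := (((hd2 x).fun_neg.fun_add ((hasDerivAt_pot x).fun_mul (hd x))).fun_sub
      (hRd x)).unique (hM x)
    linarith
  have hb3 : ∫ x, D3 x ^ 2
      ≤ 4000 * (∫ x, D x ^ 2) + 400 * (∫ x, D1 x ^ 2) + 4 * ∫ x, R1 x ^ 2 := by
    rw [← integral_const_mul, ← integral_const_mul, ← integral_const_mul,
      ← integral_add (by fun_prop) (by fun_prop), ← integral_add (by fun_prop) (by fun_prop)]
    refine integral_mono hD3.integrable_sq (by fun_prop) fun x => ?_
    change D3 x ^ 2 ≤ 4000 * D x ^ 2 + 400 * D1 x ^ 2 + 4 * R1 x ^ 2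
    rw [hD3e]
    have hq := Q_cube_le_const x
    have hq0 := Q_cube_pos x
    have hT := Th_sq_lt_one x
    have hs1 : (12 * Th x * Q x ^ 3) ^ 2 ≤ 900 := by
      have : (Q x ^ 3) ^ 2 ≤ (5 / 2) ^ 2 := pow_le_pow_left₀ hq0.le hq 2
      calc (12 * Th x * Q x ^ 3) ^ 2 = 144 * (Th x ^ 2 * (Q x ^ 3) ^ 2) := by ring
        _ ≤ 144 * (1 * (5 / 2) ^ 2) := by gcongr
        _ = 900 := by norm_num
    have hs2 : pot x ^ 2 ≤ 81 := by
      have := abs_pot_le x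
      rw [← sq_abs]; nlinarith [abs_nonneg (pot x)]
    have hs3 : lam ^ 2 ≤ 1 := pow_le_one₀ hlam.le hl1
    generalize 12 * Th x * Q x ^ 3 = u at hs1
    have b1 : (u * D x) ^ 2 ≤ 900 * D x ^ 2 := by rw [mul_pow]; gcongr
    have b2 : (pot x * D1 x) ^ 2 ≤ 81 * D1 x ^ 2 := by rw [mul_pow]; gcongr
    have b3 : (lam * D x) ^ 2 ≤ 1 * D x ^ 2 := by rw [mul_pow]; gcongr
    generalize u * D x = e1 at b1 ⊢
    generalize pot x * D1 x = e2 at b2 ⊢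
    generalize lam * D x = e3 at b3 ⊢
    nlinarith [sq_nonneg (e1 - e2), sq_nonneg (e1 - e3), sq_nonneg (e1 + R1 x),
      sq_nonneg (e2 - e3), sq_nonneg (e2 + R1 x), sq_nonneg (e3 + R1 x), sq_nonneg (D1 x),
      sq_nonneg (D x)]
  have hb2 : ∫ x, D2 x ^ 2 ≤ (∫ x, D1 x ^ 2) + ∫ x, D3 x ^ 2 := by
    have i5 := hD1.integrable_two_mul hD3
    have i6 := hD2.integrable_sq
    have h1 := integral_eq_zero_of_hasDerivAt_of_integrable
      (f := fun x => D1 x * D2 x) (f' := fun x => D2 x ^ 2 + D1 x * D3 x)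
      (fun x => ((hd1 x).fun_mul (hd2 x)).congr_deriv (by ring))
      (by fun_prop) (hD1.integrable_two_mul hD2)
    rw [integral_add i6 i5] at h1
    have h2 := integral_mul_le_add_sq hD1.neg hD3 one_pos
    simp only [Pi.neg_apply, neg_mul, neg_sq] at h2
    rw [integral_neg] at h2
    linarith
  nlinarith

/-- The profile `e^{-s x} Q³` of the source term. -/
noncomputable def src (s x : ℝ) : ℝ := exp (-s * x) * Q x ^ 3

noncomputable def srcd (s x : ℝ) : ℝ := exp (-s * x) * ((-s - 3 * Th x) * Q x ^ 3)

lemma hasDerivAt_exp_neg_mul (s x : ℝ) :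
    HasDerivAt (fun y => exp (-s * y)) (-s * exp (-s * x)) x :=
  (((hasDerivAt_id' x).const_mul (-s)).exp).congr_deriv (by ring)

lemma hasDerivAt_src (s x : ℝ) : HasDerivAt (src s) (srcd s x) x :=
  ((hasDerivAt_exp_neg_mul s x).fun_mul (hasDerivAt_Q_cube x)).congr_deriv
    (by simp only [srcd]; ring)

lemma continuous_src (s : ℝ) : Continuous (src s) :=
  continuous_iff_continuousAt.2 fun x => (hasDerivAt_src s x).continuousAt

lemma abs_exp_sub_exp_le {u v m : ℝ} (hu : u ≤ m) (hv : v ≤ m) :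
    |exp u - exp v| ≤ |u - v| * exp m := by
  wlog h : v ≤ u generalizing u v
  · rw [abs_sub_comm, abs_sub_comm u]; exact this hv hu (le_of_not_ge h)
  rw [abs_of_nonneg (sub_nonneg.2 (exp_le_exp.2 h)), abs_of_nonneg (sub_nonneg.2 h)]
  have h1 := add_one_le_exp (v - u)
  have h2 : exp v = exp u * exp (v - u) := by rw [← exp_add]; congr 1; ring
  have h3 : exp u ≤ exp m := exp_le_exp.2 hu
  have h4 := exp_pos u
  calc exp u - exp v = exp u * (1 - exp (v - u)) := by rw [h2]; ring
    _ ≤ exp u * (u - v) := mul_le_mul_of_nonneg_left (by linarith) h4.le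
    _ ≤ exp m * (u - v) := mul_le_mul_of_nonneg_right h3 (by linarith)
    _ = _ := mul_comm _ _

lemma exp_neg_mul_le {s : ℝ} (h0 : 0 ≤ s) (h1 : s ≤ 1) (x : ℝ) : -s * x ≤ |x| := by
  have := neg_abs_le x
  nlinarith [abs_nonneg x]

lemma exp_mul_Q_cube_le {s : ℝ} (h0 : 0 ≤ s) (h1 : s ≤ 1) (x : ℝ) :
    exp (-s * x) * Q x ^ 3 ≤ 10 * exp (-|x|) := by
  have h2 := Q_cube_le x
  have h3 : exp (-s * x) ≤ exp |x| := exp_le_exp.2 (exp_neg_mul_le h0 h1 x)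
  have hx := abs_nonneg x
  calc exp (-s * x) * Q x ^ 3 ≤ exp |x| * (10 * exp (-3 * |x|)) := by
        have := Q_cube_pos x
        gcongr
    _ = 10 * exp (-2 * |x|) := by
        rw [mul_left_comm, ← exp_add]; congr 2; ring
    _ ≤ 10 * exp (-|x|) := by gcongr; linarith

lemma exp_sub_exp_mul_Q_cube_le {s s' : ℝ} (h0 : 0 ≤ s) (h1 : s ≤ 1) (h0' : 0 ≤ s') (h1' : s' ≤ 1)
    (x : ℝ) : |exp (-s * x) - exp (-s' * x)| * Q x ^ 3 ≤ 10 * |s - s'| * exp (-|x|) := by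
  have h2 := Q_cube_le x
  have h3 := abs_exp_sub_exp_le (exp_neg_mul_le h0 h1 x) (exp_neg_mul_le h0' h1' x)
  have h4 : |-s * x - -s' * x| = |s - s'| * |x| := by
    rw [← abs_mul, ← abs_neg]; congr 1; ring
  rw [h4] at h3
  have hx : |x| ≤ exp |x| := by linarith [add_one_le_exp |x|]
  calc |exp (-s * x) - exp (-s' * x)| * Q x ^ 3
      ≤ (|s - s'| * exp |x| * exp |x|) * (10 * exp (-3 * |x|)) := by
        have := Q_cube_pos x
        refine mul_le_mul (h3.trans ?_) h2 this.le (by positivity)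
        gcongr
    _ = 10 * |s - s'| * (exp |x| * exp |x| * exp (-3 * |x|)) := by ring
    _ = 10 * |s - s'| * exp (-|x|) := by
        rw [← exp_add, ← exp_add]; congr 2; ring

lemma abs_src_sub_le {s s' : ℝ} (h0 : 0 ≤ s) (h1 : s ≤ 1) (h0' : 0 ≤ s') (h1' : s' ≤ 1)
    (x : ℝ) : |src s x - src s' x| ≤ 10 * |s - s'| * exp (-|x|) := by
  rw [src, src, ← sub_mul, abs_mul, abs_of_pos (Q_cube_pos x)]
  exact exp_sub_exp_mul_Q_cube_le h0 h1 h0' h1' x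

lemma abs_neg_sub_three_mul_Th_le {s : ℝ} (h0 : 0 ≤ s) (h1 : s ≤ 1) (x : ℝ) :
    |-s - 3 * Th x| ≤ 4 := by
  have := abs_lt.1 (abs_Th_lt_one x)
  rw [abs_le]; constructor <;> linarith

lemma abs_srcd_sub_le {s s' : ℝ} (h0 : 0 ≤ s) (h1 : s ≤ 1) (h0' : 0 ≤ s') (h1' : s' ≤ 1)
    (x : ℝ) : |srcd s x - srcd s' x| ≤ 50 * |s - s'| * exp (-|x|) := by
  have e : srcd s x - srcd s' x = (exp (-s * x) - exp (-s' * x)) * Q x ^ 3 * (-s - 3 * Th x)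
      + exp (-s' * x) * Q x ^ 3 * (s' - s) := by simp only [srcd]; ring
  have u1 := exp_sub_exp_mul_Q_cube_le h0 h1 h0' h1' x
  have u2 := exp_mul_Q_cube_le h0' h1' x
  have u3 := abs_neg_sub_three_mul_Th_le h0 h1 x
  have hq := Q_cube_pos x
  have b1 : |(exp (-s * x) - exp (-s' * x)) * Q x ^ 3 * (-s - 3 * Th x)|
      ≤ 10 * |s - s'| * exp (-|x|) * 4 := by
    rw [abs_mul, abs_mul, abs_of_pos hq]
    exact mul_le_mul u1 u3 (abs_nonneg _) (by positivity)
  have b2 : |exp (-s' * x) * Q x ^ 3 * (s' - s)| ≤ 10 * exp (-|x|) * |s - s'| := by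
    rw [abs_mul, abs_of_pos (mul_pos (exp_pos _) hq), abs_sub_comm s' s]
    exact mul_le_mul_of_nonneg_right u2 (abs_nonneg _)
  rw [e]
  exact (abs_add_le _ _).trans (by linarith)

lemma exp_neg_abs_le_half (x : ℝ) : exp (-|x|) ≤ exp (-(1 / 2) * |x|) := by
  have := abs_nonneg x
  gcongr; linarith

lemma memLp_src {s : ℝ} (h0 : 0 ≤ s) (h1 : s ≤ 1) : MemLp (src s) 2 :=
  memLp_two_of_exp_bound (C := 10) (continuous_src s) fun x => by
    have h2 := exp_mul_Q_cube_le h0 h1 x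
    have h3 := Q_cube_pos x
    rw [src, abs_of_pos (by positivity)]
    linarith [exp_neg_abs_le_half x]

lemma memLp_srcd {s : ℝ} (h0 : 0 ≤ s) (h1 : s ≤ 1) : MemLp (srcd s) 2 :=
  ((memLp_src h0 h1).bounded_mul (g := fun x => -s - 3 * Th x) (C := 4)
    (by have := continuous_Th; exact Continuous.aestronglyMeasurable (by fun_prop))
    (abs_neg_sub_three_mul_Th_le h0 h1)).of_forall_eq fun x => by
      simp only [src, srcd]; ring

section params

variable {c c' : ℝ}

lemma half_le_sqrt (h : 3 / 4 ≤ c) : 1 / 2 ≤ √c :=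
  Real.le_sqrt_of_sq_le (by linarith)

lemma sqrt_lt_one (h : c < 1) : √c < 1 := by
  rw [Real.sqrt_lt' one_pos]; linarith

lemma abs_sqrt_sub_sqrt_le (h : 3 / 4 ≤ c) (h' : 3 / 4 ≤ c') : |√c - √c'| ≤ |c - c'| := by
  have h1 := half_le_sqrt h
  have h2 := half_le_sqrt h'
  have e : c - c' = (√c - √c') * (√c + √c') := by
    have := Real.sq_sqrt (show 0 ≤ c by linarith)
    have := Real.sq_sqrt (show 0 ≤ c' by linarith)
    nlinarith
  rw [e, abs_mul, abs_of_nonneg (show 0 ≤ √c + √c' by linarith)]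
  nlinarith [abs_nonneg (√c - √c')]

/-- The coefficient `√c (1 - c)` of the zeroth order term. -/
noncomputable def lamc (c : ℝ) : ℝ := √c * (1 - c)

lemma lamc_pos (h : 3 / 4 ≤ c) (h1 : c < 1) : 0 < lamc c :=
  mul_pos (by linarith [half_le_sqrt h]) (by linarith)

lemma lamc_le_one (h : 3 / 4 ≤ c) (h1 : c < 1) : lamc c ≤ 1 := by
  have := sqrt_lt_one h1
  have := half_le_sqrt h
  rw [lamc]; nlinarith

lemma abs_lamc_sub_le (h : 3 / 4 ≤ c) (h1 : c < 1) (h' : 3 / 4 ≤ c') (h1' : c' < 1) :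
    |lamc c' - lamc c| ≤ 2 * |c - c'| := by
  have e : lamc c' - lamc c = (√c' - √c) * (1 - c') + √c * (c - c') := by
    simp only [lamc]; ring
  have u := abs_sqrt_sub_sqrt_le h' h
  have h2 := sqrt_lt_one h1
  have h3 := half_le_sqrt h
  rw [abs_sub_comm c'] at u
  rw [e]
  refine (abs_add_le _ _).trans ?_
  rw [abs_mul, abs_mul, abs_of_nonneg (show 0 ≤ 1 - c' by linarith),
    abs_of_nonneg (show 0 ≤ √c by linarith)]
  nlinarith [abs_nonneg (c - c'), abs_nonneg (√c' - √c)]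

end params

section solution

variable {c : ℝ} {A : ℝ → ℝ}

lemma IsAc.hasDerivAt_iteratedDeriv (h : IsAc c A) (k : ℕ) (x : ℝ) :
    HasDerivAt (iteratedDeriv k A) (iteratedDeriv (k + 1) A x) x := by
  rw [iteratedDeriv_succ]
  exact (h.1.differentiable_iteratedDeriv k
    (by exact_mod_cast WithTop.coe_lt_top _) x).hasDerivAt

lemma IsAc.continuous_iteratedDeriv (h : IsAc c A) (k : ℕ) : Continuous (iteratedDeriv k A) :=
  continuous_iff_continuousAt.2 fun x => (h.hasDerivAt_iteratedDeriv k x).continuousAt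

lemma IsAc.memLp (h : IsAc c A) {k : ℕ} (hk : k ≤ 10) : MemLp (iteratedDeriv k A) 2 :=
  (memLp_two_iff_integrable_sq (h.continuous_iteratedDeriv k).aestronglyMeasurable).2 (h.2.1 k hk)

lemma IsAc.hasDerivAt_LQ_sub_src (h : IsAc c A) (x : ℝ) :
    HasDerivAt (fun y => -iteratedDeriv 2 A y + pot y * iteratedDeriv 0 A y - src (√c) y)
      (-lamc c * iteratedDeriv 0 A x) x := by
  have h1 := h.hasDerivAt_iteratedDeriv 2 x
  have h2 := h.hasDerivAt_iteratedDeriv 0 x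
  have e : LQ A = fun y => -iteratedDeriv 2 A y + pot y * iteratedDeriv 0 A y := by
    funext y; simp only [LQ, pot, iteratedDeriv_zero]; ring
  have h3 := h1.fun_neg.fun_add ((hasDerivAt_pot x).fun_mul h2)
  have h4 := h.2.2 x
  rw [e, h3.deriv] at h4
  have h5 : deriv (fun y => exp (-√c * y) * Q y ^ 3) x = srcd (√c) x :=
    (hasDerivAt_src (√c) x).deriv
  rw [h5] at h4
  refine (h3.fun_sub (hasDerivAt_src (√c) x)).congr_deriv ?_
  simp only [iteratedDeriv_zero, lamc] at h4 ⊢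
  linarith

end solution

lemma integral_sq_le_of_abs_le_exp {f : ℝ → ℝ} {C : ℝ} (hf : MemLp f 2)
    (h : ∀ x, |f x| ≤ C * exp (-|x|)) :
    ∫ x, f x ^ 2 ≤ C ^ 2 * ∫ x : ℝ, exp (-2 * |x|) := by
  rw [← integral_const_mul]
  refine integral_mono hf.integrable_sq
    ((integrable_exp_neg_abs two_pos).const_mul _) fun x => ?_
  have : exp (-2 * |x|) = exp (-|x|) ^ 2 := by
    rw [← Real.exp_nat_mul]; congr 1; push_cast; ring
  change f x ^ 2 ≤ C ^ 2 * exp (-2 * |x|)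
  rw [this, ← mul_pow, ← sq_abs]
  exact pow_le_pow_left₀ (abs_nonneg _) (h x) 2

/-- Local Lipschitz dependence on `c` of the solution in `H³`. -/
lemma lipschitz_H3 {A : ℝ → ℝ → ℝ} (hA : ∀ c : ℝ, 3 / 4 ≤ c → c < 1 → IsAc c (A c)) {c : ℝ}
    (hc : 3 / 4 ≤ c) (hc1 : c < 1) : ∃ C : ℝ, 0 < C ∧ ∃ δ : ℝ, 0 < δ ∧
      ∀ c' : ℝ, 3 / 4 ≤ c' → c' < 1 → |c - c'| < δ →
        (∑ k ∈ Finset.range 4,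
          ∫ x : ℝ, (iteratedDeriv k (A c) x - iteratedDeriv k (A c') x) ^ 2)
          ≤ C ^ 2 * |c - c'| ^ 2 := by
  have hs0 : 0 ≤ √c := Real.sqrt_nonneg c
  have hs1 : √c ≤ 1 := (sqrt_lt_one hc1).le
  have h := hA c hc hc1
  have hl := lamc_pos hc hc1
  obtain ⟨K, hK, hest⟩ := linear_estimate (show 0 < (1 - c) / 4 by linarith)
  set E : ℝ → ℝ := fun y =>
    -iteratedDeriv 2 (A c) y + pot y * iteratedDeriv 0 (A c) y - src (√c) y with hE
  have hEL : MemLp E 2 :=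
    ((h.memLp (by norm_num)).neg.add (h.memLp (by norm_num)).pot_mul).sub (memLp_src hs0 hs1)
  obtain ⟨e, he⟩ : ∃ e, e = ∫ x, E x ^ 2 := ⟨_, rfl⟩
  obtain ⟨a, ha⟩ : ∃ a, a = ∫ x, iteratedDeriv 0 (A c) x ^ 2 := ⟨_, rfl⟩
  obtain ⟨J, hJ⟩ : ∃ J, J = ∫ x : ℝ, exp (-2 * |x|) := ⟨_, rfl⟩
  have he0 : 0 ≤ e := he ▸ integral_nonneg fun x => sq_nonneg _
  have ha0 : 0 ≤ a := ha ▸ integral_nonneg fun x => sq_nonneg _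
  have hJ0 : 0 ≤ J := hJ ▸ integral_nonneg fun x => (exp_pos _).le
  set C0 := 5200 * J + 8 / lamc c ^ 2 * e + 8 * a with hC0
  have hC0p : 0 ≤ C0 := by positivity
  refine ⟨K * C0 + 1, by positivity, (1 - c) / 2, by linarith, ?_⟩
  intro c' hc' hc1' hcc
  have h' := hA c' hc' hc1'
  have hs0' : 0 ≤ √c' := Real.sqrt_nonneg c'
  have hs1' : √c' ≤ 1 := (sqrt_lt_one hc1').le
  have hss := abs_sqrt_sub_sqrt_le hc hc'
  have hll := abs_lamc_sub_le hc hc1 hc' hc1'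
  have hl' : (1 - c) / 4 ≤ lamc c' := by
    have h1 := half_le_sqrt hc'
    have h2 := (abs_lt.1 hcc).1
    rw [lamc]; nlinarith
  set ρ := (lamc c' - lamc c) / lamc c with hρ
  set f : ℝ → ℝ := fun x => src (√c) x - src (√c') x with hf
  set f1 : ℝ → ℝ := fun x => srcd (√c) x - srcd (√c') x with hf1
  have hfL : MemLp f 2 := (memLp_src hs0 hs1).sub (memLp_src hs0' hs1')
  have hf1L : MemLp f1 2 := (memLp_srcd hs0 hs1).sub (memLp_srcd hs0' hs1')
  set R : ℝ → ℝ := fun x => f x + -ρ * E x with hR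
  set R1 : ℝ → ℝ := fun x => f1 x + (lamc c' - lamc c) * iteratedDeriv 0 (A c) x with hR1
  have hEd : ∀ x, HasDerivAt E (-lamc c * iteratedDeriv 0 (A c) x) x := h.hasDerivAt_LQ_sub_src
  have hRd : ∀ x, HasDerivAt R (R1 x) x := fun x =>
    (((hasDerivAt_src (√c) x).fun_sub (hasDerivAt_src (√c') x)).fun_add
      ((hEd x).const_mul (-ρ))).congr_deriv (by simp only [hR1, hf1, hρ]; field_simp)
  have hRL : MemLp R 2 := hfL.add (hEL.const_mul (-ρ))
  have hR1L : MemLp R1 2 := hf1L.add ((h.memLp (k := 0) (by norm_num)).const_mul _)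
  set D : ℕ → ℝ → ℝ := fun k x => iteratedDeriv k (A c) x - iteratedDeriv k (A c') x with hD
  have hDd : ∀ k x, HasDerivAt (D k) (D (k + 1) x) x := fun k x =>
    (h.hasDerivAt_iteratedDeriv k x).fun_sub (h'.hasDerivAt_iteratedDeriv k x)
  have hDL : ∀ k, k ≤ 10 → MemLp (D k) 2 := fun k hk => (h.memLp hk).sub (h'.memLp hk)
  have hsol : IsLinSol (lamc c') (D 0) (D 1) (D 2) R := by
    refine ⟨hDd 0, hDd 1, hDL 0 (by norm_num), hDL 1 (by norm_num), hDL 2 (by norm_num), hRL, ?_⟩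
    intro x
    have e1 : (fun y => -D 2 y + pot y * D 0 y - R y) = fun y => (1 + ρ) * E y
        - (-iteratedDeriv 2 (A c') y + pot y * iteratedDeriv 0 (A c') y - src (√c') y) := by
      funext y; simp only [hD, hR, hE, hf]; ring
    rw [e1]
    refine (((hEd x).const_mul (1 + ρ)).fun_sub (h'.hasDerivAt_LQ_sub_src x)).congr_deriv ?_
    simp only [hD, hρ]; field_simp; ring
  have main := hest (lamc c') (D 0) (D 1) (D 2) (D 3) R R1 hl' (lamc_le_one hc' hc1') hsol
    (hDd 2) hRd (hDL 3 (by norm_num)) hR1L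
  have hcc0 : 0 ≤ |c - c'| := abs_nonneg _
  have bf : ∫ x, f x ^ 2 ≤ 100 * |c - c'| ^ 2 * J := by
    have := integral_sq_le_of_abs_le_exp hfL (C := 10 * |√c - √c'|)
      (abs_src_sub_le hs0 hs1 hs0' hs1')
    rw [hJ]
    refine this.trans ?_
    rw [← hJ, mul_pow]
    gcongr; norm_num
  have bf1 : ∫ x, f1 x ^ 2 ≤ 2500 * |c - c'| ^ 2 * J := by
    have := integral_sq_le_of_abs_le_exp hf1L (C := 50 * |√c - √c'|)
      (abs_srcd_sub_le hs0 hs1 hs0' hs1')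
    rw [hJ]
    refine this.trans ?_
    rw [← hJ, mul_pow]
    gcongr; norm_num
  have hl2 : (lamc c' - lamc c) ^ 2 ≤ 4 * |c - c'| ^ 2 := by
    rw [← sq_abs (lamc c' - lamc c)]
    calc _ ≤ (2 * |c - c'|) ^ 2 := pow_le_pow_left₀ (abs_nonneg _) hll 2
      _ = _ := by ring
  have hρ2 : ρ ^ 2 ≤ 4 / lamc c ^ 2 * |c - c'| ^ 2 := by
    rw [hρ, div_pow, div_mul_eq_mul_div]
    gcongr
  have bR : ∫ x, R x ^ 2
      ≤ 2 * (100 * |c - c'| ^ 2 * J) + 2 * (4 / lamc c ^ 2 * |c - c'| ^ 2 * e) := by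
    have u := integral_add_sq_le hfL (hEL.const_mul (-ρ))
    simp_rw [mul_pow] at u
    rw [integral_const_mul, ← he, neg_sq] at u
    have : ρ ^ 2 * e ≤ 4 / lamc c ^ 2 * |c - c'| ^ 2 * e := by gcongr
    linarith
  have bR1 : ∫ x, R1 x ^ 2 ≤ 2 * (2500 * |c - c'| ^ 2 * J) + 2 * (4 * |c - c'| ^ 2 * a) := by
    have u := integral_add_sq_le hf1L ((h.memLp (k := 0) (by norm_num)).const_mul
      (lamc c' - lamc c))
    simp_rw [mul_pow] at u
    rw [integral_const_mul, ← ha] at u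
    have : (lamc c' - lamc c) ^ 2 * a ≤ 4 * |c - c'| ^ 2 * a := by gcongr
    linarith
  have hfin : (∫ x, R x ^ 2) + ∫ x, R1 x ^ 2 ≤ C0 * |c - c'| ^ 2 := by
    refine (add_le_add bR bR1).trans (le_of_eq ?_)
    rw [hC0]; ring
  simp only [Finset.sum_range_succ, Finset.sum_range_zero, zero_add]
  refine main.trans ?_
  calc K * ((∫ x, R x ^ 2) + ∫ x, R1 x ^ 2) ≤ K * (C0 * |c - c'| ^ 2) := by gcongr
    _ = K * C0 * |c - c'| ^ 2 := by ring
    _ ≤ (K * C0 + 1) ^ 2 * |c - c'| ^ 2 := by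
      have : 0 ≤ K * C0 := by positivity
      gcongr
      nlinarith

section exponents

variable {c : ℝ}

/-- The decay rate `√(1 - 3c/4) - √c/2`. -/
noncomputable def gam (c : ℝ) : ℝ := √(1 - 3 / 4 * c) - 1 / 2 * √c

lemma gam_quadratic (h : 3 / 4 ≤ c) (h1 : c < 1) : gam c ^ 2 + √c * gam c + √c ^ 2 = 1 := by
  have e1 := Real.sq_sqrt (show 0 ≤ c by linarith)
  have e2 := Real.sq_sqrt (show 0 ≤ 1 - 3 / 4 * c by linarith)
  rw [gam]; linear_combination e2 + 3 / 4 * e1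

lemma gam_pos (h : 3 / 4 ≤ c) (h1 : c < 1) : 0 < gam c := by
  have : 1 / 2 * √c < √(1 - 3 / 4 * c) := by
    apply Real.lt_sqrt_of_sq_lt
    rw [mul_pow, Real.sq_sqrt (by linarith)]; linarith
  rw [gam]; linarith

lemma gam_lt_sqrt (h : 3 / 4 ≤ c) (h1 : c < 1) : gam c < √c := by
  have h2 := gam_quadratic h h1
  have h3 := gam_pos h h1
  have h4 := Real.sq_sqrt (show 0 ≤ c by linarith)
  have h5 := half_le_sqrt h
  by_contra! h6
  nlinarith

lemma lamc_eq (h : 3 / 4 ≤ c) (h1 : c < 1) : lamc c = gam c * √c * (gam c + √c) := by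
  have e1 := Real.sq_sqrt (show 0 ≤ c by linarith)
  have e2 := gam_quadratic h h1
  rw [lamc]; linear_combination √c * (e1 - e2)

end exponents

/-- If `B` has a limit at infinity and `B'' + κ B'` has a limit, then the latter limit is zero. -/
lemma eq_zero_of_tendsto_of_tendsto_deriv {B B' D : ℝ → ℝ} {κ a l : ℝ}
    (hB : ∀ x, HasDerivAt B (B' x) x) (hC : ∀ x, HasDerivAt (fun y => B' y + κ * B y) (D x) x)
    (ha : Tendsto B atTop (nhds a)) (hl : Tendsto D atTop (nhds l)) : l = 0 := by
  have hex : ∀ n : ℕ, ∃ ξ ∈ Set.Ioo (n : ℝ) (n + 1), B' ξ = B (n + 1) - B n := by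
    intro n
    obtain ⟨ξ, h1, h2⟩ := exists_hasDerivAt_eq_slope B B' (show (n : ℝ) < n + 1 by linarith)
      (fun x _ => (hB x).continuousAt.continuousWithinAt) (fun x _ => hB x)
    exact ⟨ξ, h1, by rw [h2]; simp⟩
  choose ξ hξ hξB using hex
  have hn : Tendsto (fun n : ℕ => (n : ℝ)) atTop atTop := tendsto_natCast_atTop_atTop
  have hξt : Tendsto ξ atTop atTop := tendsto_atTop_mono (fun n => (hξ n).1.le) hn
  have hB0 : Tendsto (fun n => B' (ξ n)) atTop (nhds 0) := by
    simp_rw [hξB]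
    simpa using (ha.comp (tendsto_atTop_add_const_right _ 1 hn)).sub (ha.comp hn)
  have hCt : Tendsto (fun n => B' (ξ n) + κ * B (ξ n)) atTop (nhds (κ * a)) := by
    simpa using hB0.add ((ha.comp hξt).const_mul κ)
  have hlt : ∀ n, ξ n + 1 < ξ (n + 2) := fun n => by
    have h1 := (hξ n).2
    have h2 := (hξ (n + 2)).1
    push_cast at h2; linarith
  have hex' : ∀ n, ∃ η, ξ n < η ∧
      |D η| ≤ |(B' (ξ (n + 2)) + κ * B (ξ (n + 2))) - (B' (ξ n) + κ * B (ξ n))| := by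
    intro n
    obtain ⟨η, h1, h2⟩ := exists_hasDerivAt_eq_slope _ D
      (show ξ n < ξ (n + 2) by linarith [hlt n])
      (fun x _ => (hC x).continuousAt.continuousWithinAt) (fun x _ => hC x)
    refine ⟨η, h1.1, ?_⟩
    rw [h2, abs_div]
    refine div_le_self (abs_nonneg _) ?_
    rw [abs_of_pos (by linarith [hlt n])]; linarith [hlt n]
  choose η hη hηD using hex'
  have hηt : Tendsto η atTop atTop := tendsto_atTop_mono (fun n => (hη n).le) hξt
  have hD0 : Tendsto (fun n => D (η n)) atTop (nhds 0) := by
    refine squeeze_zero_norm hηD ?_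
    simpa using ((hCt.comp (tendsto_add_atTop_nat 2)).sub hCt).abs
  exact tendsto_nhds_unique (hl.comp hηt) hD0

section phi

/-- The denominator `e^{3x} + 2 + e^{-3x} = 10 / Q³`. -/
noncomputable def den (x : ℝ) : ℝ := exp (3 * x) + 2 + exp (-(3 * x))

lemma den_pos (x : ℝ) : 0 < den x := by
  have := exp_pos (3 * x)
  have := exp_pos (-(3 * x))
  rw [den]; linarith

lemma Q_cube_eq_div_den (x : ℝ) : Q x ^ 3 = 10 / den x := by
  have h := cosh_sq (3 * x / 2)
  have h2 : 4 * cosh (3 * x / 2) ^ 2 = den x := by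
    rw [Real.cosh_eq, den]
    have e1 : exp (3 * x) = exp (3 * x / 2) ^ 2 := by
      rw [← Real.exp_nat_mul]; congr 1; push_cast; ring
    have e2 : exp (-(3 * x)) = exp (-(3 * x / 2)) ^ 2 := by
      rw [← Real.exp_nat_mul]; congr 1; push_cast; ring
    have e3 : exp (3 * x / 2) * exp (-(3 * x / 2)) = 1 := by rw [← exp_add]; simp
    rw [e1, e2]; linear_combination 2 * e3
  have h3 := den_pos x
  rw [Q_cube_cosh, ← h2]
  have : 0 < cosh (3 * x / 2) := cosh_pos _
  field_simp; norm_num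

lemma exp_three_abs_le_den (x : ℝ) : exp (3 * |x|) ≤ den x := by
  have h1 := exp_pos (3 * x)
  have h2 := exp_pos (-(3 * x))
  rw [den]
  rcases abs_cases x with ⟨h, _⟩ | ⟨h, _⟩ <;> rw [h]
  · linarith
  · rw [mul_neg]; linarith

lemma continuous_den : Continuous den := by unfold den; fun_prop

/-- The function `Q³ (A + e^{-s x}/4) / 10`. -/
noncomputable def phi (s : ℝ) (A : ℝ → ℝ) (x : ℝ) : ℝ := (A x + exp (-s * x) / 4) / den x

variable {s K : ℝ} {A : ℝ → ℝ}

lemma continuous_phi (hA : Continuous A) : Continuous (phi s A) :=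
  (show Continuous fun x => A x + exp (-s * x) / 4 by fun_prop).div continuous_den
    fun x => (den_pos x).ne'

lemma forty_mul_phi (x : ℝ) : 40 * phi s A x = 4 * Q x ^ 3 * A x + src s x := by
  have := den_pos x
  rw [src, Q_cube_eq_div_den, phi]; field_simp; ring

/-- Exponential bounds on `f / (e^{3x} + 2 + e^{-3x})` on the right half-line. -/
lemma abs_div_den_le_of_nonneg (hK : 0 ≤ K) (h0 : 0 ≤ s) {x a : ℝ} (hx : 0 ≤ x)
    (ha : |a| ≤ K + exp (-s * x)) : |a / den x| ≤ (K + 1) * exp (-3 * x) := by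
  have h := exp_three_abs_le_den x
  rw [abs_of_nonneg hx] at h
  rw [abs_div, abs_of_pos (den_pos x), div_le_iff₀ (den_pos x)]
  have h1 : exp (-s * x) ≤ 1 := exp_le_one_iff.2 (by nlinarith)
  have h2 : exp (-3 * x) * exp (3 * x) = 1 := by rw [← exp_add]; simp
  have h3 : (K + 1) * exp (-3 * x) * exp (3 * x) ≤ (K + 1) * exp (-3 * x) * den x := by gcongr
  have h4 : (K + 1) * exp (-3 * x) * exp (3 * x) = K + 1 := by rw [mul_assoc, h2, mul_one]
  linarith

/-- Exponential bounds on `f / (e^{3x} + 2 + e^{-3x})` on the left half-line. -/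
lemma abs_div_den_le_of_nonpos (hK : 0 ≤ K) (h1 : s ≤ 1) {x a : ℝ} (hx : x ≤ 0)
    (ha : |a| ≤ K + exp (-s * x)) : |a / den x| ≤ (K + 1) * exp (2 * x) := by
  have h := exp_three_abs_le_den x
  rw [abs_of_nonpos hx] at h
  rw [abs_div, abs_of_pos (den_pos x), div_le_iff₀ (den_pos x)]
  have h1 : exp (-s * x) ≤ exp (-x) := exp_le_exp.2 (by nlinarith)
  have h2 : exp (2 * x) * exp (3 * -x) = exp (-x) := by rw [← exp_add]; congr 1; ring
  have h3 : (K + 1) * exp (2 * x) * exp (3 * -x) ≤ (K + 1) * exp (2 * x) * den x := by gcongr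
  have h4 : (K + 1) * exp (2 * x) * exp (3 * -x) = (K + 1) * exp (-x) := by rw [mul_assoc, h2]
  have h5 : 1 ≤ exp (-x) := one_le_exp (by linarith)
  nlinarith

lemma abs_phi_num_le (hA : ∀ x, |A x| ≤ K) (x : ℝ) :
    |A x + exp (-s * x) / 4| ≤ K + exp (-s * x) := by
  have h := exp_pos (-s * x)
  refine (abs_add_le _ _).trans ?_
  rw [abs_of_pos (show 0 < exp (-s * x) / 4 by positivity)]
  linarith [hA x]

/-- Functions decaying like `phi`. -/
def PhiDecay (K : ℝ) (f : ℝ → ℝ) : Prop :=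
  (∀ x, 0 ≤ x → |f x| ≤ K * exp (-3 * x)) ∧ ∀ x ≤ 0, |f x| ≤ K * exp (2 * x)

lemma PhiDecay.div_den {f : ℝ → ℝ} (hK : 0 ≤ K) (h0 : 0 ≤ s) (h1 : s ≤ 1)
    (hf : ∀ x, |f x| ≤ K + exp (-s * x)) : PhiDecay (K + 1) fun x => f x / den x :=
  ⟨fun x hx => abs_div_den_le_of_nonneg hK h0 hx (hf x),
    fun x hx => abs_div_den_le_of_nonpos hK h1 hx (hf x)⟩

lemma phiDecay_phi (hK : 0 ≤ K) (h0 : 0 ≤ s) (h1 : s ≤ 1) (hA : ∀ x, |A x| ≤ K) :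
    PhiDecay (K + 1) (phi s A) :=
  PhiDecay.div_den hK h0 h1 (abs_phi_num_le hA)

/-- A function with this decay is integrable against `e^{κ x}` for `0 ≤ κ < 3`. -/
lemma PhiDecay.integrable_exp_mul {f : ℝ → ℝ} (hf : PhiDecay K f) (hc : Continuous f) {κ : ℝ}
    (h0 : 0 ≤ κ) (h3 : κ < 3) : Integrable fun x => exp (κ * x) * f x := by
  refine integrable_of_exp_bounds (Continuous.aestronglyMeasurable (by fun_prop))
    (a := 2) (b := 3 - κ) (C := K) two_pos (by linarith) (fun x hx => ?_) (fun x hx => ?_)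
  · have h1 : exp (κ * x) ≤ 1 := exp_le_one_iff.2 (by nlinarith)
    rw [abs_mul, abs_of_pos (exp_pos _)]
    exact (mul_le_of_le_one_left (abs_nonneg _) h1).trans (hf.2 x hx)
  · rw [abs_mul, abs_of_pos (exp_pos _)]
    calc _ ≤ exp (κ * x) * (K * exp (-3 * x)) :=
          mul_le_mul_of_nonneg_left (hf.1 x hx) (exp_pos _).le
      _ = _ := by rw [mul_left_comm, ← exp_add]; congr 2; ring

lemma PhiDecay.tendsto_exp_mul {f : ℝ → ℝ} (hf : PhiDecay K f) {κ : ℝ} (h3 : κ < 3) :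
    Tendsto (fun x => exp (κ * x) * f x) atTop (nhds 0) := by
  have h : Tendsto (fun x : ℝ => K * exp (-((3 - κ) * x))) atTop (nhds 0) := by
    have := (Real.tendsto_exp_neg_atTop_nhds_zero.comp
      (tendsto_id.const_mul_atTop (show 0 < 3 - κ by linarith))).const_mul K
    simpa using this
  refine squeeze_zero_norm' ?_ h
  filter_upwards [eventually_ge_atTop 0] with x hx
  rw [Real.norm_eq_abs, abs_mul, abs_of_pos (exp_pos _)]
  calc _ ≤ exp (κ * x) * (K * exp (-3 * x)) :=
        mul_le_mul_of_nonneg_left (hf.1 x hx) (exp_pos _).le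
    _ = _ := by rw [mul_left_comm, ← exp_add]; congr 2; ring

end phi

section solution

variable {c : ℝ} {A : ℝ → ℝ}

lemma IsAc.exists_bound (h : IsAc c A) {k : ℕ} (hk : k ≤ 9) :
    ∃ K, 0 ≤ K ∧ ∀ x, |iteratedDeriv k A x| ≤ K := by
  refine ⟨_, Real.sqrt_nonneg _, fun x => Real.abs_le_sqrt (sq_le_of_memLp_two
    (h.hasDerivAt_iteratedDeriv k) (h.memLp (by omega)) (h.memLp (by omega)) x)⟩

/-- The quantity `A'' - A + 4 Q³ (A + e^{-s x}/4)`, a primitive of `λ A`. -/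
lemma IsAc.hasDerivAt_flux (h : IsAc c A) (x : ℝ) :
    HasDerivAt (fun y => iteratedDeriv 2 A y - iteratedDeriv 0 A y + 40 * phi (√c) A y)
      (lamc c * iteratedDeriv 0 A x) x := by
  have h1 := (h.hasDerivAt_LQ_sub_src x).fun_neg
  refine (h1.congr_deriv (by ring)).congr_of_eventuallyEq (Eventually.of_forall fun y => ?_)
  simp only [forty_mul_phi, pot, iteratedDeriv_zero]; ring

lemma IsAc.continuous (h : IsAc c A) : Continuous A := h.1.continuous

lemma IsAc.exists_phiDecay (h : IsAc c A) (hc1 : c < 1) :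
    ∃ K, PhiDecay K (phi (√c) A) := by
  obtain ⟨K, hK, hb⟩ := h.exists_bound (k := 0) (by norm_num)
  simp only [iteratedDeriv_zero] at hb
  exact ⟨_, phiDecay_phi hK (Real.sqrt_nonneg c) (sqrt_lt_one hc1).le hb⟩

/-- The moment `∫ e^{γ x} φ` which determines the leading coefficient of `A` at `+∞`. -/
noncomputable def mom (c : ℝ) (A : ℝ → ℝ) : ℝ := ∫ x, exp (gam c * x) * phi (√c) A x

lemma IsAc.tendsto_exp_mul (h : IsAc c A) (hc : 3 / 4 ≤ c) (hc1 : c < 1) :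
    Tendsto (fun x => exp (gam c * x) * (iteratedDeriv 2 A x - gam c * iteratedDeriv 1 A x
      - √c * (gam c + √c) * iteratedDeriv 0 A x)) atTop (nhds (40 * gam c * mom c A)) := by
  have hg := gam_pos hc hc1
  have hgs := gam_lt_sqrt hc hc1
  have hs1 := sqrt_lt_one hc1
  have hq := gam_quadratic hc hc1
  have hlam := lamc_eq hc hc1
  obtain ⟨K, hK⟩ := h.exists_phiDecay hc1
  obtain ⟨g, hgd⟩ : ∃ g, g = gam c := ⟨_, rfl⟩
  obtain ⟨s, hsd⟩ : ∃ s, s = √c := ⟨_, rfl⟩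
  have hφint := hK.integrable_exp_mul (continuous_phi h.continuous) hg.le
    (show gam c < 3 by linarith)
  set F : ℝ → ℝ := fun x => exp (gam c * x) * (iteratedDeriv 2 A x - gam c * iteratedDeriv 1 A x
      - √c * (gam c + √c) * iteratedDeriv 0 A x + 40 * phi (√c) A x) with hF
  have hFd : ∀ x, HasDerivAt F (40 * gam c * (exp (gam c * x) * phi (√c) A x)) x := by
    intro x
    have h1 : HasDerivAt (fun y => exp (gam c * y)) (gam c * exp (gam c * x)) x :=
      (((hasDerivAt_id' x).const_mul (gam c)).exp).congr_deriv (by ring)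
    have h2 := ((h.hasDerivAt_flux x).fun_add ((h.hasDerivAt_iteratedDeriv 0 x).const_mul
      (1 - √c * (gam c + √c)))).fun_sub ((h.hasDerivAt_iteratedDeriv 1 x).const_mul (gam c))
    refine ((h1.fun_mul h2).congr_deriv ?_).congr_of_eventuallyEq
      (Eventually.of_forall fun y => ?_)
    · simp only [hlam, zero_add, Nat.reduceAdd, ← hgd, ← hsd] at hq ⊢
      linear_combination (-exp (g * x) * iteratedDeriv 1 A x) * hq
    · simp only [hF]; ring
  have hi' := hφint.const_mul (40 * gam c)
  have hbot : Tendsto F atBot (nhds 0) := by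
    obtain ⟨K0, hK0, hb0⟩ := h.exists_bound (k := 0) (by norm_num)
    obtain ⟨K1, hK1, hb1⟩ := h.exists_bound (k := 1) (by norm_num)
    obtain ⟨K2, hK2, hb2⟩ := h.exists_bound (k := 2) (by norm_num)
    have e0 : Tendsto (fun x => exp (gam c * x)) atBot (nhds 0) :=
      Real.tendsto_exp_atBot.comp (tendsto_id.const_mul_atBot hg)
    have hpb : ∀ x ≤ 0, |phi (√c) A x| ≤ |K| := fun x hx => (hK.2 x hx).trans <| by
      have := exp_le_one_iff.2 (show 2 * x ≤ 0 by linarith)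
      nlinarith [le_abs_self K, abs_nonneg K, exp_pos (2 * x)]
    have hbd : IsBoundedUnder (· ≤ ·) atBot (fun x => ‖iteratedDeriv 2 A x
      - gam c * iteratedDeriv 1 A x
      - √c * (gam c + √c) * iteratedDeriv 0 A x + 40 * phi (√c) A x‖) := by
      refine isBoundedUnder_of_eventually_le
        (a := K2 + gam c * K1 + √c * (gam c + √c) * K0 + 40 * |K|) ?_
      filter_upwards [eventually_le_atBot 0] with x hx
      have u0 := hb0 x
      have u1 := hb1 x
      have u2 := hb2 x
      have u3 := hpb x hx
      rw [Real.norm_eq_abs]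
      refine (abs_add_le _ _).trans (add_le_add ((abs_sub _ _).trans (add_le_add
        ((abs_sub _ _).trans (add_le_add u2 ?_)) ?_)) ?_)
      · rw [abs_mul, abs_of_pos hg]; gcongr
      · rw [abs_mul, abs_of_nonneg (by positivity)]; gcongr
      · rw [abs_mul, abs_of_nonneg (by norm_num)]; gcongr
    exact e0.zero_mul_isBoundedUnder_le hbd
  have hlim := tendsto_limUnder_of_hasDerivAt_of_integrableOn_Ioi (a := 0) (fun x _ => hFd x)
    hi'.integrableOn
  have hval := integral_of_hasDerivAt_of_tendsto hFd hi' hbot hlim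
  rw [integral_const_mul, sub_zero] at hval
  rw [← hval] at hlim
  have h0 := (hK.tendsto_exp_mul (show gam c < 3 by linarith)).const_mul 40
  refine (hlim.sub h0).congr' (Eventually.of_forall fun x => ?_) |>.trans ?_
  · simp only [hF]; ring
  · rw [mul_zero, sub_zero, mom]

/-- The leading coefficient of `A` at `+∞` in terms of the moment of `φ`. -/
lemma IsAc.leading_coeff_eq (h : IsAc c A) (hc : 3 / 4 ≤ c) (hc1 : c < 1) {a : ℝ}
    (ha : Tendsto (fun x => A x * exp (gam c * x)) atTop (nhds a)) :
    (√c - gam c) * (2 * gam c + √c) * a = -(40 * gam c * mom c A) := by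
  have hB : ∀ x, HasDerivAt (fun x => A x * exp (gam c * x))
      ((iteratedDeriv 1 A x + gam c * iteratedDeriv 0 A x) * exp (gam c * x)) x := fun x => by
    have h1 : HasDerivAt (fun y => exp (gam c * y)) (gam c * exp (gam c * x)) x :=
      (((hasDerivAt_id' x).const_mul (gam c)).exp).congr_deriv (by ring)
    have h2 := h.hasDerivAt_iteratedDeriv 0 x
    rw [iteratedDeriv_zero] at h2 ⊢
    exact (h2.fun_mul h1).congr_deriv (by ring)
  have hC : ∀ x, HasDerivAt (fun y => (iteratedDeriv 1 A y + gam c * iteratedDeriv 0 A y)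
        * exp (gam c * y) + -3 * gam c * (A y * exp (gam c * y)))
      ((iteratedDeriv 2 A x - gam c * iteratedDeriv 1 A x
        - 2 * gam c ^ 2 * iteratedDeriv 0 A x) * exp (gam c * x)) x := fun x => by
    have h1 : HasDerivAt (fun y => exp (gam c * y)) (gam c * exp (gam c * x)) x :=
      (((hasDerivAt_id' x).const_mul (gam c)).exp).congr_deriv (by ring)
    have h2 := h.hasDerivAt_iteratedDeriv 0 x
    have h3 := h.hasDerivAt_iteratedDeriv 1 x
    refine (((h3.fun_add (h2.const_mul (gam c))).fun_mul h1).fun_add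
      ((hB x).const_mul (-3 * gam c))).congr_deriv ?_
    simp only [iteratedDeriv_zero, Nat.reduceAdd, zero_add]; ring
  have hl := (h.tendsto_exp_mul hc hc1).add (ha.const_mul ((√c - gam c) * (2 * gam c + √c)))
  have := eq_zero_of_tendsto_of_tendsto_deriv hB hC ha (hl.congr fun x => by
    simp only [iteratedDeriv_zero]; ring)
  linarith

end solution

section continuity

variable {A : ℝ → ℝ → ℝ} {c : ℝ}

/-- Uniform local Lipschitz dependence on `c` of the solution. -/
lemma exists_abs_sub_le (hA : ∀ c : ℝ, 3 / 4 ≤ c → c < 1 → IsAc c (A c))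
    (hc : 3 / 4 ≤ c) (hc1 : c < 1) : ∃ C : ℝ, 0 < C ∧ ∃ δ : ℝ, 0 < δ ∧
      ∀ c' : ℝ, 3 / 4 ≤ c' → c' < 1 → |c - c'| < δ → ∀ x, |A c x - A c' x| ≤ C * |c - c'| := by
  obtain ⟨C, hC, δ, hδ, H⟩ := lipschitz_H3 hA hc hc1
  refine ⟨C, hC, δ, hδ, fun c' hc' hc1' hcc x => ?_⟩
  have h := hA c hc hc1
  have h' := hA c' hc' hc1'
  have h1 := H c' hc' hc1' hcc
  have h2 := sq_le_of_memLp_two (fun x => (h.hasDerivAt_iteratedDeriv 0 x).fun_sub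
    (h'.hasDerivAt_iteratedDeriv 0 x)) ((h.memLp (by norm_num)).sub (h'.memLp (by norm_num)))
    ((h.memLp (by norm_num)).sub (h'.memLp (by norm_num))) x
  simp only [Finset.sum_range_succ, Finset.sum_range_zero, zero_add] at h1
  have h3 : 0 ≤ ∫ x, (iteratedDeriv 2 (A c) x - iteratedDeriv 2 (A c') x) ^ 2 :=
    integral_nonneg fun x => sq_nonneg _
  have h4 : 0 ≤ ∫ x, (iteratedDeriv 3 (A c) x - iteratedDeriv 3 (A c') x) ^ 2 :=
    integral_nonneg fun x => sq_nonneg _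
  refine abs_le_of_sq_le_sq ?_ (by positivity)
  simp only [iteratedDeriv_zero, zero_add] at h1 h2
  rw [mul_pow]
  linarith

lemma continuous_gam : Continuous gam := by unfold gam; fun_prop

lemma PhiDecay.abs_exp_mul_le {f : ℝ → ℝ} {K κ : ℝ} (hf : PhiDecay K f) (h0 : 0 ≤ κ) (h1 : κ ≤ 1)
    (x : ℝ) : |exp (κ * x) * f x| ≤ K * exp (-2 * |x|) := by
  rw [abs_mul, abs_of_pos (exp_pos _)]
  rcases le_total 0 x with hx | hx
  · have hu := hf.1 x hx
    rw [abs_of_nonneg hx]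
    have h2 : exp (κ * x) ≤ exp x := exp_le_exp.2 (by nlinarith)
    calc _ ≤ exp x * (K * exp (-3 * x)) :=
          mul_le_mul h2 hu (abs_nonneg _) (exp_pos _).le
      _ = _ := by rw [mul_left_comm, ← exp_add]; congr 2; ring
  · rw [abs_of_nonpos hx]
    have h2 : exp (κ * x) ≤ 1 := exp_le_one_iff.2 (by nlinarith)
    refine (mul_le_of_le_one_left (abs_nonneg _) h2).trans ((hf.2 x hx).trans_eq ?_)
    congr 2; ring

lemma continuousOn_mom (hA : ∀ c : ℝ, 3 / 4 ≤ c → c < 1 → IsAc c (A c)) :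
    ContinuousOn (fun c => mom c (A c)) (Set.Ico (3 / 4) 1) := by
  rintro c ⟨hc, hc1⟩
  obtain ⟨C, hC, δ, hδ, H⟩ := exists_abs_sub_le hA hc hc1
  obtain ⟨K, hK, hb⟩ := (hA c hc hc1).exists_bound (k := 0) (by norm_num)
  simp only [iteratedDeriv_zero] at hb
  have hev : ∀ᶠ c' in nhdsWithin c (Set.Ico (3 / 4) 1), (3 / 4 ≤ c' ∧ c' < 1) ∧ |c - c'| < δ := by
    filter_upwards [self_mem_nhdsWithin, mem_nhdsWithin_of_mem_nhds (Metric.ball_mem_nhds c hδ)]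
      with c' h1 h2
    rw [Metric.mem_ball, dist_comm, Real.dist_eq] at h2
    exact ⟨h1, h2⟩
  refine continuousWithinAt_of_dominated (bound := fun x => (K + C * δ + 1) * exp (-2 * |x|))
    ?_ ?_ ((integrable_exp_neg_abs two_pos).const_mul _) (ae_of_all _ fun x => ?_)
  · filter_upwards [hev] with c' h'
    have := continuous_phi (s := √c') (hA c' h'.1.1 h'.1.2).continuous
    exact Continuous.aestronglyMeasurable (by fun_prop)
  · filter_upwards [hev] with c' h'
    refine ae_of_all _ fun x => ?_
    have hb' : ∀ x, |A c' x| ≤ K + C * δ := fun x => by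
      have h1 := H c' h'.1.1 h'.1.2 h'.2 x
      have h2 : C * |c - c'| ≤ C * δ := by gcongr; exact h'.2.le
      have h3 := abs_sub_abs_le_abs_sub (A c' x) (A c x)
      rw [abs_sub_comm] at h3
      linarith [hb x]
    refine (phiDecay_phi (by positivity) (Real.sqrt_nonneg c') (sqrt_lt_one h'.1.2).le
      hb').abs_exp_mul_le (gam_pos h'.1.1 h'.1.2).le ?_ x
    linarith [gam_lt_sqrt h'.1.1 h'.1.2, sqrt_lt_one h'.1.2]
  · have hAc : ContinuousWithinAt (fun c' => A c' x) (Set.Ico (3 / 4) 1) c := by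
      rw [ContinuousWithinAt, tendsto_iff_norm_sub_tendsto_zero]
      have h0 : Tendsto (fun c' => C * |c - c'|) (nhdsWithin c (Set.Ico (3 / 4) 1)) (nhds 0) := by
        have : Continuous fun c' => C * |c - c'| := by fun_prop
        simpa using (this.tendsto c).mono_left nhdsWithin_le_nhds
      refine squeeze_zero' (Eventually.of_forall fun _ => norm_nonneg _) ?_ h0
      filter_upwards [hev] with c' h'
      rw [Real.norm_eq_abs, abs_sub_comm]
      exact H c' h'.1.1 h'.1.2 h'.2 x
    have h1 : Continuous fun c' => exp (gam c' * x) := by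
      have := continuous_gam
      fun_prop
    have h2 : Continuous fun c' : ℝ => exp (-√c' * x) / 4 := by fun_prop
    exact h1.continuousWithinAt.mul ((hAc.add h2.continuousWithinAt).div_const _)

lemma continuousOn_leading_coeff {aI : ℝ → ℝ}
    (hA : ∀ c : ℝ, 3 / 4 ≤ c → c < 1 → IsAc c (A c))
    (haI : ∀ c : ℝ, 3 / 4 ≤ c → c < 1 →
      Tendsto (fun x => A c x * exp (gam c * x)) atTop (nhds (aI c))) :
    ContinuousOn aI (Set.Ico (3 / 4) 1) := by
  have hg := continuous_gam
  have hne : ∀ c ∈ Set.Ico (3 / 4 : ℝ) 1, (√c - gam c) * (2 * gam c + √c) ≠ 0 := by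
    rintro c ⟨hc, hc1⟩
    have h1 := gam_pos hc hc1
    have h2 := gam_lt_sqrt hc hc1
    exact (mul_pos (by linarith) (by linarith)).ne'
  have h : ContinuousOn (fun c => -(40 * gam c * mom c (A c)) /
      ((√c - gam c) * (2 * gam c + √c))) (Set.Ico (3 / 4) 1) := by
    refine ContinuousOn.div ?_ (Continuous.continuousOn (by fun_prop)) hne
    exact ((Continuous.continuousOn (by fun_prop)).mul (continuousOn_mom hA)).neg
  refine h.congr fun c hc => ?_
  rw [eq_div_iff (hne c hc), mul_comm]
  exact (hA c hc.1 hc.2).leading_coeff_eq hc.1 hc.2 (haI c hc.1 hc.2)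

end continuity

/-- Comparison: a bound on the derivative gives a bound on the function. -/
lemma abs_le_of_abs_deriv_le {f f' h h' : ℝ → ℝ} {T : ℝ} (hf : ∀ t, HasDerivAt f (f' t) t)
    (hh : ∀ t, HasDerivAt h (h' t) t) (f0 : f 0 = 0) (h0 : h 0 = 0)
    (hle : ∀ t, 0 ≤ t → t ≤ T → |f' t| ≤ h' t) {t : ℝ} (ht0 : 0 ≤ t) (htT : t ≤ T) :
    |f t| ≤ h t :=
  image_norm_le_of_norm_deriv_right_le_deriv_boundary (f := f) (f' := f') (a := 0) (b := T)
    (fun x _ => (hf x).continuousAt.continuousWithinAt) (fun x _ => (hf x).hasDerivWithinAt)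
    (by simp [f0, h0]) hh (fun x hx => hle x hx.1 hx.2.le) ⟨ht0, htT⟩

lemma hasDerivAt_pow_mul_exp (n : ℕ) (t : ℝ) :
    HasDerivAt (fun u => u ^ n * exp (2 * u)) ((n * t ^ (n - 1) + 2 * t ^ n) * exp (2 * t)) t := by
  have h1 : HasDerivAt (fun u => exp (2 * u)) (2 * exp (2 * t)) t :=
    (((hasDerivAt_id' t).const_mul 2).exp).congr_deriv (by ring)
  exact ((hasDerivAt_pow n t).fun_mul h1).congr_deriv (by ring)

/-- One step of the contraction argument behind `HillSol.eq_zero_of_nonneg`. -/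
lemma singular_ode_contraction {Z Z1 Z2 Y : ℝ → ℝ} {T M : ℝ} (hM : 0 ≤ M)
    (hZ : ∀ t, HasDerivAt Z (Z1 t) t) (hZ1 : ∀ t, HasDerivAt Z1 (Z2 t) t)
    (hY : ∀ t, HasDerivAt Y (Z t) t) (Z0 : Z 0 = 0) (Z10 : Z1 0 = 0) (Z20 : Z2 0 = 0)
    (Y0 : Y 0 = 0)
    (hode : ∀ t, 0 ≤ t → |Z2 t| * t ^ 2 ≤ (40 / 9 + t ^ 2) * |Z t| + t ^ 2 * |Y t|)
    (hb : ∀ t, 0 ≤ t → t ≤ T → |Z t| ≤ M * (t ^ 3 * exp (2 * t))) :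
    ∀ t, 0 ≤ t → t ≤ T → |Z t| ≤ 3 / 4 * M * (t ^ 3 * exp (2 * t)) := by
  have hYb : ∀ t, 0 ≤ t → t ≤ T → |Y t| ≤ M / 2 * (t ^ 3 * exp (2 * t)) := fun t h0 hT =>
    abs_le_of_abs_deriv_le hY (fun t => (hasDerivAt_pow_mul_exp 3 t).const_mul _) Y0 (by simp)
      (fun t h0 hT => (hb t h0 hT).trans (by
        have : 0 ≤ M * (t ^ 2 * exp (2 * t)) := by positivity
        push_cast; nlinarith)) h0 hT
  have hd1 : ∀ t, HasDerivAt (fun u => 3 / 4 * M * ((3 * u ^ 2 + 2 * u ^ 3) * exp (2 * u)))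
      (3 / 4 * M * ((6 * t + 12 * t ^ 2 + 4 * t ^ 3) * exp (2 * t))) t := fun t => by
    refine ((((hasDerivAt_pow_mul_exp 2 t).const_mul 3).fun_add
      ((hasDerivAt_pow_mul_exp 3 t).const_mul 2)).const_mul (3 / 4 * M) |>.congr_deriv
        ?_).congr_of_eventuallyEq (Eventually.of_forall fun y => ?_)
    · simp only [Nat.reduceSub, pow_one]; push_cast; ring
    · ring
  have hZ2b : ∀ t, 0 ≤ t → t ≤ T →
      |Z2 t| ≤ 3 / 4 * M * ((6 * t + 12 * t ^ 2 + 4 * t ^ 3) * exp (2 * t)) := by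
    intro t h0 hT
    rcases h0.eq_or_lt with rfl | ht
    · simp [Z20]
    have u1 := hode t h0
    have u2 := hb t h0 hT
    have u3 := hYb t h0 hT
    have he := exp_pos (2 * t)
    refine le_of_mul_le_mul_right (u1.trans ?_) (pow_pos ht 2)
    calc (40 / 9 + t ^ 2) * |Z t| + t ^ 2 * |Y t|
        ≤ (40 / 9 + t ^ 2) * (M * (t ^ 3 * exp (2 * t)))
          + t ^ 2 * (M / 2 * (t ^ 3 * exp (2 * t))) := by gcongr
      _ = M * exp (2 * t) * (40 / 9 * t ^ 3 + 3 / 2 * t ^ 5) := by ring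
      _ ≤ M * exp (2 * t) * (9 / 2 * t ^ 3 + 9 * t ^ 4 + 3 * t ^ 5) := by
        have := pow_pos ht 3
        have := pow_pos ht 4
        have := pow_pos ht 5
        refine mul_le_mul_of_nonneg_left ?_ (by positivity)
        linarith
      _ = _ := by ring
  have hZ1b : ∀ t, 0 ≤ t → t ≤ T →
      |Z1 t| ≤ 3 / 4 * M * ((3 * t ^ 2 + 2 * t ^ 3) * exp (2 * t)) := fun t h0 hT =>
    abs_le_of_abs_deriv_le hZ1 hd1 Z10 (by simp) hZ2b h0 hT
  exact fun t h0 hT => abs_le_of_abs_deriv_le hZ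
    (fun t => (hasDerivAt_pow_mul_exp 3 t).const_mul _) Z0 (by simp)
    (fun t h0 hT => (hZ1b t h0 hT).trans_eq (by push_cast; norm_num)) h0 hT

/-- The transform `Z = 4 sinh²(3t/2) S` with its first two derivatives expressed through those
of `S`. -/
noncomputable def hillZ (S : ℝ → ℝ) (t : ℝ) : ℝ := 4 * sinh (3 / 2 * t) ^ 2 * S t

noncomputable def hillZ1 (S S1 : ℝ → ℝ) (t : ℝ) : ℝ :=
  12 * sinh (3 / 2 * t) * cosh (3 / 2 * t) * S t + 4 * sinh (3 / 2 * t) ^ 2 * S1 t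

noncomputable def hillZ2 (S S1 S2 : ℝ → ℝ) (t : ℝ) : ℝ :=
  18 * (1 + 2 * sinh (3 / 2 * t) ^ 2) * S t + 24 * sinh (3 / 2 * t) * cosh (3 / 2 * t) * S1 t
    + 4 * sinh (3 / 2 * t) ^ 2 * S2 t

/-- `S` (with derivatives `S1`, `S2`) solves `(Z'' - Z - 40 S)' = σ Z` for
`Z = 4 sinh²(3t/2) S`. -/
structure HillSol (σ : ℝ) (S S1 S2 : ℝ → ℝ) : Prop where
  hd : ∀ t, HasDerivAt S (S1 t) t
  hd1 : ∀ t, HasDerivAt S1 (S2 t) t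
  ode : ∀ t, HasDerivAt (fun u => hillZ2 S S1 S2 u - hillZ S u - 40 * S u) (σ * hillZ S t) t

lemma hasDerivAt_sinh_three_half (t : ℝ) :
    HasDerivAt (fun u => sinh (3 / 2 * u)) (3 / 2 * cosh (3 / 2 * t)) t :=
  (((hasDerivAt_id' t).const_mul (3 / 2)).sinh).congr_deriv (by ring)

lemma hasDerivAt_cosh_three_half (t : ℝ) :
    HasDerivAt (fun u => cosh (3 / 2 * u)) (3 / 2 * sinh (3 / 2 * t)) t :=
  (((hasDerivAt_id' t).const_mul (3 / 2)).cosh).congr_deriv (by ring)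

lemma hasDerivAt_hillZ {S S1 : ℝ → ℝ} (hd : ∀ t, HasDerivAt S (S1 t) t) (t : ℝ) :
    HasDerivAt (hillZ S) (hillZ1 S S1 t) t := by
  refine ((((hasDerivAt_sinh_three_half t).fun_pow 2).const_mul 4).fun_mul (hd t)).congr_deriv ?_
  simp only [hillZ1]; push_cast; ring

lemma hasDerivAt_hillZ1 {S S1 S2 : ℝ → ℝ} (hd : ∀ t, HasDerivAt S (S1 t) t)
    (hd1 : ∀ t, HasDerivAt S1 (S2 t) t) (t : ℝ) :
    HasDerivAt (hillZ1 S S1) (hillZ2 S S1 S2 t) t := by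
  have h1 := hasDerivAt_sinh_three_half t
  have h2 := hasDerivAt_cosh_three_half t
  have h3 := cosh_sq (3 / 2 * t)
  refine ((((h1.const_mul 12).fun_mul h2).fun_mul (hd t)).fun_add
    (((h1.fun_pow 2).const_mul 4).fun_mul (hd1 t))).congr_deriv ?_
  simp only [hillZ2]; push_cast
  linear_combination 18 * S t * h3

namespace HillSol

variable {σ : ℝ} {S S1 S2 : ℝ → ℝ}

lemma neg (h : HillSol σ S S1 S2) :
    HillSol σ (fun t => -S t) (fun t => -S1 t) (fun t => -S2 t) where
  hd t := (h.hd t).fun_neg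
  hd1 t := (h.hd1 t).fun_neg
  ode t := by
    refine ((h.ode t).fun_neg.congr_deriv ?_).congr_of_eventuallyEq
      (Eventually.of_forall fun u => ?_)
    · simp only [hillZ]; ring
    · simp only [hillZ, hillZ2]; ring

lemma comp_neg (h : HillSol σ S S1 S2) :
    HillSol (-σ) (fun t => S (-t)) (fun t => -S1 (-t)) (fun t => S2 (-t)) where
  hd t := by simpa [Function.comp_def] using (h.hd (-t)).scomp t (hasDerivAt_neg t)
  hd1 t := by simpa [Function.comp_def] using ((h.hd1 (-t)).scomp t (hasDerivAt_neg t)).fun_neg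
  ode t := by
    refine (((h.ode (-t)).scomp t (hasDerivAt_neg t)).congr_deriv ?_).congr_of_eventuallyEq
      (Eventually.of_forall fun u => ?_)
    · simp [hillZ]
    · simp [hillZ, hillZ2]

lemma exists_primitive (h : HillSol σ S S1 S2) (hσ : σ ≠ 0) :
    ∃ Y : ℝ → ℝ, (∀ t, HasDerivAt Y (hillZ S t) t) ∧ Y 0 = 0 ∧
      ∀ t, hillZ2 S S1 S2 t = hillZ S t + 40 * S t - 22 * S 0 + σ * Y t := by
  refine ⟨fun t => (hillZ2 S S1 S2 t - hillZ S t - 40 * S t + 22 * S 0) / σ, fun t => ?_, ?_,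
    fun t => ?_⟩
  · exact (((h.ode t).add_const (22 * S 0)).div_const σ).congr_deriv (by field_simp)
  · simp [hillZ, hillZ2]; left; ring
  · simp only []; field_simp; ring

/-- A twice differentiable solution vanishing at `0` vanishes on the right half-line. -/
lemma eq_zero_of_nonneg (h : HillSol σ S S1 S2) (hσ : σ ≠ 0) (hσ1 : |σ| ≤ 1) (h0 : S 0 = 0)
    {T : ℝ} (hT : 0 ≤ T) : S T = 0 := by
  obtain ⟨Y, hY, Y0, hYeq⟩ := h.exists_primitive hσ
  obtain ⟨L, hL⟩ := isCompact_Icc.exists_bound_of_continuousOn (s := Set.Icc 0 T) (f := S1)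
    fun t _ => (h.hd1 t).continuousAt.continuousWithinAt
  have hL0 : 0 ≤ L := (norm_nonneg _).trans (hL 0 ⟨le_rfl, hT⟩)
  have hS : ∀ t, 0 ≤ t → t ≤ T → |S t| ≤ L * t := fun t h1 h2 =>
    abs_le_of_abs_deriv_le h.hd (fun t => (hasDerivAt_id' t).const_mul L) h0 (by simp)
      (fun t h1 h2 => by simpa using hL t ⟨h1, h2⟩) h1 h2
  have hsh : ∀ t, 0 ≤ t → t ≤ T → |sinh (3 / 2 * t)| ≤ 3 / 2 * cosh (3 / 2 * T) * t :=
    fun t h1 h2 => abs_le_of_abs_deriv_le hasDerivAt_sinh_three_half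
      (fun t => (hasDerivAt_id' t).const_mul _) (by simp) (by simp)
      (fun t h1 h2 => by
        rw [mul_one, abs_mul, abs_of_pos (cosh_pos _), abs_of_pos (by norm_num)]
        gcongr
        rw [cosh_le_cosh, abs_of_nonneg (by positivity), abs_of_nonneg (by positivity)]
        gcongr) h1 h2
  set M := 9 * cosh (3 / 2 * T) ^ 2 * L with hM
  have hM0 : 0 ≤ M := by positivity
  have hinit : ∀ t, 0 ≤ t → t ≤ T → |hillZ S t| ≤ M * (t ^ 3 * exp (2 * t)) := fun t h1 h2 => by
    have e1 : 1 ≤ exp (2 * t) := one_le_exp (by linarith)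
    rw [hillZ, abs_mul, abs_mul, abs_pow, abs_of_pos (show (0 : ℝ) < 4 by norm_num)]
    calc 4 * |sinh (3 / 2 * t)| ^ 2 * |S t|
        ≤ 4 * (3 / 2 * cosh (3 / 2 * T) * t) ^ 2 * (L * t) := by
          gcongr
          · exact hsh t h1 h2
          · exact hS t h1 h2
      _ = M * (t ^ 3 * 1) := by rw [hM]; ring
      _ ≤ _ := by gcongr
  have hode : ∀ t, 0 ≤ t →
      |hillZ2 S S1 S2 t| * t ^ 2 ≤ (40 / 9 + t ^ 2) * |hillZ S t| + t ^ 2 * |Y t| := by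
    intro t ht
    have e1 : 9 * t ^ 2 * |S t| ≤ |hillZ S t| := by
      have : 3 / 2 * t ≤ sinh (3 / 2 * t) := self_le_sinh_iff.2 (by positivity)
      rw [hillZ, abs_mul, abs_of_nonneg (show 0 ≤ 4 * sinh (3 / 2 * t) ^ 2 by positivity)]
      calc _ = 4 * (3 / 2 * t) ^ 2 * |S t| := by ring
        _ ≤ _ := by gcongr
    have e2 : |hillZ2 S S1 S2 t| ≤ |hillZ S t| + 40 * |S t| + |Y t| := by
      rw [hYeq, h0, mul_zero, sub_zero]
      refine (abs_add_le _ _).trans (add_le_add ((abs_add_le _ _).trans (add_le_add le_rfl ?_)) ?_)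
      · rw [abs_mul, abs_of_pos (by norm_num)]
      · rw [abs_mul]; exact mul_le_of_le_one_left (abs_nonneg _) hσ1
    have e3 := mul_le_mul_of_nonneg_right e2 (sq_nonneg t)
    nlinarith
  have hn : ∀ n : ℕ, ∀ t, 0 ≤ t → t ≤ T →
      |hillZ S t| ≤ (3 / 4) ^ n * M * (t ^ 3 * exp (2 * t)) := by
    intro n
    induction n with
    | zero => simpa using hinit
    | succ n ih =>
      rw [pow_succ', mul_assoc (3 / 4 : ℝ)]
      exact singular_ode_contraction (by positivity) (hasDerivAt_hillZ h.hd)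
        (hasDerivAt_hillZ1 h.hd h.hd1) hY (by simp [hillZ]) (by simp [hillZ1])
        (by simp [hillZ2, h0]) Y0 hode ih
  have hZ : |hillZ S T| ≤ 0 := by
    have h1 : Tendsto (fun n : ℕ => (3 / 4 : ℝ) ^ n * M * (T ^ 3 * exp (2 * T))) atTop
        (nhds 0) := by
      simpa using ((tendsto_pow_atTop_nhds_zero_of_lt_one (by norm_num)
        (show (3 / 4 : ℝ) < 1 by norm_num)).mul_const M).mul_const (T ^ 3 * exp (2 * T))
    exact ge_of_tendsto' h1 fun n => hn n T hT le_rfl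
  rcases hT.eq_or_lt with rfl | hT'
  · exact h0
  have h2 := abs_nonpos_iff.1 hZ
  have h3 : 0 < sinh (3 / 2 * T) := sinh_pos_iff.2 (by positivity)
  rw [hillZ] at h2
  exact (mul_eq_zero.1 h2).resolve_left (by positivity)

/-- The auxiliary function of the growth argument. -/
noncomputable def aux (S S1 : ℝ → ℝ) (t : ℝ) : ℝ :=
  22 * (S t - S 0) + 16 * sinh (3 / 2 * t) ^ 2 * S t
    + 4 * cosh (3 / 2 * t) * sinh (3 / 2 * t) * S1 t

lemma hasDerivAt_aux (h : HillSol σ S S1 S2) {Y : ℝ → ℝ}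
    (hYeq : ∀ t, hillZ2 S S1 S2 t = hillZ S t + 40 * S t - 22 * S 0 + σ * Y t) {t : ℝ}
    (ht : 0 < t) : HasDerivAt (aux S S1)
      (cosh (3 / 2 * t) / sinh (3 / 2 * t) * (aux S S1 t + σ * Y t)) t := by
  have h1 := hasDerivAt_sinh_three_half t
  have h2 := hasDerivAt_cosh_three_half t
  have h3 := cosh_sq (3 / 2 * t)
  have h4 : sinh (3 / 2 * t) ≠ 0 := (sinh_pos_iff.2 (by positivity)).ne'
  have h5 := hYeq t
  refine (((((h.hd t).sub_const (S 0)).const_mul 22).fun_add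
    (((h1.fun_pow 2).const_mul 16).fun_mul (h.hd t))).fun_add
    (((h2.const_mul 4).fun_mul h1).fun_mul (h.hd1 t))).congr_deriv ?_
  simp only [hillZ, hillZ2] at h5
  simp only [aux]
  rw [div_mul_eq_mul_div (cosh _), eq_div_iff h4]
  push_cast
  linear_combination cosh (3 / 2 * t) * h5
    + (-22 * S1 t * sinh (3 / 2 * t)) * h3

/-- As long as `Y ≥ 0`, the auxiliary function is nonnegative. -/
lemma aux_nonneg (h : HillSol σ S S1 S2) (hσ : 0 ≤ σ) {Y : ℝ → ℝ}
    (hYeq : ∀ t, hillZ2 S S1 S2 t = hillZ S t + 40 * S t - 22 * S 0 + σ * Y t) {T : ℝ}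
    (hT : 0 < T) (hY : ∀ t, 0 < t → t ≤ T → 0 ≤ Y t) : 0 ≤ aux S S1 T := by
  have hsh : ∀ t : ℝ, 0 < t → 0 < sinh (3 / 2 * t) := fun t ht => sinh_pos_iff.2 (by positivity)
  set R : ℝ → ℝ := fun t => aux S S1 t ^ 3 / sinh (3 / 2 * t) ^ 2 with hR
  have hRd : ∀ t, 0 < t → HasDerivAt R
      (3 * aux S S1 t ^ 2 * cosh (3 / 2 * t) * (σ * Y t) / sinh (3 / 2 * t) ^ 3) t := by
    intro t ht
    have hs := (hsh t ht).ne'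
    refine (((h.hasDerivAt_aux hYeq ht).fun_pow 3).fun_div
      ((hasDerivAt_sinh_three_half t).fun_pow 2) (pow_ne_zero 2 hs)).congr_deriv ?_
    push_cast
    field_simp
    ring
  have hmono : MonotoneOn R (Set.Ioc 0 T) := by
    refine monotoneOn_of_deriv_nonneg (convex_Ioc 0 T)
      (fun t ht => (hRd t ht.1).continuousAt.continuousWithinAt) (fun t ht => ?_) (fun t ht => ?_)
    · rw [interior_Ioc] at ht
      exact (hRd t ht.1).differentiableAt.differentiableWithinAt
    · rw [interior_Ioc] at ht
      rw [(hRd t ht.1).deriv]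
      have := hY t ht.1 ht.2.le
      have := hsh t ht.1
      positivity
  have hlin : ∃ d, HasDerivAt (aux S S1) d 0 := by
    have h1 := hasDerivAt_sinh_three_half 0
    have h2 := hasDerivAt_cosh_three_half 0
    exact ⟨_, ((((h.hd 0).sub_const (S 0)).const_mul 22).fun_add
      (((h1.fun_pow 2).const_mul 16).fun_mul (h.hd 0))).fun_add
      (((h2.const_mul 4).fun_mul h1).fun_mul (h.hd1 0))⟩
  obtain ⟨d, hd⟩ := hlin
  have haux0 : aux S S1 0 = 0 := by simp [aux]
  have hR0 : Tendsto R (nhdsWithin 0 (Set.Ioi 0)) (nhds 0) := by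
    have e1 := hd.tendsto_slope_zero_right
    simp only [zero_add, haux0, sub_zero, smul_eq_mul] at e1
    have e2 := (hasDerivAt_sinh_three_half 0).tendsto_slope_zero_right
    simp only [zero_add, mul_zero, sinh_zero, sub_zero, smul_eq_mul, cosh_zero, mul_one] at e2
    have e3 : Tendsto (fun t : ℝ => t) (nhdsWithin 0 (Set.Ioi 0)) (nhds 0) :=
      tendsto_id.mono_left nhdsWithin_le_nhds
    have e4 := (e3.mul (e1.pow 3)).div (e2.pow 2) (by norm_num)
    rw [zero_mul, zero_div] at e4
    refine e4.congr' ?_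
    filter_upwards [self_mem_nhdsWithin] with t ht
    have ht' : t ≠ 0 := ne_of_gt ht
    have := (hsh t ht).ne'
    simp only [hR, Pi.div_apply]
    field_simp
  have hRT : 0 ≤ R T := by
    refine le_of_tendsto hR0 ?_
    filter_upwards [Ioo_mem_nhdsGT hT] with t ht
    exact hmono ⟨ht.1, ht.2.le⟩ ⟨hT, le_rfl⟩ ht.2.le
  by_contra! hneg
  have : R T < 0 := by
    have := hsh T hT
    exact div_neg_of_neg_of_pos (Odd.pow_neg (by decide) hneg) (by positivity)
  linarith

lemma primitive_nonneg {Y Z : ℝ → ℝ} (hY : ∀ t, HasDerivAt Y (Z t) t) (Y0 : Y 0 = 0) {T : ℝ}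
    (hZ : ∀ t, 0 < t → t < T → 0 ≤ Z t) : ∀ t, 0 < t → t ≤ T → 0 ≤ Y t := by
  intro t ht htT
  have := monotoneOn_of_deriv_nonneg (convex_Icc 0 T)
    (fun t _ => (hY t).continuousAt.continuousWithinAt)
    (fun t _ => (hY t).differentiableAt.differentiableWithinAt) (fun t ht => by
      rw [interior_Icc] at ht
      rw [(hY t).deriv]
      exact hZ t ht.1 ht.2) ⟨le_rfl, ht.le.trans htT⟩ ⟨ht.le, htT⟩ ht.le
  rwa [Y0] at this

/-- A solution which is positive at `0` stays positive on the right half-line. -/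
lemma pos_of_nonneg (h : HillSol σ S S1 S2) (hσ : 0 < σ) (h0 : 0 < S 0) {T : ℝ} (hT : 0 ≤ T) :
    0 < S T := by
  obtain ⟨Y, hY, Y0, hYeq⟩ := h.exists_primitive hσ.ne'
  by_contra! hneg
  have hSc : Continuous S := continuous_iff_continuousAt.2 fun t => (h.hd t).continuousAt
  set E : Set ℝ := {t | 0 ≤ t ∧ S t ≤ 0} with hE
  have hEc : IsClosed E := (isClosed_le continuous_const continuous_id).inter
    (isClosed_le hSc continuous_const)
  have hEb : BddBelow E := ⟨0, fun t ht => ht.1⟩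
  obtain ⟨t1, ht1⟩ : ∃ t, t = sInf E := ⟨_, rfl⟩
  have hmem : t1 ∈ E := ht1 ▸ hEc.csInf_mem ⟨T, hT, hneg⟩ hEb
  have hbelow : ∀ t, 0 ≤ t → t < t1 → 0 < S t := by
    intro t h1 h2
    by_contra! h3
    exact absurd (ht1 ▸ csInf_le hEb ⟨h1, h3⟩) (not_le.2 h2)
  have ht1p : 0 < t1 := by
    rcases hmem.1.eq_or_lt with h1 | h1
    · exact absurd (h1 ▸ hmem.2) (not_le.2 h0)
    · exact h1
  have haux := h.aux_nonneg hσ.le hYeq ht1p (primitive_nonneg hY Y0 fun t h1 h2 => by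
    have := hbelow t h1.le h2
    rw [hillZ]; positivity)
  have hsh : 0 < sinh (3 / 2 * t1) := sinh_pos_iff.2 (by positivity)
  have hch := cosh_pos (3 / 2 * t1)
  have hS1 : 0 < S1 t1 := by
    have h1 := hmem.2
    rw [aux] at haux
    have h2 : sinh (3 / 2 * t1) ^ 2 * S t1 ≤ 0 :=
      mul_nonpos_of_nonneg_of_nonpos (by positivity) h1
    have h3 : 0 < 4 * cosh (3 / 2 * t1) * sinh (3 / 2 * t1) * S1 t1 := by linarith
    exact (pos_iff_pos_of_mul_pos h3).1 (by positivity)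
  have hlt : ∀ᶠ t in nhdsWithin t1 (Set.Iio t1), 0 < slope S t1 t :=
    ((hasDerivAt_iff_tendsto_slope.1 (h.hd t1)).mono_left
      (nhdsWithin_mono _ fun t ht => ne_of_lt ht)).eventually (lt_mem_nhds hS1)
  obtain ⟨t, h1, h2⟩ := (hlt.and (Ioo_mem_nhdsLT ht1p)).exists
  rw [slope_def_field] at h1
  have h3 := hbelow t h2.1.le h2.2
  have h4 : (S t - S t1) / (t - t1) ≤ 0 :=
    div_nonpos_of_nonneg_of_nonpos (by linarith [hmem.2]) (by linarith [h2.2])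
  linarith

/-- A solution which is positive at `0` cannot decay fast. -/
lemma not_decay_of_pos (h : HillSol σ S S1 S2) (hσ : 0 < σ) (h0 : 0 < S 0) {K : ℝ}
    (hS : ∀ t, 0 ≤ t → |S t| ≤ K * exp (-(5 / 2) * t))
    (hS1 : ∀ t, 0 ≤ t → |S1 t| ≤ K * exp (-(5 / 2) * t)) : False := by
  obtain ⟨Y, hY, Y0, hYeq⟩ := h.exists_primitive hσ.ne'
  have hpos : ∀ t, 0 ≤ t → 0 < S t := fun t ht => h.pos_of_nonneg hσ h0 ht
  have hsh : ∀ t : ℝ, 0 < t → 0 < sinh (3 / 2 * t) := fun t ht => sinh_pos_iff.2 (by positivity)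
  have hZ : ∀ t, 0 < t → 0 < hillZ S t := fun t ht => by
    have := hpos t ht.le
    have := hsh t ht
    rw [hillZ]; positivity
  have hYm : StrictMonoOn Y (Set.Ici 0) :=
    strictMonoOn_of_deriv_pos (convex_Ici 0)
      (fun t _ => (hY t).continuousAt.continuousWithinAt) (fun t ht => by
        rw [interior_Ici] at ht
        rw [(hY t).deriv]
        exact hZ t ht)
  have hY1 : 0 < Y 1 := by
    have := hYm (Set.mem_Ici.2 le_rfl) (Set.mem_Ici.2 zero_le_one) one_pos
    rwa [Y0] at this
  have hYpos : ∀ t, 0 < t → 0 ≤ Y t := fun t ht => by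
    have := hYm (Set.mem_Ici.2 le_rfl) (Set.mem_Ici.2 ht.le) ht
    rw [Y0] at this; exact this.le
  have haux : ∀ t, 0 < t → 0 ≤ aux S S1 t := fun t ht =>
    h.aux_nonneg hσ.le hYeq ht fun u hu _ => hYpos u hu
  have hG : ∀ t : ℝ, 1 ≤ t → HasDerivAt (fun u => exp (-u) * (aux S S1 u + σ * Y 1))
      (-exp (-t) * (aux S S1 t + σ * Y 1) + exp (-t) * deriv (aux S S1) t) t := by
    intro t ht
    have h1 := (h.hasDerivAt_aux hYeq (show 0 < t by linarith)).differentiableAt.hasDerivAt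
    have h2 : HasDerivAt (fun u => exp (-u)) (-exp (-t)) t :=
      ((hasDerivAt_neg t).exp).congr_deriv (by ring)
    exact h2.fun_mul (h1.add_const _)
  have hGm : MonotoneOn (fun u => exp (-u) * (aux S S1 u + σ * Y 1)) (Set.Ici 1) := by
    refine monotoneOn_of_deriv_nonneg (convex_Ici 1)
      (fun t ht => (hG t ht).continuousAt.continuousWithinAt) (fun t ht => ?_) (fun t ht => ?_)
    · rw [interior_Ici] at ht
      exact (hG t (le_of_lt ht)).differentiableAt.differentiableWithinAt
    · rw [interior_Ici, Set.mem_Ioi] at ht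
      rw [(hG t ht.le).deriv]
      have ht0 : 0 < t := by linarith
      rw [(h.hasDerivAt_aux hYeq ht0).deriv]
      have u1 : 1 ≤ cosh (3 / 2 * t) / sinh (3 / 2 * t) := by
        rw [one_le_div (hsh t ht0)]; exact (sinh_lt_cosh _).le
      have u2 : Y 1 ≤ Y t := hYm.monotoneOn (Set.mem_Ici.2 zero_le_one)
        (Set.mem_Ici.2 ht0.le) ht.le
      have u3 := haux t ht0
      have u4 : σ * Y 1 ≤ σ * Y t := by gcongr
      have u5 : 0 ≤ aux S S1 t + σ * Y t := by nlinarith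
      have u6 : aux S S1 t + σ * Y t
          ≤ cosh (3 / 2 * t) / sinh (3 / 2 * t) * (aux S S1 t + σ * Y t) :=
        le_mul_of_one_le_left u5 u1
      nlinarith [exp_pos (-t)]
  have hK : 0 ≤ K := by simpa using (abs_nonneg _).trans (hS 0 le_rfl)
  have hauxle : ∀ t, 1 ≤ t → aux S S1 t ≤ 42 * K * exp (t / 2) := by
    intro t ht
    have e1 : sinh (3 / 2 * t) ≤ exp (3 / 2 * t) := by
      rw [sinh_eq]; linarith [exp_pos (3 / 2 * t), exp_pos (-(3 / 2 * t))]
    have e2 : cosh (3 / 2 * t) ≤ exp (3 / 2 * t) := by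
      rw [cosh_eq]
      linarith [exp_le_exp.2 (show -(3 / 2 * t) ≤ 3 / 2 * t by linarith)]
    have hs := hsh t (by linarith)
    have hc := cosh_pos (3 / 2 * t)
    have a1 := hS t (by linarith)
    have a2 := hS1 t (by linarith)
    have e3 : exp (3 / 2 * t) ^ 2 * exp (-(5 / 2) * t) = exp (t / 2) := by
      rw [← Real.exp_nat_mul, ← exp_add]; congr 1; push_cast; ring
    have e4 : exp (-(5 / 2) * t) ≤ exp (t / 2) := exp_le_exp.2 (by linarith)
    have b0 : S t ≤ K * exp (t / 2) := ((le_abs_self _).trans a1).trans (by gcongr)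
    have b1 : sinh (3 / 2 * t) ^ 2 * S t ≤ K * exp (t / 2) := by
      calc _ ≤ exp (3 / 2 * t) ^ 2 * (K * exp (-(5 / 2) * t)) :=
            mul_le_mul (pow_le_pow_left₀ hs.le e1 2) ((le_abs_self _).trans a1)
              (hpos t (by linarith)).le (by positivity)
        _ = _ := by rw [← e3]; ring
    have b2 : cosh (3 / 2 * t) * sinh (3 / 2 * t) * S1 t ≤ K * exp (t / 2) := by
      calc _ ≤ cosh (3 / 2 * t) * sinh (3 / 2 * t) * |S1 t| :=
            mul_le_mul_of_nonneg_left (le_abs_self _) (by positivity)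
        _ ≤ exp (3 / 2 * t) * exp (3 / 2 * t) * (K * exp (-(5 / 2) * t)) := by gcongr
        _ = _ := by rw [← e3]; ring
    rw [aux]; linarith
  have hlow : ∀ t : ℝ, 1 ≤ t → exp (-1) * (σ * Y 1)
      ≤ 42 * K * exp (-(t / 2)) + σ * Y 1 * exp (-t) := by
    intro t ht
    have u1 := hGm (Set.mem_Ici.2 le_rfl) (Set.mem_Ici.2 ht) ht
    have u2 := hauxle t ht
    have u3 := haux 1 one_pos
    have e1 : exp (-t) * exp (t / 2) = exp (-(t / 2)) := by rw [← exp_add]; congr 1; ring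
    calc exp (-1) * (σ * Y 1) ≤ exp (-1) * (aux S S1 1 + σ * Y 1) := by gcongr; linarith
      _ ≤ exp (-t) * (aux S S1 t + σ * Y 1) := u1
      _ ≤ exp (-t) * (42 * K * exp (t / 2) + σ * Y 1) := by gcongr
      _ = _ := by rw [← e1]; ring
  have hlim : Tendsto (fun t : ℝ => 42 * K * exp (-(t / 2)) + σ * Y 1 * exp (-t)) atTop
      (nhds 0) := by
    have e1 := (Real.tendsto_exp_neg_atTop_nhds_zero.comp
      (tendsto_id.atTop_div_const (show (0 : ℝ) < 2 by norm_num))).const_mul (42 * K)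
    have e2 := Real.tendsto_exp_neg_atTop_nhds_zero.const_mul (σ * Y 1)
    simpa using e1.add e2
  have := ge_of_tendsto hlim (eventually_ge_atTop (1 : ℝ) |>.mono hlow)
  have : 0 < exp (-1) * (σ * Y 1) := by positivity
  linarith

/-- A fast decaying solution vanishes on the left half-line. -/
lemma eq_zero_of_decay (h : HillSol σ S S1 S2) (hσ : 0 < σ) (hσ1 : σ ≤ 1) {K : ℝ}
    (hS : ∀ t, 0 ≤ t → |S t| ≤ K * exp (-(5 / 2) * t))
    (hS1 : ∀ t, 0 ≤ t → |S1 t| ≤ K * exp (-(5 / 2) * t)) {t : ℝ} (ht : t ≤ 0) : S t = 0 := by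
  have h0 : S 0 = 0 := by
    rcases lt_trichotomy (S 0) 0 with h1 | h1 | h1
    · exact (h.neg.not_decay_of_pos hσ (by simpa using h1) (by simpa using hS)
        (by simpa using hS1)).elim
    · exact h1
    · exact (h.not_decay_of_pos hσ h1 hS hS1).elim
  have := h.comp_neg.eq_zero_of_nonneg (neg_ne_zero.2 hσ.ne')
    (by rwa [abs_neg, abs_of_pos hσ]) (by simpa using h0) (T := -t) (by linarith)
  simpa using this

end HillSol

lemma PhiDecay.abs_le {K : ℝ} {f : ℝ → ℝ} (hf : PhiDecay K f) (x : ℝ) : |f x| ≤ K := by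
  have hK : 0 ≤ K := by simpa using (abs_nonneg _).trans (hf.1 0 le_rfl)
  rcases le_total 0 x with hx | hx
  · exact (hf.1 x hx).trans (mul_le_of_le_one_right hK (exp_le_one_iff.2 (by linarith)))
  · exact (hf.2 x hx).trans (mul_le_of_le_one_right hK (exp_le_one_iff.2 (by linarith)))

section kernel

variable {g K : ℝ} {f f' : ℝ → ℝ}

/-- The kernel `e^{g y} / (1 + e^{3 y})`. -/
noncomputable def fermi (g y : ℝ) : ℝ := exp (g * y) / (1 + exp (3 * y))

lemma fermi_pos (g y : ℝ) : 0 < fermi g y := by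
  rw [fermi]; positivity

lemma fermi_mul (g y : ℝ) : fermi g y * (1 + exp (3 * y)) = exp (g * y) := by
  rw [fermi]; field_simp

lemma continuous_fermi (g : ℝ) : Continuous (fermi g) :=
  (show Continuous fun y : ℝ => exp (g * y) by fun_prop).div (by fun_prop)
    fun y => by positivity

lemma integrable_fermi (h0 : 0 < g) (h3 : g < 3) : Integrable (fermi g) := by
  refine integrable_of_exp_bounds (continuous_fermi g).aestronglyMeasurable (a := g) (b := 3 - g)
    (C := 1) h0 (by linarith) (fun y _ => ?_) (fun y _ => ?_)
  · have := exp_pos (3 * y)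
    rw [abs_of_pos (fermi_pos g y), one_mul, fermi]
    exact div_le_self (exp_pos _).le (by linarith)
  · have := exp_pos (3 * y)
    rw [abs_of_pos (fermi_pos g y), one_mul, fermi, div_le_iff₀ (by positivity)]
    calc exp (g * y) = exp (-(3 - g) * y) * exp (3 * y) := by rw [← exp_add]; congr 1; ring
      _ ≤ _ := by gcongr; linarith

/-- The correlation `∫ f(y + t) e^{g y} / (1 + e^{3 y}) dy`. -/
noncomputable def kconv (g : ℝ) (f : ℝ → ℝ) (t : ℝ) : ℝ := ∫ y, f (y + t) * fermi g y

lemma integrable_mul_fermi (h0 : 0 < g) (h3 : g < 3) (hf : Continuous f) (hb : ∀ x, |f x| ≤ K)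
    (t : ℝ) : Integrable fun y => f (y + t) * fermi g y :=
  (integrable_fermi h0 h3).bdd_mul (c := K)
    (Continuous.aestronglyMeasurable (by fun_prop)) (ae_of_all _ fun y => hb (y + t))

lemma hasDerivAt_kconv (h0 : 0 < g) (h3 : g < 3) (hd : ∀ x, HasDerivAt f (f' x) x)
    (hf' : Continuous f') {K' : ℝ} (hb : ∀ x, |f x| ≤ K) (hb' : ∀ x, |f' x| ≤ K') (t : ℝ) :
    HasDerivAt (kconv g f) (kconv g f' t) t := by
  have hf : Continuous f := continuous_iff_continuousAt.2 fun x => (hd x).continuousAt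
  have hk := continuous_fermi g
  refine (hasDerivAt_integral_of_dominated_loc_of_deriv_le (s := Set.univ)
    (F := fun t y => f (y + t) * fermi g y) (F' := fun t y => f' (y + t) * fermi g y)
    (bound := fun y => K' * fermi g y) univ_mem
    (Eventually.of_forall fun t => Continuous.aestronglyMeasurable (by fun_prop))
    (integrable_mul_fermi h0 h3 hf hb t) (Continuous.aestronglyMeasurable (by fun_prop))
    (ae_of_all _ fun y t _ => ?_) ((integrable_fermi h0 h3).const_mul _)
    (ae_of_all _ fun y t _ => ?_)).2
  · rw [Real.norm_eq_abs, abs_mul, abs_of_pos (fermi_pos g y)]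
    exact mul_le_mul_of_nonneg_right (hb' _) (fermi_pos g y).le
  · exact ((hd (y + t)).comp_const_add y t).mul_const _

/-- A correlation with vanishing exponential moment decays at the faster rate `5/2`. -/
lemma PhiDecay.exists_kconv_le (hf : PhiDecay K f) (hc : Continuous f) (h0 : 0 < g)
    (h1 : g ≤ 1) (hm : ∫ x, exp (g * x) * f x = 0) :
    ∃ K', ∀ t, |kconv g f t| ≤ K' * exp (-(5 / 2) * t) := by
  refine ⟨∫ x, |exp (5 / 2 * x) * f x|, fun t => ?_⟩
  have i1 := (hf.integrable_exp_mul hc h0.le (by linarith)).comp_add_right t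
  have e1 : (fun y => exp (g * y) * f (y + t))
      = fun y => exp (-g * t) * (exp (g * (y + t)) * f (y + t)) := by
    funext y; rw [← mul_assoc, ← exp_add]; congr 2; ring
  have i2 : Integrable fun y => exp (g * y) * f (y + t) := e1 ▸ i1.const_mul _
  have v2 : ∫ y, exp (g * y) * f (y + t) = 0 := by
    rw [e1, integral_const_mul, integral_add_right_eq_self (fun y => exp (g * y) * f y), hm,
      mul_zero]
  have i3 := integrable_mul_fermi h0 (by linarith) hc hf.abs_le t
  have v3 : kconv g f t = ∫ y, (f (y + t) * fermi g y - exp (g * y) * f (y + t)) := by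
    rw [integral_sub i3 i2, v2, sub_zero, kconv]
  have i4 := ((hf.integrable_exp_mul hc (κ := 5 / 2) (by norm_num)
    (by norm_num)).abs.comp_add_right t).const_mul (exp (-(5 / 2) * t))
  have v4 : (∫ x, |exp (5 / 2 * x) * f x|) * exp (-(5 / 2) * t)
      = ∫ y, exp (-(5 / 2) * t) * |exp (5 / 2 * (y + t)) * f (y + t)| := by
    rw [integral_const_mul, integral_add_right_eq_self (fun x => |exp (5 / 2 * x) * f x|) t,
      mul_comm]
  rw [v3, v4, ← Real.norm_eq_abs]
  refine norm_integral_le_of_norm_le i4 (ae_of_all _ fun y => ?_)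
  have hk := fermi_mul g y
  have e2 : f (y + t) * fermi g y - exp (g * y) * f (y + t)
      = -(f (y + t) * (fermi g y * exp (3 * y))) := by rw [← hk]; ring
  have e3 : exp (-(5 / 2) * t) * |exp (5 / 2 * (y + t)) * f (y + t)|
      = |f (y + t)| * exp (5 / 2 * y) := by
    rw [abs_mul, abs_of_pos (exp_pos _), ← mul_assoc, ← exp_add, mul_comm]; congr 2; ring
  have hkp := fermi_pos g y
  rw [e2, e3, Real.norm_eq_abs, abs_neg, abs_mul,
    abs_of_pos (show 0 < fermi g y * exp (3 * y) by positivity)]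
  refine mul_le_mul_of_nonneg_left ?_ (abs_nonneg _)
  rcases le_total 0 y with hy | hy
  · calc fermi g y * exp (3 * y) ≤ exp (g * y) := by rw [← hk]; nlinarith
      _ ≤ _ := exp_le_exp.2 (by nlinarith)
  · have h4 : fermi g y ≤ 1 := by
      rw [fermi, div_le_one (by positivity)]
      have : exp (g * y) ≤ 1 := exp_le_one_iff.2 (by nlinarith)
      linarith [exp_pos (3 * y)]
    calc fermi g y * exp (3 * y) ≤ 1 * exp (3 * y) := by gcongr
      _ ≤ _ := by rw [one_mul]; exact exp_le_exp.2 (by linarith)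

end kernel

section reduction

variable {s g K : ℝ} {A : ℝ → ℝ}

/-- The integrand of the exponential remainder in `kconv_eq`. -/
noncomputable def remi (s g : ℝ) (A : ℝ → ℝ) (t y : ℝ) : ℝ :=
  exp ((s - 3) * t) * (exp ((g - 3) * y) * phi s A (y + t)) - exp (-s * y) * fermi g y / 4

lemma mul_fermi_eq (t y : ℝ) : A (y + t) * fermi g y
    = -(4 * sinh (3 / 2 * t) ^ 2) * (phi s A (y + t) * fermi g y)
      + exp (3 * t) * (exp (g * y) * phi s A (y + t)) + exp (-s * t) * remi s g A t y := by
  have hden : den (y + t) * phi s A (y + t) = A (y + t) + exp (-s * (y + t)) / 4 := by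
    rw [phi]; have := (den_pos (y + t)).ne'; field_simp
  have hk := fermi_mul g y
  have e1 : exp (3 * (y + t)) = exp (3 * y) * exp (3 * t) := by rw [← exp_add]; congr 1; ring
  have e2 : exp (-(3 * (y + t))) = exp (-(3 * y)) * exp (-(3 * t)) := by
    rw [← exp_add]; congr 1; ring
  have e3 : exp (3 * y) * exp (-(3 * y)) = 1 := by rw [← exp_add]; simp
  have e4 : exp (-s * t) * exp ((s - 3) * t) = exp (-(3 * t)) := by
    rw [← exp_add]; congr 1; ring
  have e5 : exp ((g - 3) * y) = exp (g * y) * exp (-(3 * y)) := by rw [← exp_add]; congr 1; ring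
  have e6 : exp (-s * (y + t)) = exp (-s * t) * exp (-s * y) := by rw [← exp_add]; congr 1; ring
  have e7 : 4 * sinh (3 / 2 * t) ^ 2 = exp (3 * t) + exp (-(3 * t)) - 2 := by
    have u1 : exp (3 * t) = exp (3 / 2 * t) ^ 2 := by
      rw [← Real.exp_nat_mul]; congr 1; push_cast; ring
    have u2 : exp (-(3 * t)) = exp (-(3 / 2 * t)) ^ 2 := by
      rw [← Real.exp_nat_mul]; congr 1; push_cast; ring
    have u3 : exp (3 / 2 * t) * exp (-(3 / 2 * t)) = 1 := by rw [← exp_add]; simp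
    rw [sinh_eq, u1, u2]; linear_combination -2 * u3
  rw [den, e1, e2, e6] at hden
  rw [remi, e5, e7]
  generalize exp (3 * y) = w at *
  generalize exp (-(3 * y)) = w' at *
  generalize exp (3 * t) = E at *
  generalize exp (-(3 * t)) = E' at *
  generalize exp (g * y) = G at *
  generalize exp (-s * t) = p at *
  generalize exp (-s * y) = q at *
  generalize phi s A (y + t) = F at *
  generalize fermi g y = k at *
  linear_combination (-k) * hden + (E * F + E' * w' * F) * hk - E' * F * k * e3 - G * w' * F * e4

lemma remi_shift (t r y : ℝ) : remi s g A (t + r) y - remi s g A r y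
    = exp ((s - g) * r) * (remi s g A t (y + r) - remi s g A 0 (y + r)) := by
  have e1 : exp ((s - 3) * (t + r)) * exp ((g - 3) * y)
      = exp ((s - g) * r) * (exp ((s - 3) * t) * exp ((g - 3) * (y + r))) := by
    simp only [← exp_add]; congr 1; ring
  have e2 : exp ((s - 3) * r) * exp ((g - 3) * y)
      = exp ((s - g) * r) * exp ((g - 3) * (y + r)) := by
    simp only [← exp_add]; congr 1; ring
  have e3 : y + (t + r) = y + r + t := by ring
  simp only [remi, e3, mul_zero, exp_zero, one_mul, add_zero]
  linear_combination phi s A (y + r + t) * e1 - phi s A (y + r) * e2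

/-- When the exponential moment of `φ` vanishes, the correlation of `A` equals `-Z` up to
exponentials. -/
lemma kconv_eq (h0 : 0 < g) (hgs : g < s) (hs1 : s ≤ 1) (hA : Continuous A)
    (hb : ∀ x, |A x| ≤ K) (hm : ∫ x, exp (g * x) * phi s A x = 0) :
    ∃ C₁ C₂, ∀ t, kconv g A t
      = -hillZ (kconv g (phi s A)) t + C₁ * exp (-s * t) + C₂ * exp (-g * t) := by
  have hK : 0 ≤ K := (abs_nonneg _).trans (hb 0)
  have hdec := phiDecay_phi (A := A) hK (h0.trans hgs).le hs1 hb
  have hφ := continuous_phi (s := s) hA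
  have iA := integrable_mul_fermi h0 (by linarith) hA hb
  have iφ := integrable_mul_fermi h0 (by linarith) hφ hdec.abs_le
  have e1 : ∀ t, (fun y => exp (g * y) * phi s A (y + t))
      = fun y => exp (-g * t) * (exp (g * (y + t)) * phi s A (y + t)) := fun t => by
    funext y; rw [← mul_assoc, ← exp_add]; congr 2; ring
  have iE : ∀ t, Integrable fun y => exp (g * y) * phi s A (y + t) := fun t =>
    e1 t ▸ ((hdec.integrable_exp_mul hφ h0.le (by linarith)).comp_add_right t).const_mul _
  have vE : ∀ t, ∫ y, exp (g * y) * phi s A (y + t) = 0 := fun t => by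
    rw [e1 t, integral_const_mul, integral_add_right_eq_self (fun y => exp (g * y) * phi s A y),
      hm, mul_zero]
  have iR : ∀ t, Integrable (remi s g A t) := fun t => by
    have := (((iA t).add ((iφ t).const_mul (4 * sinh (3 / 2 * t) ^ 2))).sub
      ((iE t).const_mul (exp (3 * t)))).const_mul (exp (s * t))
    refine this.congr (ae_of_all _ fun y => ?_)
    have e : exp (s * t) * exp (-s * t) = 1 := by rw [← exp_add]; simp
    simp only [Pi.add_apply, Pi.sub_apply]
    rw [mul_fermi_eq (s := s)]
    linear_combination remi s g A t y * e
  obtain ⟨P, hP⟩ : ∃ P : ℝ → ℝ, ∀ t, P t = ∫ y, remi s g A t y := ⟨_, fun _ => rfl⟩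
  have hU : ∀ t, kconv g A t = -hillZ (kconv g (phi s A)) t + exp (-s * t) * P t := by
    intro t
    have i1 := (iφ t).const_mul (-(4 * sinh (3 / 2 * t) ^ 2))
    have i2 := (iE t).const_mul (exp (3 * t))
    have i3 := (iR t).const_mul (exp (-s * t))
    have i12 : Integrable fun y => -(4 * sinh (3 / 2 * t) ^ 2) * (phi s A (y + t) * fermi g y)
        + exp (3 * t) * (exp (g * y) * phi s A (y + t)) := i1.add i2
    rw [kconv, integral_congr_ae (ae_of_all _ fun y => mul_fermi_eq (s := s) t y),
      integral_add i12 i3, integral_add i1 i2, integral_const_mul, integral_const_mul,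
      integral_const_mul, vE, hP, hillZ, kconv]
    ring
  have hshift : ∀ t r, P (t + r) - P r = exp ((s - g) * r) * (P t - P 0) := by
    intro t r
    rw [hP, hP, hP, hP, ← integral_sub (iR _) (iR _), ← integral_sub (iR _) (iR _)]
    simp_rw [remi_shift]
    rw [integral_const_mul, integral_add_right_eq_self (fun y => remi s g A t y - remi s g A 0 y)]
  have hb1 : 1 < exp (s - g) := one_lt_exp_iff.2 (by linarith)
  refine ⟨P 0 - (P 1 - P 0) / (exp (s - g) - 1), (P 1 - P 0) / (exp (s - g) - 1), fun t => ?_⟩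
  have u1 := hshift t 1
  have u2 := hshift 1 t
  rw [mul_one] at u1
  rw [add_comm] at u2
  have hPt : P t = P 0 + (P 1 - P 0) / (exp (s - g) - 1) * (exp ((s - g) * t) - 1) := by
    have : exp (s - g) - 1 ≠ 0 := by linarith
    field_simp
    linear_combination u2 - u1
  have e : exp (-s * t) * exp ((s - g) * t) = exp (-g * t) := by rw [← exp_add]; congr 1; ring
  rw [hU, hPt, ← e]
  ring

end reduction

section nonvanishing

variable {c : ℝ} {A : ℝ → ℝ}

/-- The derivative of `φ`, expressed through the equation satisfied by `A`. -/
noncomputable def phid (c : ℝ) (A : ℝ → ℝ) (x : ℝ) : ℝ :=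
  (lamc c * iteratedDeriv 0 A x - iteratedDeriv 3 A x + iteratedDeriv 1 A x) / 40

/-- The second derivative of `φ`, expressed through the equation satisfied by `A`. -/
noncomputable def phidd (c : ℝ) (A : ℝ → ℝ) (x : ℝ) : ℝ :=
  (lamc c * iteratedDeriv 1 A x - iteratedDeriv 4 A x + iteratedDeriv 2 A x) / 40

lemma IsAc.hasDerivAt_phi (h : IsAc c A) (x : ℝ) :
    HasDerivAt (phi (√c) A) (phid c A x) x := by
  refine ((((h.hasDerivAt_flux x).fun_sub (h.hasDerivAt_iteratedDeriv 2 x)).fun_add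
    (h.hasDerivAt_iteratedDeriv 0 x)).div_const 40).congr_of_eventuallyEq
      (Eventually.of_forall fun y => ?_)
  ring

lemma IsAc.hasDerivAt_phid (h : IsAc c A) (x : ℝ) :
    HasDerivAt (phid c A) (phidd c A x) x :=
  ((((h.hasDerivAt_iteratedDeriv 0 x).const_mul (lamc c)).fun_sub
    (h.hasDerivAt_iteratedDeriv 3 x)).fun_add (h.hasDerivAt_iteratedDeriv 1 x)).div_const 40

lemma IsAc.continuous_phid (h : IsAc c A) : Continuous (phid c A) :=
  continuous_iff_continuousAt.2 fun x => (h.hasDerivAt_phid x).continuousAt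

lemma IsAc.continuous_phidd (h : IsAc c A) : Continuous (phidd c A) := by
  have h1 := h.continuous_iteratedDeriv 1
  have h2 := h.continuous_iteratedDeriv 2
  have h4 := h.continuous_iteratedDeriv 4
  unfold phidd; fun_prop

lemma IsAc.exists_phidd_le (h : IsAc c A) : ∃ K, ∀ x, |phidd c A x| ≤ K := by
  obtain ⟨K1, -, h1⟩ := h.exists_bound (k := 1) (by norm_num)
  obtain ⟨K2, -, h2⟩ := h.exists_bound (k := 2) (by norm_num)
  obtain ⟨K4, -, h4⟩ := h.exists_bound (k := 4) (by norm_num)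
  refine ⟨(|lamc c| * K1 + K4 + K2) / 40, fun x => ?_⟩
  rw [phidd, abs_div, abs_of_pos (by norm_num : (0 : ℝ) < 40)]
  gcongr
  refine (abs_add_le _ _).trans (add_le_add ((abs_sub _ _).trans (add_le_add ?_ (h4 x))) (h2 x))
  rw [abs_mul]
  gcongr
  exact h1 x

lemma IsAc.phid_eq (h : IsAc c A) (x : ℝ) :
    phid c A x = -(3 * Th x) * phi (√c) A x
      + (iteratedDeriv 1 A x - √c * exp (-√c * x) / 4) / den x := by
  have h0 := h.hasDerivAt_iteratedDeriv 0 x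
  rw [iteratedDeriv_zero] at h0
  have h1 : HasDerivAt (fun y => 40 * phi (√c) A y)
      (4 * (-(3 * Th x * Q x ^ 3)) * A x + 4 * Q x ^ 3 * iteratedDeriv 1 A x + srcd (√c) x) x := by
    simp_rw [forty_mul_phi]
    exact (((hasDerivAt_Q_cube x).const_mul 4).fun_mul h0).fun_add (hasDerivAt_src _ x)
  have h2 := h1.unique ((h.hasDerivAt_phi x).const_mul 40)
  have h3 := forty_mul_phi (s := √c) (A := A) x
  have hd := (den_pos x).ne'
  rw [srcd, Q_cube_eq_div_den] at h2
  rw [src, Q_cube_eq_div_den] at h3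
  have h4 : (iteratedDeriv 1 A x - √c * exp (-√c * x) / 4) / den x
      = (4 * (10 / den x) * iteratedDeriv 1 A x - √c * exp (-√c * x) * (10 / den x)) / 40 := by
    field_simp; ring
  rw [h4]
  linear_combination (-1 / 40) * h2 + (3 * Th x / 40) * h3

lemma PhiDecay.add {K L : ℝ} {f g : ℝ → ℝ} (hf : PhiDecay K f) (hg : PhiDecay L g) :
    PhiDecay (K + L) fun x => f x + g x :=
  ⟨fun x hx => (abs_add_le _ _).trans
      ((add_le_add (hf.1 x hx) (hg.1 x hx)).trans_eq (add_mul _ _ _).symm),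
    fun x hx => (abs_add_le _ _).trans
      ((add_le_add (hf.2 x hx) (hg.2 x hx)).trans_eq (add_mul _ _ _).symm)⟩

lemma PhiDecay.bdd_mul {K C : ℝ} {f g : ℝ → ℝ} (hf : PhiDecay K f) (hg : ∀ x, |g x| ≤ C) :
    PhiDecay (C * K) fun x => g x * f x := by
  have hC : 0 ≤ C := (abs_nonneg _).trans (hg 0)
  refine ⟨fun x hx => ?_, fun x hx => ?_⟩ <;> rw [abs_mul, mul_assoc]
  · exact mul_le_mul (hg x) (hf.1 x hx) (abs_nonneg _) hC
  · exact mul_le_mul (hg x) (hf.2 x hx) (abs_nonneg _) hC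

lemma IsAc.exists_phiDecay_phid (h : IsAc c A) (hc1 : c < 1) :
    ∃ K, PhiDecay K (phid c A) := by
  obtain ⟨K, hK⟩ := h.exists_phiDecay hc1
  obtain ⟨K1, hK1, h1⟩ := h.exists_bound (k := 1) (by norm_num)
  have hs1 := sqrt_lt_one hc1
  have hs0 := Real.sqrt_nonneg c
  have hd : PhiDecay (K1 + 1) fun x => (iteratedDeriv 1 A x - √c * exp (-√c * x) / 4) / den x :=
    PhiDecay.div_den hK1 hs0 hs1.le fun x => by
      refine (abs_sub _ _).trans (add_le_add (h1 x) ?_)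
      rw [abs_of_nonneg (by positivity)]
      nlinarith [exp_pos (-√c * x)]
  have hb : ∀ x, |-(3 * Th x)| ≤ 3 := fun x => by
    rw [abs_neg, abs_mul, abs_of_pos (by norm_num : (0 : ℝ) < 3)]
    linarith [(abs_Th_lt_one x).le]
  have e : phid c A = fun x => -(3 * Th x) * phi (√c) A x
      + (iteratedDeriv 1 A x - √c * exp (-√c * x) / 4) / den x := funext h.phid_eq
  exact ⟨_, e ▸ (hK.bdd_mul hb).add hd⟩

lemma IsAc.integral_exp_mul_phid (h : IsAc c A) (hc : 3 / 4 ≤ c) (hc1 : c < 1) :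
    ∫ x, exp (gam c * x) * phid c A x = -(gam c * mom c A) := by
  obtain ⟨K, hK⟩ := h.exists_phiDecay hc1
  obtain ⟨L, hL⟩ := h.exists_phiDecay_phid hc1
  have h0 := gam_pos hc hc1
  have h3 : gam c < 3 := by linarith [gam_lt_sqrt hc hc1, sqrt_lt_one hc1]
  have i1 := hK.integrable_exp_mul (continuous_phi h.continuous) h0.le h3
  have i2 := hL.integrable_exp_mul h.continuous_phid h0.le h3
  have i3 := i1.const_mul (gam c)
  have hd : ∀ x, HasDerivAt (fun x => exp (gam c * x) * phi (√c) A x)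
      (gam c * (exp (gam c * x) * phi (√c) A x) + exp (gam c * x) * phid c A x) x := fun x => by
    have h1 : HasDerivAt (fun y => exp (gam c * y)) (gam c * exp (gam c * x)) x :=
      (((hasDerivAt_id' x).const_mul (gam c)).exp).congr_deriv (by ring)
    exact (h1.fun_mul (h.hasDerivAt_phi x)).congr_deriv (by ring)
  have := integral_eq_zero_of_hasDerivAt_of_integrable hd (i3.add i2) i1
  rw [integral_add i3 i2, integral_const_mul] at this
  rw [mom]; linarith

/-- If the moment of `φ` vanishes, the correlation of `φ` solves the Hill-type equation. -/
lemma IsAc.hillSol_of_mom_eq_zero (h : IsAc c A) (hc : 3 / 4 ≤ c) (hc1 : c < 1)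
    (hm : mom c A = 0) :
    HillSol (lamc c) (kconv (gam c) (phi (√c) A)) (kconv (gam c) (phid c A))
      (kconv (gam c) (phidd c A)) := by
  obtain ⟨g, hgd⟩ : ∃ g, g = gam c := ⟨_, rfl⟩
  have h0 : 0 < g := hgd ▸ gam_pos hc hc1
  have hgs : g < √c := hgd ▸ gam_lt_sqrt hc hc1
  have hs1 := sqrt_lt_one hc1
  have h3 : g < 3 := by linarith
  have hq : g ^ 2 + √c * g + √c ^ 2 = 1 := hgd ▸ gam_quadratic hc hc1
  have hlam : lamc c = g * √c * (g + √c) := hgd ▸ lamc_eq hc hc1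
  rw [mom, ← hgd] at hm
  rw [← hgd]
  obtain ⟨K, hK⟩ := h.exists_phiDecay hc1
  obtain ⟨L, hL⟩ := h.exists_phiDecay_phid hc1
  obtain ⟨M, hM⟩ := h.exists_phidd_le
  obtain ⟨K0, -, hK0⟩ := h.exists_bound (k := 0) (by norm_num)
  obtain ⟨K1, -, hK1⟩ := h.exists_bound (k := 1) (by norm_num)
  obtain ⟨K2, -, hK2⟩ := h.exists_bound (k := 2) (by norm_num)
  have dS := hasDerivAt_kconv h0 h3 h.hasDerivAt_phi h.continuous_phid hK.abs_le hL.abs_le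
  have dS1 := hasDerivAt_kconv h0 h3 h.hasDerivAt_phid h.continuous_phidd hL.abs_le hM
  refine ⟨dS, dS1, fun t => ?_⟩
  have dU := hasDerivAt_kconv h0 h3 (h.hasDerivAt_iteratedDeriv 0) (h.continuous_iteratedDeriv 1)
    hK0 hK1
  have dU1 := hasDerivAt_kconv h0 h3 (h.hasDerivAt_iteratedDeriv 1) (h.continuous_iteratedDeriv 2)
    hK1 hK2
  have dW : HasDerivAt (fun t => kconv g (iteratedDeriv 2 A) t - kconv g (iteratedDeriv 0 A) t
      + 40 * kconv g (phi (√c) A) t) (lamc c * kconv g (iteratedDeriv 0 A) t) t := by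
    have hb : ∀ x, |iteratedDeriv 2 A x - iteratedDeriv 0 A x + 40 * phi (√c) A x|
        ≤ K2 + K0 + 40 * K := fun x => by
      refine (abs_add_le _ _).trans (add_le_add ((abs_sub _ _).trans
        (add_le_add (hK2 x) (hK0 x))) ?_)
      rw [abs_mul, abs_of_pos (by norm_num : (0 : ℝ) < 40)]
      gcongr
      exact hK.abs_le x
    have hb' : ∀ x, |lamc c * iteratedDeriv 0 A x| ≤ |lamc c| * K0 := fun x => by
      rw [abs_mul]; gcongr; exact hK0 x
    have hc0 := h.continuous_iteratedDeriv 0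
    have := hasDerivAt_kconv h0 h3 h.hasDerivAt_flux (by fun_prop) hb hb' t
    have e1 : kconv g (fun x => lamc c * iteratedDeriv 0 A x) t
        = lamc c * kconv g (iteratedDeriv 0 A) t := by
      simp_rw [kconv, mul_assoc]; exact integral_const_mul _ _
    rw [e1] at this
    refine this.congr_of_eventuallyEq (Eventually.of_forall fun u => ?_)
    have i0 := integrable_mul_fermi h0 h3 hc0 hK0 u
    have i2 := integrable_mul_fermi h0 h3 (h.continuous_iteratedDeriv 2) hK2 u
    have iφ := (integrable_mul_fermi h0 h3 (continuous_phi (s := √c) h.continuous) hK.abs_le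
      u).const_mul 40
    have i20 : Integrable fun y => iteratedDeriv 2 A (y + u) * fermi g y
      - iteratedDeriv 0 A (y + u) * fermi g y := i2.sub i0
    simp only [kconv]
    rw [← integral_sub i2 i0, ← integral_const_mul, ← integral_add i20 iφ]
    congr 1; funext y; ring
  obtain ⟨C₁, C₂, hE⟩ := kconv_eq h0 hgs hs1.le h.continuous
    (by simpa only [iteratedDeriv_zero] using hK0) hm
  have dE : ∀ a b : ℝ, ∀ u, HasDerivAt (fun u => a * exp (-√c * u) + b * exp (-g * u))
      (-√c * a * exp (-√c * u) + -g * b * exp (-g * u)) u := fun a b u =>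
    (((hasDerivAt_exp_neg_mul _ u).const_mul a).fun_add
      ((hasDerivAt_exp_neg_mul _ u).const_mul b)).congr_deriv (by ring)
  have hZ : hillZ (kconv g (phi (√c) A)) = fun u => -kconv g (iteratedDeriv 0 A) u
      + (C₁ * exp (-√c * u) + C₂ * exp (-g * u)) := by
    funext u; rw [iteratedDeriv_zero, hE u]; ring
  have hZ1 : hillZ1 (kconv g (phi (√c) A)) (kconv g (phid c A))
      = fun u => -kconv g (iteratedDeriv 1 A) u
        + (-√c * C₁ * exp (-√c * u) + -g * C₂ * exp (-g * u)) := by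
    funext u
    refine (hasDerivAt_hillZ dS u).unique ?_
    rw [hZ]
    exact (dU u).fun_neg.fun_add (dE _ _ u)
  have hZ2 : ∀ u, hillZ2 (kconv g (phi (√c) A)) (kconv g (phid c A)) (kconv g (phidd c A)) u
      = -kconv g (iteratedDeriv 2 A) u
        + (-√c * (-√c * C₁) * exp (-√c * u) + -g * (-g * C₂) * exp (-g * u)) := by
    intro u
    refine (hasDerivAt_hillZ1 dS dS1 u).unique ?_
    rw [hZ1]
    exact (dU1 u).fun_neg.fun_add (dE _ _ u)
  refine ((dW.fun_neg.fun_add (dE (-√c * (-√c * C₁)) (-g * (-g * C₂)) t)).fun_sub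
    (dE C₁ C₂ t) |>.congr_deriv ?_).congr_of_eventuallyEq (Eventually.of_forall fun u => ?_)
  · rw [hZ, hlam]
    linear_combination -(√c * C₁ * exp (-√c * t) + g * C₂ * exp (-g * t)) * hq
  · simp only [hZ2, hZ]; ring

/-- The exponential moment of `φ` does not vanish. -/
lemma IsAc.mom_ne_zero (h : IsAc c A) (hc : 3 / 4 ≤ c) (hc1 : c < 1) : mom c A ≠ 0 := by
  intro hm
  have h0 := gam_pos hc hc1
  have hgs := gam_lt_sqrt hc hc1
  have hs1 := sqrt_lt_one hc1
  have hs0 := half_le_sqrt hc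
  have hsol := h.hillSol_of_mom_eq_zero hc hc1 hm
  obtain ⟨K, hK⟩ := h.exists_phiDecay hc1
  obtain ⟨L, hL⟩ := h.exists_phiDecay_phid hc1
  obtain ⟨K', hK'⟩ := hK.exists_kconv_le (continuous_phi h.continuous) h0 (by linarith) hm
  obtain ⟨L', hL'⟩ := hL.exists_kconv_le h.continuous_phid h0 (by linarith)
    (by rw [h.integral_exp_mul_phid hc hc1, hm]; simp)
  have hz : ∀ t ≤ 0, kconv (gam c) (phi (√c) A) t = 0 := fun t ht =>
    hsol.eq_zero_of_decay (K := max K' L') (lamc_pos hc hc1) (lamc_le_one hc hc1)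
      (fun t _ => (hK' t).trans (by gcongr; exact le_max_left _ _))
      (fun t _ => (hL' t).trans (by gcongr; exact le_max_right _ _)) ht
  obtain ⟨M, hM, hMb⟩ := h.exists_bound (k := 0) (by norm_num)
  rw [iteratedDeriv_zero] at hMb
  obtain ⟨f, hf⟩ : ∃ f : ℝ → ℝ, ∀ x, f x = exp (-(3 - √c) * x) * phi (√c) A x := ⟨_, fun _ => rfl⟩
  have hfe : ∀ x, f x = (A x * exp (√c * x) + 1 / 4) / (exp (3 * x) + 1) ^ 2 := fun x => by
    have e1 : den x = exp (-(3 * x)) * (exp (3 * x) + 1) ^ 2 := by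
      have : exp (-(3 * x)) * exp (3 * x) = 1 := by rw [← exp_add]; simp
      rw [den]; linear_combination (-exp (3 * x) - 2) * this
    have e2 : exp (-√c * x) * exp (√c * x) = 1 := by rw [← exp_add]; simp
    have e3 : exp (-(3 - √c) * x) = exp (-(3 * x)) * exp (√c * x) := by
      rw [← exp_add]; congr 1; ring
    have h1 := exp_pos (-(3 * x))
    have h2 := exp_pos (3 * x)
    rw [hf, phi, e1, e3]
    generalize exp (-(3 * x)) = u at *
    generalize exp (3 * x) = v at *
    generalize exp (-√c * x) = p at *
    generalize exp (√c * x) = q at *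
    field_simp
    linear_combination e2
  have hfc : Continuous f := by
    have := continuous_phi (s := √c) h.continuous
    rw [funext hf]; fun_prop
  have hfb : ∀ x, |f x| ≤ M + 1 := fun x => by
    have h1 := exp_pos (3 * x)
    have h2 : exp (√c * x) ≤ (exp (3 * x) + 1) ^ 2 := by
      rcases le_total 0 x with hx | hx
      · have : exp (√c * x) ≤ exp (3 * x) := exp_le_exp.2 (by nlinarith)
        nlinarith
      · have : exp (√c * x) ≤ 1 := exp_le_one_iff.2 (by nlinarith)
        nlinarith
    have h3 : |A x * exp (√c * x)| ≤ M * (exp (3 * x) + 1) ^ 2 := by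
      rw [abs_mul, abs_of_pos (exp_pos _)]
      exact mul_le_mul (hMb x) h2 (exp_pos _).le hM
    rw [hfe, abs_div, abs_of_pos (show 0 < (exp (3 * x) + 1) ^ 2 by positivity),
      div_le_iff₀ (by positivity)]
    refine (abs_add_le _ _).trans ?_
    rw [abs_of_pos (by norm_num : (0 : ℝ) < 1 / 4)]
    nlinarith
  have hexp : ∀ r : ℝ, 0 < r → Tendsto (fun x => exp (r * x)) atBot (nhds 0) := fun r hr =>
    tendsto_exp_atBot.comp (tendsto_id.const_mul_atBot hr)
  have hlim : Tendsto f atBot (nhds (1 / 4)) := by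
    have h1 : Tendsto (fun x => A x * exp (√c * x)) atBot (nhds 0) := by
      refine squeeze_zero_norm (a := fun x => M * exp (√c * x)) (fun x => ?_)
        (by simpa using (hexp _ (by linarith)).const_mul M)
      rw [norm_mul, Real.norm_eq_abs, Real.norm_eq_abs, abs_of_pos (exp_pos _)]
      exact mul_le_mul_of_nonneg_right (hMb x) (exp_pos _).le
    rw [funext hfe]
    have h2 := (h1.add_const (1 / 4)).div (((hexp 3 (by norm_num)).add_const 1).pow 2)
      (by norm_num)
    rwa [zero_add, zero_add, one_pow, div_one] at h2
  have hg' : 0 < gam c + (3 - √c) := by linarith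
  have hik := integrable_fermi hg' (by linarith)
  have hT : Tendsto (fun t => ∫ y, f (y + t) * fermi (gam c + (3 - √c)) y) atBot
      (nhds (∫ y, 1 / 4 * fermi (gam c + (3 - √c)) y)) := by
    refine tendsto_integral_filter_of_dominated_convergence
      (fun y => (M + 1) * fermi (gam c + (3 - √c)) y)
      (Eventually.of_forall fun t => ?_) (Eventually.of_forall fun t => ae_of_all _ fun y => ?_)
      (hik.const_mul _) (ae_of_all _ fun y => ?_)
    · have := continuous_fermi (gam c + (3 - √c))
      exact Continuous.aestronglyMeasurable (by fun_prop)
    · rw [norm_mul, Real.norm_eq_abs, Real.norm_eq_abs, abs_of_pos (fermi_pos _ y)]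
      exact mul_le_mul_of_nonneg_right (hfb _) (fermi_pos _ y).le
    · exact (hlim.comp (tendsto_atBot_add_const_left _ y tendsto_id)).mul_const _
  have hz' : ∀ t ≤ 0, ∫ y, f (y + t) * fermi (gam c + (3 - √c)) y = 0 := fun t ht => by
    have e : (fun y => f (y + t) * fermi (gam c + (3 - √c)) y)
        = fun y => exp (-(3 - √c) * t) * (phi (√c) A (y + t) * fermi (gam c) y) := by
      funext y
      have e1 : exp (-(3 - √c) * (y + t)) * exp ((gam c + (3 - √c)) * y)
          = exp (-(3 - √c) * t) * exp (gam c * y) := by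
        simp only [← exp_add]; congr 1; ring
      rw [hf, fermi, fermi]
      linear_combination (phi (√c) A (y + t) / (1 + exp (3 * y))) * e1
    have := hz t ht
    rw [kconv] at this
    rw [e, integral_const_mul, this, mul_zero]
  have h1 : ∫ y, 1 / 4 * fermi (gam c + (3 - √c)) y = 0 :=
    tendsto_nhds_unique hT (tendsto_const_nhds.congr' (by
      filter_upwards [eventually_le_atBot 0] with t ht using (hz' t ht).symm))
  rw [integral_const_mul] at h1
  have h2 : 0 < ∫ y, fermi (gam c + (3 - √c)) y :=
    (integral_pos_iff_support_of_nonneg (fun y => (fermi_pos _ y).le) hik).2 (by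
      rw [Function.support_eq_univ fun y => (fermi_pos _ y).ne', Real.volume_univ]
      exact ENNReal.zero_lt_top)
  linarith

end nonvanishing

/-- Lipschitz dependence of `A_c` in `c` (in `H³`), and continuity and
constant sign of `c ↦ a_c^I` on `[3/4, 1)`. -/
theorem continuity_of_aI
    (A : ℝ → ℝ → ℝ) (aI : ℝ → ℝ)
    (hA : ∀ c : ℝ, 3 / 4 ≤ c → c < 1 → IsAc c (A c))
    (haI : ∀ c : ℝ, 3 / 4 ≤ c → c < 1 →
      Tendsto (fun x => A c x
          * Real.exp ((Real.sqrt (1 - 3 / 4 * c) - 1 / 2 * Real.sqrt c) * x))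
        atTop (nhds (aI c))) :
    (∀ c : ℝ, 3 / 4 < c → c < 1 → ∃ C : ℝ, 0 < C ∧ ∃ δ : ℝ, 0 < δ ∧
      ∀ c' : ℝ, 3 / 4 ≤ c' → c' < 1 → |c - c'| < δ →
        (∑ k ∈ Finset.range 4,
          ∫ x : ℝ, (iteratedDeriv k (A c) x - iteratedDeriv k (A c') x) ^ 2)
          ≤ C ^ 2 * |c - c'| ^ 2) ∧
    ContinuousOn aI (Set.Ico (3 / 4 : ℝ) 1) ∧
    ((∀ c ∈ Set.Ico (3 / 4 : ℝ) 1, 0 < aI c) ∨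
      (∀ c ∈ Set.Ico (3 / 4 : ℝ) 1, aI c < 0)) := by
  have haI' : ∀ c : ℝ, 3 / 4 ≤ c → c < 1 →
      Tendsto (fun x => A c x * exp (gam c * x)) atTop (nhds (aI c)) := haI
  have hcont := continuousOn_leading_coeff hA haI'
  have hne : ∀ c ∈ Set.Ico (3 / 4 : ℝ) 1, aI c ≠ 0 := by
    rintro c ⟨hc, hc1⟩ h0
    have h := (hA c hc hc1).leading_coeff_eq hc hc1 (haI' c hc hc1)
    rw [h0, mul_zero, zero_eq_neg, mul_eq_zero, mul_eq_zero] at h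
    rcases h with (h | h) | h
    · norm_num at h
    · exact (gam_pos hc hc1).ne' h
    · exact (hA c hc hc1).mom_ne_zero hc hc1 h
  refine ⟨fun c hc hc1 => lipschitz_H3 hA hc.le hc1, hcont, ?_⟩
  by_contra! hcon
  obtain ⟨⟨a, ha, ha0⟩, b, hb, hb0⟩ := hcon
  obtain ⟨c, hc, hc0⟩ := isPreconnected_Ico.intermediate_value ha hb hcont ⟨ha0, hb0⟩
  exact hne c hc hc0
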